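/- arXiv:1101.3074 — 2 statements merged into one kernel-verified Lean document; each statement's English description precedes it below -/
import Mathlib

section
/- Let 0 < ε < 1 and C > 0 be constants. There exist constants r₀ and c (depending only on C and ε) such that the following holds for all sufficiently large n. Let M be an (n−1)×(n−1) symmetric matrix with entries ±1 of rank n−2, let a_{ij} (1 ≤ i,j ≤ n−1) denote its cofactors (a_{ij} = (−1)^{i+j} times the determinant of M with row i and column j deleted), and suppose that P(Σ_{i,j} a_{ij} x_i x_j = 0) ≥ n^{−C}, where x₁,…,x_{n−1} are independent Rademacher random variables. Then there exists a nonzero vector u = (u₁,…,u_{n−1}) ∈ ℝ^{n−1} such that: (i) all but at most n^ε of the coordinates u_i belong to a proper symmetric GAP of rank at most r₀ and size at most n^c; (ii) every coordinate u_i is rational of the form p/q with integers |p|, |q| ≤ n^{c·n^ε}, q ≠ 0; and (iii) u is orthogonal to at least n − c·n^ε of the rows of M. -/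
open scoped Classical BigOperators

noncomputable section

/-- `Q` is a proper symmetric generalized arithmetic progression (GAP) of rank at most `r`
and size at most `s`: there are `r' ≤ r` generators `g i` and dimensions `N i` such that
`Q = {Σ mᵢ gᵢ : |mᵢ| ≤ Nᵢ}`, the representation is unique (properness), and the volume
`∏ (2Nᵢ + 1)` (which equals `|Q|` by properness) is at most `s`. -/
def IsProperSymGAPSet (Q : Set ℝ) (r : ℕ) (s : ℝ) : Prop :=
  ∃ (r' : ℕ) (g : Fin r' → ℝ) (N : Fin r' → ℕ),
    r' ≤ r ∧
    Q = {x : ℝ | ∃ m : Fin r' → ℤ, (∀ i, |m i| ≤ (N i : ℤ)) ∧ x = ∑ i, (m i : ℝ) * g i} ∧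
    (∀ m m' : Fin r' → ℤ, (∀ i, |m i| ≤ (N i : ℤ)) → (∀ i, |m' i| ≤ (N i : ℤ)) →
      (∑ i, (m i : ℝ) * g i) = (∑ i, (m' i : ℝ) * g i) → m = m') ∧
    (∏ i, (2 * (N i : ℝ) + 1)) ≤ s

/-- The real number (±1) corresponding to a Boolean sign bit. -/
def signv (b : Bool) : ℝ := if b then 1 else -1

/-- Probability of an event for a vector of `n` iid Rademacher random variables. -/
def probRad (n : ℕ) (E : (Fin n → ℝ) → Prop) : ℝ :=
  ((Finset.univ.filter fun x : Fin n → Bool => E fun i => signv (x i)).card : ℝ) / 2 ^ n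

/-- The product `∏ cos(w θ)^(2h)` over the members `w` of a list. -/
def cosProd (h : ℕ) (L : List ℤ) (θ : ℝ) : ℝ :=
  (L.map fun w => Real.cos ((w : ℝ) * θ) ^ (2 * h)).prod

/-- The normalised Fourier coefficient of `cosProd h L` at frequency `2x`. -/
def fourierCos (h : ℕ) (L : List ℤ) (x : ℤ) : ℝ :=
  (2 * Real.pi)⁻¹ * ∫ θ in (0 : ℝ)..(2 * Real.pi), cosProd h L θ * Real.cos (2 * (x : ℝ) * θ)

/-- All sums `∑ jᵢ wᵢ` over the list, with `|jᵢ| ≤ h`. -/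
def walkSupport (h : ℕ) : List ℤ → Set ℤ
  | [] => {0}
  | v :: L => {s | ∃ j : ℤ, |j| ≤ (h : ℤ) ∧ s - j * v ∈ walkSupport h L}

/-- The normalised integral of `cosProd h L` times the remaining absolute cosines. -/
def mixedCos {ι : Type*} (h : ℕ) (L : List ℤ) (v : ι → ℤ) (R : Finset ι) : ℝ :=
  (2 * Real.pi)⁻¹ * ∫ θ in (0 : ℝ)..(2 * Real.pi),
    cosProd h L θ * ∏ i ∈ R, |Real.cos ((v i : ℝ) * θ)|

lemma cosProd_cons (h : ℕ) (v : ℤ) (L : List ℤ) (θ : ℝ) :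
    cosProd h (v :: L) θ = Real.cos ((v : ℝ) * θ) ^ (2 * h) * cosProd h L θ := by
  simp [cosProd]

lemma cosProd_nonneg (h : ℕ) (L : List ℤ) (θ : ℝ) : 0 ≤ cosProd h L θ := by
  induction L with
  | nil => simp [cosProd]
  | cons v L ih =>
    rw [cosProd_cons]
    exact mul_nonneg (by rw [pow_mul]; positivity) ih

@[fun_prop]
lemma continuous_cosProd (h : ℕ) (L : List ℤ) : Continuous (cosProd h L) := by
  induction L with
  | nil => exact continuous_const (y := (1 : ℝ))
  | cons v L ih =>
    have : cosProd h (v :: L) = fun θ => Real.cos ((v : ℝ) * θ) ^ (2 * h) * cosProd h L θ :=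
      funext fun θ => cosProd_cons h v L θ
    rw [this]
    fun_prop

lemma cos_pow_mul_cos (h : ℕ) (α β : ℝ) :
    Real.cos α ^ (2 * h) * Real.cos β =
      ∑ b ∈ Finset.range (2 * h + 1), ((2 * h).choose b : ℝ) / 4 ^ h *
        Real.cos (β + 2 * ((b : ℝ) - h) * α) := by
  have key : (Complex.cos α) ^ (2 * h) * Complex.exp (β * Complex.I) =
      ∑ b ∈ Finset.range (2 * h + 1), ((2 * h).choose b : ℂ) / 4 ^ h *
        Complex.exp (((β + 2 * ((b : ℝ) - h) * α : ℝ) : ℂ) * Complex.I) := by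
    rw [Complex.cos, div_pow, add_pow, Finset.sum_div, Finset.sum_mul]
    refine Finset.sum_congr rfl fun b hb => ?_
    have hb' : b ≤ 2 * h := Nat.lt_succ_iff.1 (Finset.mem_range.1 hb)
    have h4 : (2 : ℂ) ^ (2 * h) = 4 ^ h := by rw [pow_mul]; norm_num
    rw [h4, ← Complex.exp_nat_mul, ← Complex.exp_nat_mul]
    have : Complex.exp (((β + 2 * ((b : ℝ) - h) * α : ℝ) : ℂ) * Complex.I) =
        Complex.exp (b * (α * Complex.I)) * Complex.exp (((2 * h - b : ℕ) : ℂ) * (-α * Complex.I))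
          * Complex.exp (β * Complex.I) := by
      rw [← Complex.exp_add, ← Complex.exp_add]
      congr 1
      push_cast [Nat.cast_sub hb']
      ring
    rw [this]
    ring
  have := congrArg Complex.re key
  rw [← Complex.ofReal_cos, ← Complex.ofReal_pow, Complex.re_ofReal_mul,
    Complex.exp_ofReal_mul_I_re, Complex.re_sum] at this
  rw [this]
  refine Finset.sum_congr rfl fun b _ => ?_
  have : ((2 * h).choose b : ℂ) / 4 ^ h = (((2 * h).choose b / 4 ^ h : ℝ) : ℂ) := by push_cast; rfl
  rw [this, Complex.re_ofReal_mul, Complex.exp_ofReal_mul_I_re]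

lemma fourierCos_cons (h : ℕ) (v : ℤ) (L : List ℤ) (x : ℤ) :
    fourierCos h (v :: L) x = ∑ b ∈ Finset.range (2 * h + 1),
      ((2 * h).choose b : ℝ) / 4 ^ h * fourierCos h L (x + ((b : ℤ) - h) * v) := by
  have : ∀ θ : ℝ, cosProd h (v :: L) θ * Real.cos (2 * (x : ℝ) * θ) =
      ∑ b ∈ Finset.range (2 * h + 1), ((2 * h).choose b : ℝ) / 4 ^ h *
        (cosProd h L θ * Real.cos (2 * ((x + ((b : ℤ) - h) * v : ℤ) : ℝ) * θ)) := by
    intro θ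
    rw [cosProd_cons, mul_right_comm, cos_pow_mul_cos, Finset.sum_mul]
    refine Finset.sum_congr rfl fun b _ => ?_
    have : 2 * (x : ℝ) * θ + 2 * ((b : ℝ) - h) * (v * θ) =
        2 * ((x + ((b : ℤ) - h) * v : ℤ) : ℝ) * θ := by push_cast; ring
    rw [this]; ring
  unfold fourierCos
  simp_rw [this]
  rw [intervalIntegral.integral_finsetSum, Finset.mul_sum]
  · refine Finset.sum_congr rfl fun b _ => ?_
    rw [intervalIntegral.integral_const_mul]; ring
  · intro b _
    apply Continuous.intervalIntegrable
    fun_prop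

lemma fourierCos_nil (h : ℕ) (x : ℤ) : fourierCos h [] x = if x = 0 then 1 else 0 := by
  have hpi := Real.pi_pos
  have h1 : ∀ θ, cosProd h [] θ = 1 := fun θ => by simp [cosProd]
  simp only [fourierCos, h1, one_mul]
  split_ifs with hx
  · subst hx
    simp
    field_simp
  · have h0 : (2 * (x : ℝ)) ≠ 0 := by
      have : (x : ℝ) ≠ 0 := by exact_mod_cast hx
      positivity
    rw [intervalIntegral.integral_comp_mul_left (fun θ => Real.cos θ) h0, integral_cos]
    have : Real.sin (2 * x * (2 * Real.pi)) = 0 := by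
      have := Real.sin_int_mul_pi (4 * x)
      push_cast at this
      rw [← this]; congr 1; ring
    simp [this]

lemma fourierCos_le (h : ℕ) (L : List ℤ) (x : ℤ) : fourierCos h L x ≤ fourierCos h L 0 := by
  have hpi := Real.pi_pos
  unfold fourierCos
  gcongr
  apply intervalIntegral.integral_mono_on (by positivity)
  · apply Continuous.intervalIntegrable; fun_prop
  · apply Continuous.intervalIntegrable; fun_prop
  · intro θ _
    have := cosProd_nonneg h L θ
    gcongr
    simpa using Real.cos_le_one _

lemma fourierCos_zero_nonneg (h : ℕ) (L : List ℤ) : 0 ≤ fourierCos h L 0 := by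
  have hpi := Real.pi_pos
  unfold fourierCos
  refine mul_nonneg (by positivity) (intervalIntegral.integral_nonneg (by positivity) ?_)
  intro θ _
  simpa using cosProd_nonneg h L θ

lemma mem_walkSupport_of_fourierCos_ne_zero (h : ℕ) (L : List ℤ) :
    ∀ x : ℤ, fourierCos h L x ≠ 0 → x ∈ walkSupport h L := by
  induction L with
  | nil =>
    intro x hx
    rw [fourierCos_nil] at hx
    by_contra hne
    simp_all [walkSupport]
  | cons v L ih =>
    intro x hx
    rw [fourierCos_cons] at hx
    obtain ⟨b, hb, hne⟩ := Finset.exists_ne_zero_of_sum_ne_zero hx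
    have hb' := Finset.mem_range.1 hb
    refine ⟨(h : ℤ) - b, ?_, ?_⟩
    · rw [abs_le]; constructor <;> omega
    · have := ih _ (right_ne_zero_of_mul hne)
      convert this using 1
      ring

lemma mixedCos_le (h : ℕ) (L : List ℤ) {ι : Type*} (v : ι → ℤ) (R : Finset ι) :
    mixedCos h L v R ≤ fourierCos h L 0 := by
  have hpi := Real.pi_pos
  unfold fourierCos mixedCos
  gcongr
  apply intervalIntegral.integral_mono_on (by positivity)
  · apply Continuous.intervalIntegrable; fun_prop
  · apply Continuous.intervalIntegrable; fun_prop
  · intro θ _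
    have := cosProd_nonneg h L θ
    gcongr
    simpa using Finset.prod_le_one (fun i _ => abs_nonneg _)
      (fun i _ => Real.abs_cos_le_one ((v i : ℝ) * θ))

lemma prod_le_avg_pow {ι : Type*} (S : Finset ι) {m : ℕ} (hm : m ≠ 0) (hS : S.card = m)
    (a : ι → ℝ) (ha : ∀ i, 0 ≤ a i) :
    ∏ i ∈ S, a i ≤ ∑ i ∈ S, (m : ℝ)⁻¹ * a i ^ m := by
  have := Real.geom_mean_le_arith_mean_weighted S (fun _ => (m : ℝ)⁻¹) (fun i => a i ^ m)
    (fun _ _ => by positivity) (by simp [hS, hm]) (fun i _ => pow_nonneg (ha i) m)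
  refine le_trans (le_of_eq ?_) this
  refine Finset.prod_congr rfl fun i _ => ?_
  rw [Real.pow_rpow_inv_natCast (ha i) hm]

lemma exists_mixedCos_le (h : ℕ) (hh : 1 ≤ h) (L : List ℤ) {ι : Type*} [DecidableEq ι] (v : ι → ℤ)
    (R S : Finset ι) (hSR : S ⊆ R) (hS : S.card = 2 * h) :
    ∃ i ∈ S, mixedCos h L v R ≤ mixedCos h (v i :: L) v (R \ S) := by
  have hpi := Real.pi_pos
  have hm : 2 * h ≠ 0 := by omega
  have hne : S.Nonempty := by rw [← Finset.card_pos]; omega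
  by_contra! hcon
  have key : mixedCos h L v R ≤
      ∑ i ∈ S, ((2 * h : ℕ) : ℝ)⁻¹ * mixedCos h (v i :: L) v (R \ S) := by
    have e : ∑ i ∈ S, ((2 * h : ℕ) : ℝ)⁻¹ * mixedCos h (v i :: L) v (R \ S) =
        (2 * Real.pi)⁻¹ * ∫ θ in (0 : ℝ)..(2 * Real.pi), ∑ i ∈ S, ((2 * h : ℕ) : ℝ)⁻¹ *
          (cosProd h (v i :: L) θ * ∏ i ∈ R \ S, |Real.cos ((v i : ℝ) * θ)|) := by
      rw [intervalIntegral.integral_finsetSum, Finset.mul_sum]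
      · refine Finset.sum_congr rfl fun i _ => ?_
        rw [intervalIntegral.integral_const_mul, mixedCos]; ring
      · intro i _
        apply Continuous.intervalIntegrable; fun_prop
    rw [e, mixedCos]
    · gcongr _ * ?_
      apply intervalIntegral.integral_mono_on (by positivity)
      · apply Continuous.intervalIntegrable; fun_prop
      · apply Continuous.intervalIntegrable; fun_prop
      intro θ _
      have h1 := prod_le_avg_pow S hm hS (fun i => |Real.cos ((v i : ℝ) * θ)|)
        (fun i => abs_nonneg _)
      have h2 : 0 ≤ cosProd h L θ * ∏ i ∈ R \ S, |Real.cos ((v i : ℝ) * θ)| :=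
        mul_nonneg (cosProd_nonneg _ _ _) (Finset.prod_nonneg fun i _ => abs_nonneg _)
      have h3 := mul_le_mul_of_nonneg_left h1 h2
      rw [← Finset.prod_sdiff hSR, ← mul_assoc]
      refine h3.trans (le_of_eq ?_)
      rw [Finset.mul_sum]
      refine Finset.sum_congr rfl fun i _ => ?_
      rw [cosProd_cons, pow_mul, sq_abs, ← pow_mul]
      ring
  have h4 : ∑ i ∈ S, ((2 * h : ℕ) : ℝ)⁻¹ * mixedCos h (v i :: L) v (R \ S) <
      ∑ i ∈ S, ((2 * h : ℕ) : ℝ)⁻¹ * mixedCos h L v R := by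
    apply Finset.sum_lt_sum_of_nonempty hne
    intro i hi
    have : (0 : ℝ) < ((2 * h : ℕ) : ℝ)⁻¹ := by positivity
    exact mul_lt_mul_of_pos_left (hcon i hi) this
  have h5 : ∑ i ∈ S, ((2 * h : ℕ) : ℝ)⁻¹ * mixedCos h L v R = mixedCos h L v R := by
    rw [Finset.sum_const, hS, nsmul_eq_mul, ← mul_assoc, mul_inv_cancel₀, one_mul]
    exact_mod_cast hm
  linarith

lemma sum_cos_signv (p : ℕ) (v : Fin p → ℤ) (θ : ℝ) :
    ∑ x : Fin p → Bool, Real.cos ((∑ i, (v i : ℝ) * signv (x i)) * θ) =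
      2 ^ p * ∏ i, Real.cos ((v i : ℝ) * θ) := by
  have key : ∑ x : Fin p → Bool,
      Complex.exp ((((∑ i, (v i : ℝ) * signv (x i)) * θ : ℝ) : ℂ) * Complex.I) =
      ((2 ^ p * ∏ i, Real.cos ((v i : ℝ) * θ) : ℝ) : ℂ) := by
    have h1 : ∀ x : Fin p → Bool,
        Complex.exp ((((∑ i, (v i : ℝ) * signv (x i)) * θ : ℝ) : ℂ) * Complex.I) =
        ∏ i, Complex.exp ((((v i : ℝ) * signv (x i) * θ : ℝ) : ℂ) * Complex.I) := by
      intro x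
      rw [← Complex.exp_sum]
      congr 1
      push_cast
      rw [Finset.sum_mul, Finset.sum_mul]
    simp_rw [h1]
    rw [← Fintype.prod_sum (fun (i : Fin p) (b : Bool) =>
      Complex.exp ((((v i : ℝ) * signv b * θ : ℝ) : ℂ) * Complex.I))]
    have h2 : (2 : ℝ) ^ p = ∏ _i : Fin p, (2 : ℝ) := by simp
    rw [h2, ← Finset.prod_mul_distrib, Complex.ofReal_prod]
    refine Finset.prod_congr rfl fun i _ => ?_
    rw [Fintype.sum_bool]
    push_cast
    rw [Complex.cos]
    simp only [signv]
    push_cast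
    simp
    ring
  have := congrArg Complex.re key
  rw [Complex.re_sum, Complex.ofReal_re] at this
  rw [← this]
  refine Finset.sum_congr rfl fun x _ => ?_
  rw [Complex.exp_ofReal_mul_I_re]

lemma integral_cos_int (s : ℤ) :
    (2 * Real.pi)⁻¹ * ∫ θ in (0 : ℝ)..(2 * Real.pi), Real.cos ((s : ℝ) * θ) =
      if s = 0 then 1 else 0 := by
  have hpi := Real.pi_pos
  split_ifs with hs
  · subst hs
    simp
    field_simp
  · have h0 : (s : ℝ) ≠ 0 := by exact_mod_cast hs
    rw [intervalIntegral.integral_comp_mul_left (fun θ => Real.cos θ) h0, integral_cos]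
    have : Real.sin (s * (2 * Real.pi)) = 0 := by
      have := Real.sin_int_mul_pi (2 * s)
      push_cast at this
      rw [← this]; congr 1; ring
    simp [this]

lemma probRad_le_mixedCos (h p : ℕ) (v : Fin p → ℤ) :
    probRad p (fun x => ∑ i, (v i : ℝ) * x i = 0) ≤ mixedCos h [] v Finset.univ := by
  have hpi := Real.pi_pos
  have h2p : (0 : ℝ) < 2 ^ p := by positivity
  have hs : ∀ x : Fin p → Bool, ∃ s : ℤ, (s : ℝ) = ∑ i, (v i : ℝ) * signv (x i) := by
    intro x
    refine ⟨∑ i, v i * (if x i then 1 else -1), ?_⟩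
    push_cast
    simp [signv]
  choose s hs using hs
  have e1 : ((Finset.univ.filter fun x : Fin p → Bool =>
      ∑ i, (v i : ℝ) * signv (x i) = 0).card : ℝ) =
      (2 * Real.pi)⁻¹ * ∫ θ in (0 : ℝ)..(2 * Real.pi),
        2 ^ p * ∏ i, Real.cos ((v i : ℝ) * θ) := by
    simp_rw [← sum_cos_signv, ← hs]
    rw [intervalIntegral.integral_finsetSum, Finset.mul_sum]
    · simp_rw [integral_cos_int]
      simp
    · intro i _
      apply Continuous.intervalIntegrable; fun_prop
  unfold probRad
  rw [e1, intervalIntegral.integral_const_mul, mixedCos]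
  rw [← mul_assoc, mul_comm _ ((2 : ℝ) ^ p), mul_assoc, mul_div_cancel_left₀ _ h2p.ne']
  gcongr _ * ?_
  apply intervalIntegral.integral_mono_on (by positivity)
  · apply Continuous.intervalIntegrable; fun_prop
  · apply Continuous.intervalIntegrable; fun_prop
  intro θ _
  rw [← Finset.abs_prod]
  simpa [cosProd] using le_abs_self _

lemma centralBinom_sq_le (h : ℕ) : ((h.centralBinom : ℝ) / 4 ^ h) ^ 2 * (2 * h + 1) ≤ 1 := by
  induction h with
  | zero => simp
  | succ h ih =>
    have e := Nat.succ_mul_centralBinom_succ h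
    have e' : ((h : ℝ) + 1) * ((h + 1).centralBinom : ℝ) =
        2 * (2 * h + 1) * (h.centralBinom : ℝ) := by exact_mod_cast e
    have e2 : ((h + 1).centralBinom : ℝ) / 4 ^ (h + 1) =
        ((h.centralBinom : ℝ) / 4 ^ h) * ((2 * h + 1) / (2 * h + 2)) := by
      rw [pow_succ]
      field_simp
      linear_combination 2 * e'
    rw [e2, mul_pow]
    have : ((2 * (h : ℝ) + 1) / (2 * h + 2)) ^ 2 * (2 * ((h + 1 : ℕ) : ℝ) + 1) ≤ 2 * h + 1 := by
      rw [div_pow, div_mul_eq_mul_div, div_le_iff₀ (by positivity)]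
      push_cast
      have : (0 : ℝ) ≤ h := by positivity
      nlinarith
    have h0 : 0 ≤ ((h.centralBinom : ℝ) / 4 ^ h) ^ 2 := by positivity
    calc _ = ((h.centralBinom : ℝ) / 4 ^ h) ^ 2 *
          (((2 * (h : ℝ) + 1) / (2 * h + 2)) ^ 2 * (2 * ((h + 1 : ℕ) : ℝ) + 1)) := by ring
      _ ≤ _ := mul_le_mul_of_nonneg_left this h0
      _ ≤ 1 := ih

lemma choose_antitone_right (h i j : ℕ) (hij : i ≤ j) :
    (2 * h).choose (h + j) ≤ (2 * h).choose (h + i) := by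
  induction j, hij using Nat.le_induction with
  | base => exact le_rfl
  | succ j _ ih =>
    refine le_trans ?_ ih
    by_cases hj : h + j + 1 ≤ 2 * h
    · rw [← Nat.choose_symm (by omega : h + (j + 1) ≤ 2 * h),
        ← Nat.choose_symm (by omega : h + j ≤ 2 * h)]
      have := Nat.choose_le_succ_of_lt_half_left (r := 2 * h - (h + (j + 1))) (n := 2 * h)
        (by omega)
      rwa [show 2 * h - (h + (j + 1)) + 1 = 2 * h - (h + j) by omega] at this
    · rw [Nat.choose_eq_zero_of_lt (by omega)]; exact Nat.zero_le _

lemma mul_sum_multiples_le (g : ℕ → ℕ) (hg : Antitone g) (q J : ℕ) :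
    q * ∑ j ∈ Finset.range J, g (q * (j + 1)) ≤ ∑ i ∈ Finset.range (q * J), g (i + 1) := by
  induction J with
  | zero => simp
  | succ J ih =>
    rw [Finset.sum_range_succ, mul_add, mul_add, mul_one, Finset.sum_range_add]
    refine add_le_add ih ?_
    calc q * g (q * J + q) = ∑ _i ∈ Finset.range q, g (q * J + q) := by simp
      _ ≤ _ := Finset.sum_le_sum fun i hi => hg (by have := Finset.mem_range.1 hi; omega)

lemma sum_choose_right (h J : ℕ) (hJ : h ≤ J) :
    2 * ∑ i ∈ Finset.range J, (2 * h).choose (h + (i + 1)) + h.centralBinom = 4 ^ h := by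
  have e0 : ∑ i ∈ Finset.range J, (2 * h).choose (h + (i + 1)) =
      ∑ i ∈ Finset.range h, (2 * h).choose (h + (i + 1)) := by
    symm
    apply Finset.sum_subset (Finset.range_subset_range.2 hJ)
    intro i _ hi
    apply Nat.choose_eq_zero_of_lt
    rw [Finset.mem_range] at hi
    omega
  have e1 : ∑ i ∈ Finset.range h, (2 * h).choose i =
      ∑ i ∈ Finset.range h, (2 * h).choose (h + (i + 1)) := by
    rw [← Finset.sum_range_reflect]
    refine Finset.sum_congr rfl fun i hi => ?_
    have := Finset.mem_range.1 hi
    rw [← Nat.choose_symm (by omega)]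
    congr 1
    omega
  have e2 := Nat.sum_range_choose (2 * h)
  rw [show 2 * h + 1 = h + (1 + h) by ring, Finset.sum_range_add, Finset.sum_range_add, e1] at e2
  rw [e0, Nat.centralBinom_eq_two_mul_choose]
  have e3 : (2 : ℕ) ^ (2 * h) = 4 ^ h := by rw [pow_mul]; norm_num
  rw [e3] at e2
  rw [← e2]
  simp [add_comm 1]
  ring

lemma sum_union_le {ι : Type*} [DecidableEq ι] (A B : Finset ι) (f : ι → ℕ) :
    ∑ i ∈ A ∪ B, f i ≤ ∑ i ∈ A, f i + ∑ i ∈ B, f i := by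
  rw [← Finset.sum_union_inter]
  exact Nat.le_add_right _ _

lemma sum_choose_dvd_le (h q : ℕ) (hq : 1 ≤ q) :
    q * ∑ b ∈ Finset.filter (fun b : ℕ => (q : ℤ) ∣ (b : ℤ) - h) (Finset.range (2 * h + 1)),
      (2 * h).choose b ≤ q * h.centralBinom + 4 ^ h := by
  set g : ℕ → ℕ := fun j => (2 * h).choose (h + j) with hgdef
  have hg : Antitone g := fun i j hij => choose_antitone_right h i j hij
  set T := ∑ j ∈ Finset.range h, g (q * (j + 1)) with hT
  have hT1 : q * T ≤ ∑ i ∈ Finset.range (q * h), g (i + 1) := mul_sum_multiples_le g hg q h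
  have hT2 : 2 * ∑ i ∈ Finset.range (q * h), g (i + 1) + h.centralBinom = 4 ^ h :=
    sum_choose_right h (q * h) (Nat.le_mul_of_pos_left h hq)
  have hsplit : ∑ b ∈ Finset.filter (fun b : ℕ => (q : ℤ) ∣ (b : ℤ) - h) (Finset.range (2 * h + 1)),
      (2 * h).choose b ≤ h.centralBinom + (T + T) := by
    have hsub : Finset.filter (fun b : ℕ => (q : ℤ) ∣ (b : ℤ) - h) (Finset.range (2 * h + 1)) ⊆
        {h} ∪ ((Finset.range h).image (fun j => h + q * (j + 1)) ∪
          ((Finset.range h).filter (fun j => q * (j + 1) ≤ h)).image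
            (fun j => h - q * (j + 1))) := by
      intro b hb
      obtain ⟨hb1, c, hc⟩ := Finset.mem_filter.1 hb
      have hb1 := Finset.mem_range.1 hb1
      simp only [Finset.mem_union, Finset.mem_singleton, Finset.mem_image, Finset.mem_range,
        Finset.mem_filter]
      rcases lt_trichotomy c 0 with hc0 | hc0 | hc0
      · right; right
        obtain ⟨k, rfl⟩ : ∃ k : ℕ, c = -(k + 1 : ℕ) := ⟨(-c - 1).toNat, by omega⟩
        have e : h = b + q * (k + 1) := by
          zify; push_cast at hc; linarith
        have : k + 1 ≤ q * (k + 1) := Nat.le_mul_of_pos_left _ hq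
        exact ⟨k, ⟨by omega, by omega⟩, by omega⟩
      · left; subst hc0; simp at hc; omega
      · right; left
        obtain ⟨k, rfl⟩ : ∃ k : ℕ, c = (k + 1 : ℕ) := ⟨(c - 1).toNat, by omega⟩
        have e : b = h + q * (k + 1) := by
          zify; push_cast at hc; linarith
        have : k + 1 ≤ q * (k + 1) := Nat.le_mul_of_pos_left _ hq
        exact ⟨k, by omega, by omega⟩
    refine (Finset.sum_le_sum_of_subset hsub).trans ?_
    refine (sum_union_le _ _ _).trans ?_
    refine add_le_add (by simp [Nat.centralBinom_eq_two_mul_choose]) ?_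
    refine (sum_union_le _ _ _).trans ?_
    refine add_le_add ?_ ?_
    · exact Finset.sum_image_le_of_nonneg (fun _ _ => Nat.zero_le _)
    · refine (Finset.sum_image_le_of_nonneg (fun _ _ => Nat.zero_le _)).trans ?_
      refine le_trans (le_of_eq ?_) (Finset.sum_le_sum_of_subset (Finset.filter_subset
        (fun j => q * (j + 1) ≤ h) (Finset.range h)))
      refine Finset.sum_congr rfl fun j hj => ?_
      have := (Finset.mem_filter.1 hj).2
      rw [hgdef]
      simp only
      rw [← Nat.choose_symm (by omega)]
      congr 1
      omega
  calc _ ≤ q * (h.centralBinom + (T + T)) := Nat.mul_le_mul_left _ hsplit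
    _ = q * h.centralBinom + 2 * (q * T) := by ring
    _ ≤ _ := by omega

/-- The probability that the symmetric walk of `2h` half-steps returns to the origin. -/
def returnProb (h : ℕ) : ℝ := (h.centralBinom : ℝ) / 4 ^ h

lemma returnProb_nonneg (h : ℕ) : 0 ≤ returnProb h := by unfold returnProb; positivity

lemma returnProb_le_one (h : ℕ) : returnProb h ≤ 1 := by
  unfold returnProb
  rw [div_le_one (by positivity)]
  exact_mod_cast Nat.centralBinom_le_four_pow h

/-- `w` admits no nontrivial integer relation with coefficients at most `K`. -/
def Dissoc {d : ℕ} (w : Fin d → ℤ) (K : ℕ) : Prop :=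
  ∀ y : Fin d → ℤ, (∀ i, |y i| ≤ (K : ℤ)) → ∑ i, y i * w i = 0 → y = 0

/-- A positive multiple of `v` is a combination of `w`, all coefficients being at most `K`. -/
def DepOn {d : ℕ} (w : Fin d → ℤ) (K : ℕ) (v : ℤ) : Prop :=
  ∃ b : ℕ, 1 ≤ b ∧ b ≤ K ∧ ∃ a : Fin d → ℤ, (∀ i, |a i| ≤ (K : ℤ)) ∧ (b : ℤ) * v = ∑ i, a i * w i

/-- `N * v` is a combination of `w` with coefficients at most `N * K`. -/
def CommonDep {d : ℕ} (w : Fin d → ℤ) (K N : ℕ) (v : ℤ) : Prop :=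
  ∃ c : Fin d → ℤ, (∀ i, |c i| ≤ (N : ℤ) * K) ∧ (N : ℤ) * v = ∑ i, c i * w i

/-- Every walk on `L` lands in the span of `w` with common denominator `N`, with control on the
coefficients. -/
def SupportControl {d : ℕ} (h K : ℕ) (w : Fin d → ℤ) (L : List ℤ) (N : ℕ) : Prop :=
  ∀ s ∈ walkSupport h L, ∃ c : Fin d → ℤ,
    (∀ i, |c i| ≤ (L.length : ℤ) * h * K * N) ∧ (N : ℤ) * s = ∑ i, c i * w i

lemma fourierCos_cons_zero_le (h : ℕ) (v : ℤ) (L : List ℤ) (P : ℤ → Prop) [DecidablePred P]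
    (hP : ∀ z : ℤ, |z| ≤ (h : ℤ) → z * v ∈ walkSupport h L → P z) :
    fourierCos h (v :: L) 0 ≤
      (((∑ b ∈ Finset.filter (fun b : ℕ => P ((b : ℤ) - h)) (Finset.range (2 * h + 1)),
        (2 * h).choose b : ℕ) : ℝ) / 4 ^ h) * fourierCos h L 0 := by
  rw [fourierCos_cons, Nat.cast_sum, Finset.sum_div, Finset.sum_mul, Finset.sum_filter]
  refine Finset.sum_le_sum fun b hb => ?_
  have hb' := Finset.mem_range.1 hb
  have h0 := fourierCos_zero_nonneg h L
  split_ifs with hc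
  · exact mul_le_mul_of_nonneg_left (fourierCos_le h L _) (by positivity)
  · refine le_of_eq ?_
    by_contra hne
    apply hc
    apply hP
    · rw [abs_le]; constructor <;> omega
    · have := mem_walkSupport_of_fourierCos_ne_zero h L _ (right_ne_zero_of_mul hne)
      simpa using this

lemma fourierCos_cons_le_of_free (h : ℕ) (v : ℤ) (L : List ℤ)
    (hP : ∀ z : ℤ, |z| ≤ (h : ℤ) → z * v ∈ walkSupport h L → z = 0) :
    fourierCos h (v :: L) 0 ≤ returnProb h * fourierCos h L 0 := by
  refine (fourierCos_cons_zero_le h v L _ hP).trans (le_of_eq ?_)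
  have : Finset.filter (fun b : ℕ => (b : ℤ) - h = 0) (Finset.range (2 * h + 1)) = {h} := by
    ext b
    simp only [Finset.mem_filter, Finset.mem_range, Finset.mem_singleton]
    omega
  rw [this, Finset.sum_singleton, returnProb, Nat.centralBinom_eq_two_mul_choose]

lemma fourierCos_cons_le_of_dvd (h : ℕ) (v : ℤ) (L : List ℤ) (q : ℕ) (hq : 1 ≤ q)
    (hP : ∀ z : ℤ, |z| ≤ (h : ℤ) → z * v ∈ walkSupport h L → (q : ℤ) ∣ z) :
    fourierCos h (v :: L) 0 ≤ (1 / q + returnProb h) * fourierCos h L 0 := by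
  refine (fourierCos_cons_zero_le h v L _ hP).trans ?_
  refine mul_le_mul_of_nonneg_right ?_ (fourierCos_zero_nonneg h L)
  have hs := sum_choose_dvd_le h q hq
  have hs' : (q : ℝ) * ((∑ b ∈ Finset.filter (fun b : ℕ => (q : ℤ) ∣ (b : ℤ) - h)
      (Finset.range (2 * h + 1)), (2 * h).choose b : ℕ) : ℝ) ≤
      q * (h.centralBinom : ℝ) + 4 ^ h := by
    exact_mod_cast hs
  have hq0 : (0 : ℝ) < q := by exact_mod_cast hq
  have h4 : (0 : ℝ) < 4 ^ h := by positivity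
  rw [returnProb, div_add_div _ _ hq0.ne' h4.ne', div_le_div_iff₀ h4 (by positivity)]
  have := mul_le_mul_of_nonneg_right hs' h4.le
  linarith

lemma Dissoc.cons {d : ℕ} {w : Fin d → ℤ} {K K' : ℕ} (hw : Dissoc w K) (hK : K' ≤ K) {v : ℤ}
    (hv : ¬ DepOn w K' v) : Dissoc (Fin.cons v w : Fin (d + 1) → ℤ) K' := by
  intro y hy hsum
  rw [Fin.sum_univ_succ] at hsum
  simp only [Fin.cons_zero, Fin.cons_succ] at hsum
  have h0 : y 0 = 0 := by
    by_contra hne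
    apply hv
    refine ⟨(y 0).natAbs, Int.natAbs_pos.2 hne, ?_, ?_⟩
    · have := hy 0
      rw [Int.abs_eq_natAbs] at this
      omega
    · rcases lt_or_gt_of_ne hne with hlt | hgt
      · refine ⟨fun i => y i.succ, fun i => hy _, ?_⟩
        rw [show ((y 0).natAbs : ℤ) = -y 0 by omega]
        linarith
      · refine ⟨fun i => -y i.succ, fun i => by rw [abs_neg]; exact hy _, ?_⟩
        rw [show ((y 0).natAbs : ℤ) = y 0 by omega]
        simp only [neg_mul, Finset.sum_neg_distrib]
        linarith
  rw [h0, zero_mul, zero_add] at hsum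
  have := hw (fun i => y i.succ) (fun i => (hy _).trans (by exact_mod_cast hK)) hsum
  funext i
  refine Fin.cases h0 (fun j => ?_) i
  exact congrFun this j

lemma exists_of_mem_walkSupport_ofFn {h d : ℕ} (w : Fin d → ℤ) :
    ∀ s ∈ walkSupport h (List.ofFn w), ∃ y : Fin d → ℤ, (∀ i, |y i| ≤ (h : ℤ)) ∧
      s = ∑ i, y i * w i := by
  induction d with
  | zero =>
    intro s hs
    simp only [List.ofFn_zero, walkSupport, Set.mem_singleton_iff] at hs
    exact ⟨fun _ => 0, fun i => i.elim0, by simp [hs]⟩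
  | succ d ih =>
    intro s hs
    rw [List.ofFn_succ] at hs
    obtain ⟨j, hj, hs⟩ := hs
    obtain ⟨y, hy, hs⟩ := ih _ _ hs
    refine ⟨Fin.cons j y, fun i => ?_, ?_⟩
    · refine Fin.cases hj (fun k => ?_) i
      simpa using hy k
    · rw [Fin.sum_univ_succ]
      simp only [Fin.cons_zero, Fin.cons_succ]
      linarith

lemma Dissoc.fourierCos_le {h d : ℕ} {w : Fin d → ℤ} {K : ℕ} (hw : Dissoc w K) (hK : h ≤ K) :
    fourierCos h (List.ofFn w) 0 ≤ returnProb h ^ d := by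
  induction d with
  | zero => simp [fourierCos_nil]
  | succ d ih =>
    rw [List.ofFn_succ, pow_succ']
    refine (fourierCos_cons_le_of_free h _ _ ?_).trans
      (mul_le_mul_of_nonneg_left (ih (w := fun i => w i.succ) ?_) (returnProb_nonneg h))
    · intro z hz hmem
      obtain ⟨y, hy, hs⟩ := exists_of_mem_walkSupport_ofFn _ _ hmem
      have hhK : (h : ℤ) ≤ K := by exact_mod_cast hK
      have := hw (Fin.cons (-z) y) (fun i => ?_) ?_
      · have := congrFun this 0
        simpa using this
      · refine Fin.cases (by simpa using hz.trans hhK) (fun k => ?_) i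
        simpa using (hy k).trans hhK
      · rw [Fin.sum_univ_succ]
        simp only [Fin.cons_zero, Fin.cons_succ]
        linarith
    · intro y hy hs
      have := hw (Fin.cons 0 y) (fun i => ?_) ?_
      · funext i
        simpa using congrFun this i.succ
      · refine Fin.cases (by simp) (fun k => ?_) i
        simpa using hy k
      · rw [Fin.sum_univ_succ]
        simpa using hs

lemma exists_step {ι : Type*} [Fintype ι] [DecidableEq ι] {h : ℕ} (hh : 1 ≤ h) {v : ι → ℤ}
    {ρ : ℝ} {L : List ℤ} {R : Finset ι} (hρ : ρ ≤ mixedCos h L v R) (P : ι → Prop)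
    [DecidablePred P] (hP : 2 * h ≤ (R.filter P).card) :
    ∃ i ∈ R, P i ∧ ∃ R' ⊆ R, R'ᶜ.card ≤ Rᶜ.card + 2 * h ∧ ρ ≤ mixedCos h (v i :: L) v R' := by
  obtain ⟨S, hS, hcard⟩ := Finset.exists_subset_card_eq hP
  have hSR : S ⊆ R := hS.trans (Finset.filter_subset _ _)
  obtain ⟨i, hi, hle⟩ := exists_mixedCos_le h hh L v R S hSR hcard
  refine ⟨i, hSR hi, (Finset.mem_filter.1 (hS hi)).2, R \ S, Finset.sdiff_subset, ?_, ?_⟩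
  · rw [← hcard]
    have : (R \ S)ᶜ = Rᶜ ∪ S := by
      ext x; simp; tauto
    rw [this]
    exact Finset.card_union_le _ _
  · exact hρ.trans hle

lemma exists_dissociated_base {ι : Type*} [Fintype ι] [DecidableEq ι] {h : ℕ} (hh : 1 ≤ h)
    (v : ι → ℤ) (K : ℕ → ℕ) (hK : ∀ d, K (d + 1) ≤ K d) (hKh : ∀ d, h ≤ K d) (D : ℕ) (ρ : ℝ)
    (hρ : ρ ≤ mixedCos h [] v Finset.univ) (hD : returnProb h ^ D < ρ) :
    ∃ d < D, ∃ w : Fin d → ℤ, ∃ R : Finset ι, Dissoc w (K d) ∧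
      ρ ≤ mixedCos h (List.ofFn w) v R ∧ Rᶜ.card ≤ 2 * h * d ∧
      (R.filter fun i => ¬ DepOn w (K (d + 1)) (v i)).card < 2 * h := by
  by_contra! hcon
  have key : ∀ d ≤ D, ∃ w : Fin d → ℤ, ∃ R : Finset ι, Dissoc w (K d) ∧
      ρ ≤ mixedCos h (List.ofFn w) v R ∧ Rᶜ.card ≤ 2 * h * d := by
    intro d
    induction d with
    | zero =>
      intro _
      exact ⟨fun i => i.elim0, Finset.univ, fun y _ _ => funext fun i => i.elim0,
        by simpa using hρ, by simp⟩
    | succ d ih =>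
      intro hd
      obtain ⟨w, R, hw, hR, hc⟩ := ih (by omega)
      have := hcon d (by omega) w R hw hR hc
      obtain ⟨i, _, hi, R', _, hc', hR'⟩ := exists_step hh hR _ this
      refine ⟨Fin.cons (v i) w, R', hw.cons (hK d) hi, ?_, ?_⟩
      · rw [List.ofFn_cons]; exact hR'
      · rw [mul_add, mul_one]; omega
  obtain ⟨w, R, hw, hR, _⟩ := key D le_rfl
  have := hw.fourierCos_le (hKh D)
  have := mixedCos_le h (List.ofFn w) v R
  linarith

lemma SupportControl.ofFn {d : ℕ} (h K : ℕ) (hK : 1 ≤ K) (w : Fin d → ℤ) :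
    SupportControl h K w (List.ofFn w) 1 := by
  intro s hs
  obtain ⟨y, hy, hs⟩ := exists_of_mem_walkSupport_ofFn _ _ hs
  refine ⟨y, fun i => (hy i).trans ?_, by simp [hs]⟩
  have hd : 1 ≤ d := Nat.succ_le_of_lt (Nat.zero_lt_of_lt i.isLt)
  rw [List.length_ofFn]
  norm_cast
  calc h = 1 * h * 1 * 1 := by ring
    _ ≤ d * h * K * 1 := by gcongr

lemma SupportControl.cons {d : ℕ} {h K : ℕ} {w : Fin d → ℤ} {L : List ℤ} {N Kbig : ℕ}
    (hw : Dissoc w Kbig) (hN : 1 ≤ N) (hI : SupportControl h K w L N) {v : ℤ}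
    (hv : DepOn w K v) (hv' : ¬ CommonDep w K N v)
    (hbig : (L.length + 1) * h * K ^ 2 * N ≤ Kbig) :
    ∃ q : ℕ, 2 ≤ q ∧ q ≤ K ∧ SupportControl h K w (v :: L) (q * N) ∧
      fourierCos h (v :: L) 0 ≤ (1 / q + returnProb h) * fourierCos h L 0 := by
  obtain ⟨b, hb1, hbK, a, ha, hba⟩ := hv
  have hb0 : (0 : ℤ) < b := by exact_mod_cast hb1
  have hex : ∃ q : ℕ, 1 ≤ q ∧ ∀ i, (b : ℤ) ∣ (q : ℤ) * N * a i :=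
    ⟨b, hb1, fun i => ⟨N * a i, by ring⟩⟩
  set q := Nat.find hex with hqdef
  obtain ⟨hq1, hqdvd⟩ := Nat.find_spec hex
  have hqb : q ≤ b := Nat.find_min' hex ⟨hb1, fun i => ⟨N * a i, by ring⟩⟩
  have hqmin : ∀ z : ℤ, (∀ i, (b : ℤ) ∣ z * N * a i) → (q : ℤ) ∣ z := by
    intro z hz
    have hq0 : (0 : ℤ) < q := by exact_mod_cast hq1
    by_contra hnd
    have hr : z % q ≠ 0 := fun h0 => hnd (Int.dvd_of_emod_eq_zero h0)
    have hr0 := Int.emod_nonneg z hq0.ne'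
    have hrlt := Int.emod_lt_of_pos z hq0
    have : q ≤ (z % q).toNat := by
      apply Nat.find_min' hex
      refine ⟨by omega, fun i => ?_⟩
      rw [Int.toNat_of_nonneg hr0]
      have e : z % q * N * a i = z * N * a i - q * N * a i * (z / q) := by
        rw [Int.emod_def]; ring
      rw [e]
      exact dvd_sub (hz i) (Dvd.dvd.mul_right (hqdvd i) (z / q))
    omega
  choose c' hc' using hqdvd
  have hcv : ((q * N : ℕ) : ℤ) * v = ∑ i, c' i * w i := by
    apply mul_left_cancel₀ hb0.ne'
    calc (b : ℤ) * (((q * N : ℕ) : ℤ) * v) = (q * N) * (b * v) := by push_cast; ring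
      _ = _ := by
        rw [hba, Finset.mul_sum, Finset.mul_sum]
        refine Finset.sum_congr rfl fun i _ => ?_
        rw [← mul_assoc, hc' i, mul_assoc]
  have hcb : ∀ i, |c' i| ≤ ((q * N : ℕ) : ℤ) * K := by
    intro i
    have h1 : (b : ℤ) * |c' i| = q * N * |a i| := by
      have := congrArg abs (hc' i)
      rw [abs_mul, abs_mul, abs_mul] at this
      simpa using this.symm
    have h2 : q * N * |a i| ≤ (q * N : ℤ) * K := by
      exact mul_le_mul_of_nonneg_left (ha i) (by positivity)
    have h3 : |c' i| ≤ b * |c' i| := le_mul_of_one_le_left (abs_nonneg _) (by exact_mod_cast hb1)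
    push_cast
    linarith
  have hq2 : 2 ≤ q := by
    by_contra hlt
    have hq : q = 1 := by omega
    apply hv'
    rw [hq, one_mul] at hcb hcv
    exact ⟨c', hcb, hcv⟩
  refine ⟨q, hq2, hqb.trans hbK, ?_, ?_⟩
  · rintro s ⟨j, hj, hs⟩
    obtain ⟨c, hc, hsum⟩ := hI _ hs
    refine ⟨fun i => q * c i + j * c' i, fun i => ?_, ?_⟩
    · have h1 : |(q : ℤ) * c i| ≤ q * (L.length * h * K * N) := by
        rw [abs_mul, Nat.abs_cast]
        exact mul_le_mul_of_nonneg_left (hc i) (by positivity)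
      have h2 : |j * c' i| ≤ h * (((q * N : ℕ) : ℤ) * K) := by
        rw [abs_mul]
        exact mul_le_mul hj (hcb i) (abs_nonneg _) (by positivity)
      refine (abs_add_le _ _).trans ((add_le_add h1 h2).trans (le_of_eq ?_))
      rw [List.length_cons]
      push_cast
      ring
    · calc ((q * N : ℕ) : ℤ) * s = q * (N * (s - j * v)) + j * (((q * N : ℕ) : ℤ) * v) := by
            push_cast; ring
        _ = _ := by
          rw [hsum, hcv, Finset.mul_sum, Finset.mul_sum, ← Finset.sum_add_distrib]
          refine Finset.sum_congr rfl fun i _ => ?_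
          ring
  · apply fourierCos_cons_le_of_dvd h v L q hq1
    intro z hz hmem
    apply hqmin
    obtain ⟨c, hc, hsum⟩ := hI _ hmem
    have hrel := hw (fun i => z * N * a i - b * c i) (fun i => ?_) ?_
    · intro i
      have := congrFun hrel i
      simp only [Pi.zero_apply] at this
      exact ⟨c i, by linarith⟩
    · have h1 : |z * N * a i| ≤ h * N * K := by
        rw [abs_mul, abs_mul, Nat.abs_cast]
        exact mul_le_mul (mul_le_mul_of_nonneg_right hz (by positivity)) (ha i) (abs_nonneg _)
          (by positivity)
      have h2 : |(b : ℤ) * c i| ≤ K * (L.length * h * K * N) := by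
        rw [abs_mul, Nat.abs_cast]
        exact mul_le_mul (by exact_mod_cast hbK) (hc i) (abs_nonneg _) (by positivity)
      refine (abs_sub _ _).trans ((add_le_add h1 h2).trans (le_trans ?_
        (by exact_mod_cast hbig : (((L.length + 1) * h * K ^ 2 * N : ℕ) : ℤ) ≤ Kbig)))
      norm_cast
      have hK1 : 1 ≤ K := hb1.trans hbK
      calc h * N * K + K * (L.length * h * K * N)
          = h * N * (1 * K) + L.length * h * K ^ 2 * N := by ring
        _ ≤ h * N * (K * K) + L.length * h * K ^ 2 * N := by gcongr
        _ = _ := by ring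
    · have : ∑ i, (z * N * a i - b * c i) * w i =
          z * N * ∑ i, a i * w i - b * ∑ i, c i * w i := by
        rw [Finset.mul_sum, Finset.mul_sum, ← Finset.sum_sub_distrib]
        refine Finset.sum_congr rfl fun i _ => ?_
        ring
      rw [this, ← hba, ← hsum]
      ring

lemma exists_common_denominator {ι : Type*} [Fintype ι] [DecidableEq ι] {h : ℕ} (hh : 1 ≤ h)
    (v : ι → ℤ) {d : ℕ} {w : Fin d → ℤ} {K Kbig k Nmax T : ℕ} {ρ : ℝ} {R : Finset ι}
    (hρ0 : 0 ≤ ρ) (hK : 1 ≤ K) (hKbig : h ≤ Kbig) (hw : Dissoc w Kbig)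
    (hρ : ρ ≤ mixedCos h (List.ofFn w) v R) (hR : Rᶜ.card ≤ 2 * h * d)
    (hdep : (R.filter fun i => ¬ DepOn w K (v i)).card < 2 * h)
    (hk : ∀ q : ℕ, 2 ≤ q → q ≤ K → (1 / q + returnProb h) ^ k * (q : ℝ) ≤ 1)
    (hNmax : ∀ N : ℕ, ρ ^ k * (N : ℝ) ≤ 1 → N ≤ Nmax) (hT : Nmax < 2 ^ T)
    (hbig : (d + T) * h * K ^ 2 * Nmax ≤ Kbig) :
    ∃ N, 1 ≤ N ∧ N ≤ Nmax ∧
      (Finset.univ.filter fun i => ¬ CommonDep w K N (v i)).card ≤ 2 * h * (d + T + 2) := by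
  by_contra! hcon
  have hNle : ∀ (L : List ℤ) (R : Finset ι) (N : ℕ), ρ ≤ mixedCos h L v R →
      fourierCos h L 0 ^ k * (N : ℝ) ≤ 1 → N ≤ Nmax := by
    intro L R N h1 h2
    apply hNmax
    refine le_trans ?_ h2
    gcongr
    exact h1.trans (mixedCos_le h L v R)
  have key : ∀ t ≤ T, ∃ (L : List ℤ) (R : Finset ι) (N : ℕ), L.length = d + t ∧ 2 ^ t ≤ N ∧
      SupportControl h K w L N ∧ fourierCos h L 0 ^ k * (N : ℝ) ≤ 1 ∧ ρ ≤ mixedCos h L v R ∧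
      Rᶜ.card ≤ 2 * h * (d + t) ∧ (R.filter fun i => ¬ DepOn w K (v i)).card < 2 * h := by
    intro t
    induction t with
    | zero =>
      intro _
      refine ⟨List.ofFn w, R, 1, by simp, by simp, SupportControl.ofFn h K hK w, ?_, hρ, hR, hdep⟩
      have h1 := hw.fourierCos_le hKbig
      have h2 : fourierCos h (List.ofFn w) 0 ≤ 1 :=
        h1.trans (pow_le_one₀ (returnProb_nonneg h) (returnProb_le_one h))
      simpa using pow_le_one₀ (fourierCos_zero_nonneg h _) h2
    | succ t ih =>
      intro ht
      obtain ⟨L, R, N, hL, hN, hS, hF, hρL, hRc, hRd⟩ := ih (by omega)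
      have hN1 : 1 ≤ N := Nat.one_le_two_pow.trans hN
      have hNm := hNle L R N hρL hF
      have hlt := hcon N hN1 hNm
      have hcov : (Finset.univ.filter fun i => ¬ CommonDep w K N (v i)) ⊆
          Rᶜ ∪ ((R.filter fun i => ¬ DepOn w K (v i)) ∪
            (R.filter fun i => DepOn w K (v i) ∧ ¬ CommonDep w K N (v i))) := by
        intro i hi
        have := (Finset.mem_filter.1 hi).2
        simp only [Finset.mem_union, Finset.mem_compl, Finset.mem_filter]
        tauto
      have hc1 := Finset.card_le_card hcov
      have hc2 := Finset.card_union_le Rᶜ ((R.filter fun i => ¬ DepOn w K (v i)) ∪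
            (R.filter fun i => DepOn w K (v i) ∧ ¬ CommonDep w K N (v i)))
      have hc3 := Finset.card_union_le (R.filter fun i => ¬ DepOn w K (v i))
            (R.filter fun i => DepOn w K (v i) ∧ ¬ CommonDep w K N (v i))
      have hc4 : 2 * h * (d + t) ≤ 2 * h * (d + T) := by gcongr; omega
      have hc5 : 2 * h * (d + T + 2) = 2 * h * (d + T) + 2 * h + 2 * h := by ring
      have hmany : 2 * h ≤ (R.filter fun i => DepOn w K (v i) ∧ ¬ CommonDep w K N (v i)).card := by
        omega
      obtain ⟨i, _, ⟨hi1, hi2⟩, R', hR', hRc', hρ'⟩ := exists_step hh hρL _ hmany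
      have hLT : L.length + 1 ≤ d + T := by omega
      obtain ⟨q, hq2, hqK, hS', hF'⟩ := SupportControl.cons hw hN1 hS hi1 hi2
        (le_trans (by gcongr) hbig)
      refine ⟨v i :: L, R', q * N, by simp [hL]; ring, ?_, hS', ?_, hρ', ?_, ?_⟩
      · rw [pow_succ, mul_comm]; exact Nat.mul_le_mul hq2 hN
      · have hF0 := fourierCos_zero_nonneg h (v i :: L)
        have hr0 := returnProb_nonneg h
        have hF00 := fourierCos_zero_nonneg h L
        calc fourierCos h (v i :: L) 0 ^ k * ((q * N : ℕ) : ℝ)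
            ≤ ((1 / q + returnProb h) * fourierCos h L 0) ^ k * ((q * N : ℕ) : ℝ) := by gcongr
          _ = ((1 / q + returnProb h) ^ k * q) * (fourierCos h L 0 ^ k * N) := by
            rw [mul_pow]; push_cast; ring
          _ ≤ 1 * 1 := by
            refine mul_le_mul (hk q hq2 hqK) hF (by positivity) zero_le_one
          _ = 1 := one_mul 1
      · have : 2 * h * (d + (t + 1)) = 2 * h * (d + t) + 2 * h := by ring
        omega
      · exact (Finset.card_le_card (Finset.filter_subset_filter _ hR')).trans_lt hRd
  obtain ⟨L, R, N, _, hN, _, hF, hρL, _⟩ := key T le_rfl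
  have := hNle L R N hρL hF
  omega

lemma eventually_add_mul_log_le_rpow (a b : ℕ) {s : ℝ} (hs : 0 < s) :
    ∀ᶠ n : ℕ in Filter.atTop, (a : ℝ) + b * (Nat.log 2 n : ℝ) ≤ (n : ℝ) ^ s := by
  have h1 := ((isLittleO_log_rpow_atTop hs).comp_tendsto tendsto_natCast_atTop_atTop).bound
    (show (0 : ℝ) < 1 / (4 * (b + 1)) by positivity)
  have h2 : ∀ᶠ n : ℕ in Filter.atTop, 2 * (a : ℝ) ≤ (n : ℝ) ^ s :=
    ((tendsto_rpow_atTop hs).comp tendsto_natCast_atTop_atTop).eventually_ge_atTop _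
  filter_upwards [h1, h2, Filter.eventually_ge_atTop 1] with n h1 h2 hn
  have hn' : (1 : ℝ) ≤ n := by exact_mod_cast hn
  have hpos : (0 : ℝ) ≤ (n : ℝ) ^ s := by positivity
  simp only [Function.comp_apply, Real.norm_eq_abs, abs_of_nonneg (Real.log_nonneg hn'),
    abs_of_nonneg hpos] at h1
  have h3 : (Nat.log 2 n : ℝ) ≤ 2 * Real.log n := by
    have h4 : ((2 : ℝ)) ^ (Nat.log 2 n) ≤ n := by
      exact_mod_cast Nat.pow_log_le_self 2 (by omega)
    have h5 := Real.log_le_log (by positivity) h4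
    rw [Real.log_pow] at h5
    have h6 := Real.log_two_gt_d9
    have h7 : (0 : ℝ) ≤ Nat.log 2 n := by positivity
    nlinarith
  have hb : (0 : ℝ) ≤ b := by positivity
  have h8 : (b : ℝ) * (2 * Real.log n) ≤ 1 / 2 * (n : ℝ) ^ s := by
    calc (b : ℝ) * (2 * Real.log n) ≤ (b + 1) * (2 * (1 / (4 * (b + 1)) * (n : ℝ) ^ s)) := by
          have := Real.log_nonneg hn'
          gcongr
          linarith
      _ = _ := by field_simp; ring
  have h9 := mul_le_mul_of_nonneg_left h3 hb
  linarith

/-- The return probability at time `⌊n ^ (ε / 2)⌋` is polynomially small. -/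
lemma exists_pow_returnProb_le {ε : ℝ} (hε : 0 < ε) :
    ∃ k : ℕ, ∀ᶠ n : ℕ in Filter.atTop,
      (3 * returnProb ⌊(n : ℝ) ^ (ε / 2)⌋₊) ^ k * (n : ℝ) ≤ 1 := by
  obtain ⟨k, hk⟩ := exists_nat_ge (4 / ε)
  refine ⟨2 * k, ?_⟩
  have h2 : ∀ᶠ n : ℕ in Filter.atTop, (9 : ℝ) ≤ (n : ℝ) ^ (ε / 4) :=
    ((tendsto_rpow_atTop (by positivity)).comp tendsto_natCast_atTop_atTop).eventually_ge_atTop _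
  filter_upwards [h2, Filter.eventually_ge_atTop 1] with n h2 hn
  have hn' : (1 : ℝ) ≤ n := by exact_mod_cast hn
  have hn0 : (0 : ℝ) < n := by linarith
  set h := ⌊(n : ℝ) ^ (ε / 2)⌋₊ with hh
  have h3 : (n : ℝ) ^ (ε / 2) < h + 1 := Nat.lt_floor_add_one _
  have h4 := centralBinom_sq_le h
  set q := returnProb h with hq
  have h4 : q ^ 2 * (2 * h + 1) ≤ 1 := by simpa [hq, returnProb] using h4
  have h5 : q ^ 2 * (n : ℝ) ^ (ε / 2) ≤ 1 := by
    refine le_trans (mul_le_mul_of_nonneg_left ?_ (sq_nonneg q)) h4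
    have : (0 : ℝ) ≤ h := by positivity
    linarith
  have h6 : (n : ℝ) ^ (ε / 2) = (n : ℝ) ^ (ε / 4) * (n : ℝ) ^ (ε / 4) := by
    rw [← Real.rpow_add hn0]; congr 1; ring
  have h7 : (3 * q) ^ 2 * (n : ℝ) ^ (ε / 4) ≤ 1 := by
    refine le_trans ?_ h5
    rw [h6, mul_pow]
    have : 0 ≤ q ^ 2 * (n : ℝ) ^ (ε / 4) := by positivity
    nlinarith
  have h8 : (n : ℝ) ≤ ((n : ℝ) ^ (ε / 4)) ^ k := by
    rw [← Real.rpow_natCast, ← Real.rpow_mul hn0.le]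
    calc (n : ℝ) = (n : ℝ) ^ (1 : ℝ) := (Real.rpow_one _).symm
      _ ≤ _ := by
        apply Real.rpow_le_rpow_of_exponent_le hn'
        rw [div_le_iff₀ hε] at hk
        linarith
  calc (3 * q) ^ (2 * k) * (n : ℝ) ≤ (3 * q) ^ (2 * k) * ((n : ℝ) ^ (ε / 4)) ^ k := by
        have := returnProb_nonneg h
        gcongr
    _ = ((3 * q) ^ 2 * (n : ℝ) ^ (ε / 4)) ^ k := by rw [mul_pow ((3 * q) ^ 2), ← pow_mul]
    _ ≤ 1 := pow_le_one₀ (by positivity) h7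

lemma inv_add_pow_mul_le {p : ℝ} (hp : 0 ≤ p) {n k A q : ℕ}
    (hpn : (3 * p) ^ k * (n : ℝ) ≤ 1) (hp1 : 3 * p ≤ 1) (hq : 2 ≤ q) (hqn : q ≤ n ^ A) :
    (1 / q + p) ^ (k * A + 3) * (q : ℝ) ≤ 1 := by
  have hq2 : (2 : ℝ) ≤ q := by exact_mod_cast hq
  have hq0 : (0 : ℝ) < q := by linarith
  rcases le_total p (1 / (2 * q)) with hle | hle
  · have h1 : 1 / q + p ≤ 3 / (2 * q) := by
      calc 1 / q + p ≤ 1 / q + 1 / (2 * q) := by gcongr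
        _ = 3 / (2 * q) := by field_simp; norm_num
    have h2 : 3 / (2 * (q : ℝ)) ≤ 1 := by
      rw [div_le_one (by positivity)]; linarith
    calc (1 / q + p) ^ (k * A + 3) * (q : ℝ) ≤ (3 / (2 * q)) ^ (k * A + 3) * q := by gcongr
      _ ≤ (3 / (2 * q)) ^ 3 * q := by
          gcongr ?_ * _
          exact pow_le_pow_of_le_one (by positivity) h2 (by omega)
      _ = 27 / (8 * (q : ℝ) ^ 2) := by field_simp; norm_num
      _ ≤ 1 := by rw [div_le_one (by positivity)]; nlinarith
  · have h1 : 1 / q + p ≤ 3 * p := by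
      have : 1 / (q : ℝ) = 2 * (1 / (2 * q)) := by field_simp
      linarith
    calc (1 / q + p) ^ (k * A + 3) * (q : ℝ) ≤ (3 * p) ^ (k * A + 3) * (n : ℝ) ^ A := by
          gcongr
          exact_mod_cast hqn
      _ ≤ (3 * p) ^ (k * A) * (n : ℝ) ^ A := by
          gcongr ?_ * _
          exact pow_le_pow_of_le_one (by positivity) hp1 (by omega)
      _ = ((3 * p) ^ k * n) ^ A := by rw [mul_pow ((3 * p) ^ k), ← pow_mul]
      _ ≤ 1 := pow_le_one₀ (by positivity) hpn

/-- Exponents of the scales used in the dissociation argument. -/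
def scaleExp (C k : ℕ) : ℕ → ℕ
  | 0 => 1
  | s + 1 => 2 * scaleExp C k s + C * (k * scaleExp C k s + 3) + 2

lemma scaleExp_mono (C k : ℕ) : Monotone (scaleExp C k) :=
  monotone_nat_of_le_succ fun s => by
    simp only [scaleExp]
    nlinarith [Nat.zero_le (C * (k * scaleExp C k s + 3))]

lemma one_le_scaleExp (C k s : ℕ) : 1 ≤ scaleExp C k s := scaleExp_mono C k (Nat.zero_le s)

/-- **Inverse Littlewood–Offord theorem** with few exceptional coordinates. -/
theorem exists_commonDep_of_concentration {ε : ℝ} (hε : 0 < ε) (hε1 : ε < 1) (C : ℕ) :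
    ∃ D B : ℕ, ∀ᶠ n : ℕ in Filter.atTop, ∀ (p : ℕ) (v : Fin p → ℤ),
      1 / (n : ℝ) ^ C ≤ probRad p (fun x => ∑ i, (v i : ℝ) * x i = 0) →
      ∃ d ≤ D, ∃ (w : Fin d → ℤ) (N K : ℕ), 1 ≤ N ∧ N * K ≤ n ^ B ∧
        ((Finset.univ.filter fun i => ¬ CommonDep w K N (v i)).card : ℝ) ≤ (n : ℝ) ^ ε := by
  obtain ⟨k₁, hk₁⟩ := exists_pow_returnProb_le hε
  set D := k₁ * (C + 1) with hD
  set a := scaleExp C k₁ with ha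
  set kmax := k₁ * a D + 3 with hkmax
  refine ⟨D, C * kmax + a D, ?_⟩
  have hlog := eventually_add_mul_log_le_rpow (2 * (D + 3 + C * kmax)) (2 * (C * kmax))
    (show 0 < ε / 2 by positivity)
  filter_upwards [hk₁, hlog, Filter.eventually_ge_atTop 2] with n hk₁ hlog hn p v hρ
  have hn' : (2 : ℝ) ≤ n := by exact_mod_cast hn
  have hn0 : (0 : ℝ) < n := by linarith
  have hn1 : (1 : ℝ) ≤ n := by linarith
  set h := ⌊(n : ℝ) ^ (ε / 2)⌋₊ with hh
  have hh1 : 1 ≤ h := Nat.le_floor (by simpa using Real.one_le_rpow hn1 (by positivity))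
  have hhr : (h : ℝ) ≤ (n : ℝ) ^ (ε / 2) := Nat.floor_le (by positivity)
  have hpown : (n : ℝ) ^ (ε / 2) ≤ n := by
    simpa using Real.rpow_le_rpow_of_exponent_le hn1 (show ε / 2 ≤ 1 by linarith)
  have hhn : h ≤ n := by exact_mod_cast hhr.trans hpown
  set T := C * kmax * (Nat.log 2 n + 1) + 1 with hT
  have hTr : 2 * ((D : ℝ) + T + 2) ≤ (n : ℝ) ^ (ε / 2) := by
    refine le_trans (le_of_eq ?_) hlog
    rw [hT]; push_cast; ring
  have hDT : D + T ≤ n := by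
    have : ((D + T : ℕ) : ℝ) ≤ n := by
      push_cast
      have h1 : (0 : ℝ) ≤ (D : ℝ) + T := by positivity
      linarith
    exact_mod_cast this
  have hp0 := returnProb_nonneg h
  have hk1pos : k₁ ≠ 0 := by
    rintro rfl
    simp at hk₁
    omega
  have hp1 : 3 * returnProb h ≤ 1 := by
    by_contra! hlt
    have := one_lt_pow₀ hlt hk1pos
    nlinarith
  have hDlt : returnProb h ^ D < 1 / (n : ℝ) ^ C := by
    have h1 : returnProb h ^ k₁ ≤ 1 / n := by
      rw [le_div_iff₀ hn0]
      refine le_trans ?_ hk₁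
      gcongr
      linarith
    calc returnProb h ^ D = (returnProb h ^ k₁) ^ (C + 1) := by rw [hD, pow_mul]
      _ ≤ (1 / n) ^ (C + 1) := by gcongr
      _ = 1 / (n : ℝ) ^ (C + 1) := by rw [div_pow, one_pow]
      _ < 1 / (n : ℝ) ^ C := by
        apply one_div_lt_one_div_of_lt (by positivity)
        exact pow_lt_pow_right₀ (by linarith) (by omega)
  have ha1 : ∀ s, a s ≠ 0 := fun s => Nat.one_le_iff_ne_zero.1 (one_le_scaleExp C k₁ s)
  obtain ⟨d, hdD, w, R, hw, hρR, hR, hdep⟩ := exists_dissociated_base hh1 v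
    (fun d => n ^ a (D - d))
    (fun d => Nat.pow_le_pow_right (by omega) (scaleExp_mono C k₁ (Nat.sub_le_sub_left d.le_succ D)))
    (fun d => hhn.trans (Nat.le_self_pow (ha1 _) n))
    D _ (hρ.trans (probRad_le_mixedCos h p v)) hDlt
  set A := a (D - (d + 1)) with hA
  have hAD : A ≤ a D := scaleExp_mono C k₁ (by omega)
  have hA' : a (D - d) = 2 * A + C * (k₁ * A + 3) + 2 := by
    have : D - d = (D - (d + 1)) + 1 := by omega
    rw [this, hA, ha, scaleExp]
  have hk_le : k₁ * A + 3 ≤ kmax := by rw [hkmax]; gcongr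
  obtain ⟨N, hN1, hN, hcard⟩ := exists_common_denominator (T := T) (k := k₁ * A + 3)
    (Nmax := n ^ (C * (k₁ * A + 3))) (K := n ^ A) hh1 v (by positivity)
    (Nat.one_le_pow _ _ (by omega))
    (hhn.trans (Nat.le_self_pow (ha1 _) n))
    hw hρR hR hdep
    (fun q hq hqn => inv_add_pow_mul_le hp0 hk₁ hp1 hq hqn)
    (fun N hN => by
      rw [div_pow, one_pow, ← pow_mul, one_div, inv_mul_le_iff₀ (by positivity), mul_one] at hN
      exact_mod_cast hN)
    (by
      calc n ^ (C * (k₁ * A + 3)) ≤ (2 ^ (Nat.log 2 n + 1)) ^ (C * kmax) := by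
            refine (Nat.pow_le_pow_left (Nat.lt_pow_succ_log_self Nat.one_lt_two n).le _).trans ?_
            exact Nat.pow_le_pow_right (by positivity) (Nat.mul_le_mul_left _ hk_le)
        _ = 2 ^ (C * kmax * (Nat.log 2 n + 1)) := by rw [← pow_mul, mul_comm]
        _ < 2 ^ T := Nat.pow_lt_pow_right Nat.one_lt_two (by rw [hT]; exact Nat.lt_succ_self _))
    (by
      calc (d + T) * h * (n ^ A) ^ 2 * n ^ (C * (k₁ * A + 3))
          ≤ n * n * (n ^ A) ^ 2 * n ^ (C * (k₁ * A + 3)) := by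
            have := (Nat.add_le_add_right hdD.le T).trans hDT
            gcongr
        _ = n ^ (2 * A + C * (k₁ * A + 3) + 2) := by ring
        _ = n ^ a (D - d) := by rw [hA'])
  refine ⟨d, hdD.le, w, N, n ^ A, hN1, ?_, ?_⟩
  · calc N * n ^ A ≤ n ^ (C * kmax) * n ^ a D := by
          apply Nat.mul_le_mul
          · exact hN.trans (Nat.pow_le_pow_right (by omega) (Nat.mul_le_mul_left _ hk_le))
          · exact Nat.pow_le_pow_right (by omega) hAD
      _ = _ := by rw [← pow_add]
  · calc ((Finset.univ.filter fun i => ¬ CommonDep w (n ^ A) N (v i)).card : ℝ)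
        ≤ ((2 * h * (d + T + 2) : ℕ) : ℝ) := by exact_mod_cast hcard
      _ = (h : ℝ) * (2 * ((d : ℝ) + T + 2)) := by
          clear_value T h
          push_cast
          ring
      _ ≤ (n : ℝ) ^ (ε / 2) * (n : ℝ) ^ (ε / 2) := by
          have : (d : ℝ) ≤ D := by exact_mod_cast hdD.le
          gcongr
          linarith
      _ = (n : ℝ) ^ ε := by rw [← Real.rpow_add hn0]; congr 1; ring

/-- Every symmetric GAP of polynomial size is contained in a proper one of at most the same rank
and polynomial size. -/
lemma exists_proper_cover (d B : ℕ) :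
    ∃ B' : ℕ, ∀ n : ℕ, 2 ≤ n → ∀ X : ℕ, X ≤ n ^ B → ∀ g : Fin d → ℝ,
      ∃ d' ≤ d, ∃ (g' : Fin d' → ℝ) (X' : ℕ), X' ≤ n ^ B' ∧
        (∀ m : Fin d → ℤ, (∀ i, |m i| ≤ (X : ℤ)) →
          ∃ m' : Fin d' → ℤ, (∀ i, |m' i| ≤ (X' : ℤ)) ∧
            ∑ i, (m i : ℝ) * g i = ∑ i, (m' i : ℝ) * g' i) ∧
        (∀ m m' : Fin d' → ℤ, (∀ i, |m i| ≤ (X' : ℤ)) → (∀ i, |m' i| ≤ (X' : ℤ)) →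
          (∑ i, (m i : ℝ) * g' i) = (∑ i, (m' i : ℝ) * g' i) → m = m') := by
  induction d generalizing B with
  | zero =>
    exact ⟨B, fun n _ X hX g => ⟨0, le_rfl, g, X, hX, fun m hm => ⟨m, hm, rfl⟩,
      fun m m' _ _ _ => Subsingleton.elim _ _⟩⟩
  | succ d ih =>
    obtain ⟨B₁, hB₁⟩ := ih (2 * B + 2)
    refine ⟨max B B₁, fun n hn X hX g => ?_⟩
    by_cases hproper : ∀ m m' : Fin (d + 1) → ℤ, (∀ i, |m i| ≤ (X : ℤ)) →
        (∀ i, |m' i| ≤ (X : ℤ)) →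
        (∑ i, (m i : ℝ) * g i) = (∑ i, (m' i : ℝ) * g i) → m = m'
    · exact ⟨d + 1, le_rfl, g, X, hX.trans (Nat.pow_le_pow_right (by omega) (le_max_left _ _)),
        fun m hm => ⟨m, hm, rfl⟩, hproper⟩
    push Not at hproper
    obtain ⟨m₁, m₂, h₁, h₂, heq, hne⟩ := hproper
    obtain ⟨i₀, hi₀⟩ := Function.ne_iff.1 hne
    set r : Fin (d + 1) → ℤ := fun i => m₁ i - m₂ i with hr
    have hrX : ∀ i, |r i| ≤ 2 * (X : ℤ) := fun i => by
      have := abs_sub (m₁ i) (m₂ i)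
      have := h₁ i
      have := h₂ i
      simp only [hr]
      linarith
    have hr0 : (r i₀ : ℝ) ≠ 0 := by
      have : r i₀ ≠ 0 := sub_ne_zero.2 hi₀
      exact_mod_cast this
    have hrel : ∑ i, (r i : ℝ) * g i = 0 := by
      simp only [hr, Int.cast_sub, sub_mul, Finset.sum_sub_distrib, heq, sub_self]
    have hX' : 4 * X ^ 2 ≤ n ^ (2 * B + 2) := by
      calc 4 * X ^ 2 ≤ n ^ 2 * (n ^ B) ^ 2 := by
            gcongr
            nlinarith
        _ = _ := by ring
    obtain ⟨d', hd', g', X', hX'', hcov, hprop⟩ :=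
      hB₁ n hn (4 * X ^ 2) hX' (fun j => g (i₀.succAbove j) / r i₀)
    refine ⟨d', hd'.trans d.le_succ, g', X',
      hX''.trans (Nat.pow_le_pow_right (by omega) (le_max_right _ _)), fun m hm => ?_, hprop⟩
    obtain ⟨m', hm', hsum⟩ := hcov
      (fun j => m (i₀.succAbove j) * r i₀ - m i₀ * r (i₀.succAbove j)) (fun j => by
        calc |m (i₀.succAbove j) * r i₀ - m i₀ * r (i₀.succAbove j)|
            ≤ |m (i₀.succAbove j)| * |r i₀| + |m i₀| * |r (i₀.succAbove j)| := by
              rw [← abs_mul, ← abs_mul]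
              exact abs_sub _ _
          _ ≤ X * (2 * X) + X * (2 * X) := by
              have a1 := hm (i₀.succAbove j)
              have a2 := hm i₀
              have a3 := hrX (i₀.succAbove j)
              have a4 := hrX i₀
              gcongr
          _ = ((4 * X ^ 2 : ℕ) : ℤ) := by push_cast; ring)
    refine ⟨m', hm', ?_⟩
    rw [← hsum]
    rw [Fin.sum_univ_succAbove _ i₀] at hrel ⊢
    have hg0 : g i₀ = -(∑ j, (r (i₀.succAbove j) : ℝ) * g (i₀.succAbove j)) / r i₀ := by
      rw [eq_div_iff hr0]
      linarith
    rw [hg0, neg_div, mul_neg, Finset.sum_div, Finset.mul_sum, ← Finset.sum_neg_distrib,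
      ← Finset.sum_add_distrib]
    refine Finset.sum_congr rfl fun j _ => ?_
    push_cast
    field_simp
    ring

/-- **Siegel's lemma** for an arbitrary number of equations: only solvability over the reals is
required. -/
lemma exists_small_int_solution {ι κ : Type*} [Fintype ι] [Fintype κ] (A : Matrix ι κ ℤ) {Y : ℕ}
    (hY : 1 ≤ Y) (hA : ∀ i k, |A i k| ≤ (Y : ℤ)) {c : κ → ℝ} (hc : c ≠ 0)
    (hAc : ∀ i, ∑ k, (A i k : ℝ) * c k = 0) :
    ∃ t : κ → ℤ, t ≠ 0 ∧ (∀ i, ∑ k, A i k * t k = 0) ∧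
      ∀ k, |t k| ≤ (((Fintype.card κ * Y) ^ Fintype.card κ : ℕ) : ℤ) := by
  have hκ : Nonempty κ := by
    obtain ⟨k, -⟩ := Function.ne_iff.1 hc
    exact ⟨k⟩
  have hcard : 1 ≤ Fintype.card κ := Fintype.card_pos
  have hbase : 1 ≤ Fintype.card κ * Y := Nat.mul_pos hcard hY
  obtain ⟨τ, b, hb, hspan, hli⟩ :=
    exists_linearIndependent' ℝ (fun i : ι => fun k : κ => (A i k : ℝ))
  have : Finite τ := Finite.of_injective b hb
  have : Fintype τ := Fintype.ofFinite τ
  have key : ∀ z : κ → ℝ, (∀ i : τ, ∑ k, (A (b i) k : ℝ) * z k = 0) →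
      ∀ x ∈ Submodule.span ℝ (Set.range ((fun i : ι => fun k : κ => (A i k : ℝ)) ∘ b)),
        ∑ k, x k * z k = 0 := by
    intro z hz x hx
    induction hx using Submodule.span_induction with
    | mem x hx =>
      obtain ⟨i, rfl⟩ := hx
      exact hz i
    | zero => simp
    | add x y _ _ hx hy => simp [add_mul, Finset.sum_add_distrib, hx, hy]
    | smul a x _ hx => simp [mul_assoc, ← Finset.mul_sum, hx]
  have hlt : Fintype.card τ < Fintype.card κ := by
    by_contra! hge
    have hle := hli.fintype_card_le_finrank
    rw [Module.finrank_fintype_fun_eq_card] at hle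
    have htop := hli.span_eq_top_of_card_eq_finrank'
      (by rw [Module.finrank_fintype_fun_eq_card]; exact le_antisymm hle hge)
    have h0 := key c (fun i => hAc (b i)) c (htop ▸ Submodule.mem_top)
    rw [Finset.sum_eq_zero_iff_of_nonneg fun k _ => mul_self_nonneg (c k)] at h0
    exact hc (funext fun k => mul_self_eq_zero.1 (h0 k (Finset.mem_univ k)))
  obtain ⟨t, ht0, ht, htn⟩ : ∃ t : κ → ℤ, t ≠ 0 ∧ (∀ i : τ, ∑ k, A (b i) k * t k = 0) ∧
      ∀ k, |t k| ≤ (((Fintype.card κ * Y) ^ Fintype.card κ : ℕ) : ℤ) := by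
    rcases Nat.eq_zero_or_pos (Fintype.card τ) with h0 | hpos
    · have := Fintype.card_eq_zero_iff.1 h0
      refine ⟨fun _ => 1, fun h => ?_, fun i => isEmptyElim i, fun k => ?_⟩
      · exact one_ne_zero (congrFun h hκ.some)
      · rw [abs_one]
        exact_mod_cast Nat.one_le_pow _ _ hbase
    · let _ : SeminormedAddCommGroup (Matrix τ κ ℤ) := Matrix.seminormedAddCommGroup
      obtain ⟨t, ht0, ht, htn⟩ :=
        Int.Matrix.exists_ne_zero_int_vec_norm_le (A.submatrix b id) hlt hpos
      refine ⟨t, ht0, fun i => congrFun ht i, fun k => ?_⟩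
      have hA' : ‖A.submatrix b id‖ ≤ Y := by
        refine (Matrix.norm_le_iff (by positivity)).2 fun i k => ?_
        rw [Int.norm_eq_abs]
        exact_mod_cast hA (b i) k
      have hY' : (1 : ℝ) ≤ Y := by exact_mod_cast hY
      have hbase' : (1 : ℝ) ≤ (Fintype.card κ : ℝ) * Y := by exact_mod_cast hbase
      have hlt' : (Fintype.card τ : ℝ) + 1 ≤ Fintype.card κ := by exact_mod_cast hlt
      have h1 : ‖t k‖ ≤ ((Fintype.card κ : ℝ) * Y) ^ Fintype.card κ := by
        refine (norm_le_pi_norm t k).trans (htn.trans ?_)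
        calc ((Fintype.card κ : ℝ) * max 1 ‖A.submatrix b id‖) ^
              ((Fintype.card τ : ℝ) / (Fintype.card κ - Fintype.card τ))
            ≤ ((Fintype.card κ : ℝ) * Y) ^
              ((Fintype.card τ : ℝ) / (Fintype.card κ - Fintype.card τ)) := by
              apply Real.rpow_le_rpow (by positivity)
              · gcongr
                exact max_le hY' hA'
              · apply div_nonneg (by positivity)
                linarith
          _ ≤ ((Fintype.card κ : ℝ) * Y) ^ (Fintype.card κ : ℝ) := by
              apply Real.rpow_le_rpow_of_exponent_le hbase'
              rw [div_le_iff₀ (by linarith)]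
              have : (0 : ℝ) ≤ Fintype.card τ := by positivity
              nlinarith
          _ = _ := Real.rpow_natCast _ _
      rw [Int.norm_eq_abs] at h1
      exact_mod_cast h1
  refine ⟨t, ht0, fun i => ?_, htn⟩
  have h1 := key (fun k => (t k : ℝ)) (fun i => by exact_mod_cast ht i)
    (fun k => (A i k : ℝ)) (hspan ▸ Submodule.subset_span ⟨i, rfl⟩)
  exact_mod_cast h1

/-- If the kernel of an integer matrix meets the span of few small integer vectors, then it
contains a nonzero integer vector of controlled height. -/
lemma exists_small_kernel_vector {p : ℕ} {ι : Type*} [Fintype ι] (M : Matrix (Fin p) (Fin p) ℤ)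
    (hM : ∀ i j, |M i j| ≤ 1) {X : ℕ} (hX : 1 ≤ X) (y : ι → Fin p → ℤ)
    (hy : ∀ k i, |y k i| ≤ (X : ℤ)) {v : Fin p → ℝ} (hv : v ≠ 0)
    (hMv : ∀ i, ∑ j, (M i j : ℝ) * v j = 0)
    (hspan : v ∈ Submodule.span ℝ (Set.range fun k : ι => fun i : Fin p => (y k i : ℝ))) :
    ∃ u : Fin p → ℤ, u ≠ 0 ∧ (∀ i, ∑ j, M i j * u j = 0) ∧
      ∀ i, |u i| ≤ ((Fintype.card ι * (Fintype.card ι * (p * X)) ^ Fintype.card ι * X : ℕ) : ℤ) := by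
  have hp : 1 ≤ p := by
    obtain ⟨i, -⟩ := Function.ne_iff.1 hv
    exact i.pos
  obtain ⟨κ, a, ha, hsp, hli⟩ :=
    exists_linearIndependent' ℝ (fun k : ι => fun i : Fin p => (y k i : ℝ))
  have : Finite κ := Finite.of_injective a ha
  have : Fintype κ := Fintype.ofFinite κ
  have hκι : Fintype.card κ ≤ Fintype.card ι := Fintype.card_le_of_injective a ha
  rw [← hsp] at hspan
  obtain ⟨c, hcv⟩ := (Submodule.mem_span_range_iff_exists_fun ℝ).1 hspan
  have hcv' : ∀ j, v j = ∑ k, c k * (y (a k) j : ℝ) := fun j => by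
    rw [← hcv]
    simp
  have hc : c ≠ 0 := by
    rintro rfl
    exact hv (funext fun j => by simp [hcv'])
  obtain ⟨t, ht0, ht, htn⟩ := exists_small_int_solution
    (Matrix.of fun (i : Fin p) (k : κ) => ∑ j, M i j * y (a k) j) (Y := p * X)
    (Nat.mul_pos hp hX)
    (fun i k => by
      calc |∑ j, M i j * y (a k) j| ≤ ∑ j, |M i j * y (a k) j| := Finset.abs_sum_le_sum_abs _ _
        _ ≤ ∑ _j : Fin p, (X : ℤ) := Finset.sum_le_sum fun j _ => by
            rw [abs_mul]
            calc |M i j| * |y (a k) j| ≤ 1 * X := by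
                  gcongr
                  · exact hM i j
                  · exact hy _ _
              _ = X := one_mul _
        _ = ((p * X : ℕ) : ℤ) := by simp)
    hc
    (fun i => by
      rw [← hMv i]
      simp only [hcv', Matrix.of_apply, Int.cast_sum, Int.cast_mul, Finset.sum_mul,
        Finset.mul_sum]
      rw [Finset.sum_comm]
      exact Finset.sum_congr rfl fun j _ => Finset.sum_congr rfl fun k _ => by ring)
  refine ⟨fun j => ∑ k, t k * y (a k) j, fun h0 => ?_, fun i => ?_, fun i => ?_⟩
  · apply ht0
    have h1 := Fintype.linearIndependent_iff.1 hli (fun k => (t k : ℝ)) (by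
      ext j
      have := congrFun h0 j
      simp only [Pi.zero_apply] at this
      have h2 : ∑ k, (t k : ℝ) * (y (a k) j : ℝ) = 0 := by exact_mod_cast this
      simpa using h2)
    exact funext fun k => by exact_mod_cast h1 k
  · rw [← ht i]
    simp only [Matrix.of_apply, Finset.sum_mul, Finset.mul_sum]
    rw [Finset.sum_comm]
    exact Finset.sum_congr rfl fun j _ => Finset.sum_congr rfl fun k _ => by ring
  · set Z := (Fintype.card ι * (p * X)) ^ Fintype.card ι with hZ
    have hZ' : (Fintype.card κ * (p * X)) ^ Fintype.card κ ≤ Z := by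
      rcases Nat.eq_zero_or_pos (Fintype.card κ) with h0 | hpos
      · have := Fintype.card_eq_zero_iff.1 h0
        exact absurd (Subsingleton.elim t 0) ht0
      · calc (Fintype.card κ * (p * X)) ^ Fintype.card κ
            ≤ (Fintype.card ι * (p * X)) ^ Fintype.card κ := by gcongr
          _ ≤ Z := Nat.pow_le_pow_right
            (Nat.mul_pos (hpos.trans_le hκι) (Nat.mul_pos hp hX)) hκι
    calc |∑ k, t k * y (a k) i| ≤ ∑ k, |t k * y (a k) i| := Finset.abs_sum_le_sum_abs _ _
      _ ≤ ∑ _k : κ, (Z : ℤ) * X := Finset.sum_le_sum fun k _ => by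
          rw [abs_mul]
          exact mul_le_mul ((htn k).trans (by exact_mod_cast hZ')) (hy _ _) (abs_nonneg _)
            (by positivity)
      _ = Fintype.card κ * ((Z : ℤ) * X) := by simp
      _ ≤ Fintype.card ι * ((Z : ℤ) * X) := by gcongr
      _ = _ := by push_cast; ring

lemma exists_span_of_commonDep {p d : ℕ} (w : Fin d → ℤ) {N K X : ℕ} (hN : 1 ≤ N) (hX : 1 ≤ X)
    (hNK : N * K ≤ X) (v : Fin p → ℤ) :
    ∃ y : (Fin d ⊕ {i : Fin p // ¬ CommonDep w K N (v i)}) → Fin p → ℤ,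
      (∀ k i, |y k i| ≤ (X : ℤ)) ∧
      (fun i => (v i : ℝ)) ∈
        Submodule.span ℝ (Set.range fun k => fun i : Fin p => (y k i : ℝ)) := by
  have hN0 : (N : ℝ) ≠ 0 := by
    have : N ≠ 0 := by omega
    exact_mod_cast this
  have hc : ∀ i : Fin p, ∃ c : Fin d → ℤ, (∀ j, |c j| ≤ (X : ℤ)) ∧
      (CommonDep w K N (v i) → (N : ℤ) * v i = ∑ j, c j * w j) ∧
      (¬ CommonDep w K N (v i) → c = 0) := by
    intro i
    by_cases h : CommonDep w K N (v i)
    · obtain ⟨c, hcK, hc⟩ := h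
      exact ⟨c, fun j => (hcK j).trans (by exact_mod_cast hNK), fun _ => hc,
        fun h' => absurd ⟨c, hcK, hc⟩ h'⟩
    · exact ⟨0, fun j => by simp, fun h' => absurd h' h, fun _ => rfl⟩
  choose c hcX hcdep hc0 using hc
  refine ⟨Sum.elim (fun j i => c i j) (fun e => Pi.single e.1 1), ?_, ?_⟩
  · rintro (j | e) i
    · exact hcX i j
    · simp only [Sum.elim_inr, Pi.single_apply]
      split_ifs
      · rw [abs_one]; exact_mod_cast hX
      · simp
  · refine (Submodule.mem_span_range_iff_exists_fun ℝ).2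
      ⟨Sum.elim (fun j => (w j : ℝ) / N) (fun e => (v e.1 : ℝ)), ?_⟩
    ext i
    simp only [Fintype.sum_sum_type, Sum.elim_inl, Sum.elim_inr, Finset.sum_apply, Pi.smul_apply,
      smul_eq_mul, Pi.single_apply]
    by_cases h : CommonDep w K N (v i)
    · have h1 : ∑ e : {i : Fin p // ¬ CommonDep w K N (v i)},
          (v e.1 : ℝ) * (((if i = e.1 then 1 else 0 : ℤ)) : ℝ) = 0 :=
        Finset.sum_eq_zero fun e _ => by
          have : i ≠ e.1 := fun hi => e.2 (hi ▸ h)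
          simp [this]
      have h2 : (N : ℝ) * v i = ∑ j, (c i j : ℝ) * w j := by exact_mod_cast hcdep i h
      rw [h1, add_zero, ← mul_right_inj' hN0, h2, Finset.mul_sum]
      exact Finset.sum_congr rfl fun j _ => by field_simp
    · rw [Finset.sum_eq_single (⟨i, h⟩ : {i : Fin p // ¬ CommonDep w K N (v i)})]
      · simp [hc0 i h]
      · intro e _ he
        have : i ≠ e.1 := fun hi => he (Subtype.ext hi.symm)
        simp [this]
      · simp

open Matrix in
/-- A symmetric integer matrix of corank one has a rank one adjugate, proportional to the square
of an integer vector spanning its kernel. -/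
lemma exists_adjugate_eq {p : ℕ} (hp : 1 ≤ p) (Z : Matrix (Fin p) (Fin p) ℤ)
    (hZ : (Z.map (Int.cast : ℤ → ℝ)).IsSymm) (hrank : (Z.map (Int.cast : ℤ → ℝ)).rank = p - 1) :
    ∃ v : Fin p → ℤ, v ≠ 0 ∧ (∀ i, ∑ j, (Z i j : ℝ) * v j = 0) ∧
      (∀ u : Fin p → ℝ, (∀ i, ∑ j, (Z i j : ℝ) * u j = 0) → ∃ t : ℝ, ∀ i, u i = t * v i) ∧
      ∃ l : ℝ, l ≠ 0 ∧
        ∀ i j, (Z.map (Int.cast : ℤ → ℝ)).adjugate i j = l * v i * v j := by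
  set M := Z.map (Int.cast : ℤ → ℝ) with hM
  have hker : Module.finrank ℝ (LinearMap.ker M.mulVecLin) = 1 := by
    have h1 := LinearMap.finrank_range_add_finrank_ker M.mulVecLin
    rw [Module.finrank_fintype_fun_eq_card, Fintype.card_fin] at h1
    have h2 : Module.finrank ℝ (LinearMap.range M.mulVecLin) = p - 1 := hrank
    omega
  obtain ⟨⟨v₀, hv₀⟩, hv₀0, hv₀s⟩ := finrank_eq_one_iff'.1 hker
  have hMv₀ : M *ᵥ v₀ = 0 := by simpa using hv₀
  have hv₀ne : v₀ ≠ 0 := fun h => hv₀0 (Subtype.ext h)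
  have hspan : ∀ u : Fin p → ℝ, M *ᵥ u = 0 → ∃ t : ℝ, t • v₀ = u := fun u hu => by
    obtain ⟨t, ht⟩ := hv₀s ⟨u, by simpa using hu⟩
    exact ⟨t, congrArg Subtype.val ht⟩
  obtain ⟨i₀, hi₀⟩ := Function.ne_iff.1 hv₀ne
  have hupd : (M.updateRow i₀ v₀).det ≠ 0 := by
    intro hdet
    obtain ⟨z, hz0, hz⟩ := Matrix.exists_mulVec_eq_zero_iff.2 hdet
    have hrow : ∀ i, i ≠ i₀ → (M *ᵥ z) i = 0 := fun i hi => by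
      have := congrFun hz i
      simpa [Matrix.mulVec, Matrix.updateRow_ne hi] using this
    have hv₀z : v₀ ⬝ᵥ z = 0 := by
      have := congrFun hz i₀
      simpa [Matrix.mulVec] using this
    have hMz : M *ᵥ z = 0 := by
      have h1 : v₀ ⬝ᵥ (M *ᵥ z) = 0 := by
        rw [Matrix.dotProduct_mulVec, ← Matrix.mulVec_transpose, hZ.eq, hMv₀, zero_dotProduct]
      have h2 : v₀ ⬝ᵥ (M *ᵥ z) = v₀ i₀ * (M *ᵥ z) i₀ :=
        Finset.sum_eq_single i₀ (fun i _ hi => by rw [hrow i hi, mul_zero]) (by simp)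
      rw [h2] at h1
      funext i
      by_cases hi : i = i₀
      · subst hi
        exact (mul_eq_zero.1 h1).resolve_left hi₀
      · exact hrow i hi
    obtain ⟨t, rfl⟩ := hspan z hMz
    rw [dotProduct_smul, smul_eq_mul, mul_eq_zero] at hv₀z
    rcases hv₀z with h | h
    · exact hz0 (by simp [h])
    · exact hv₀ne (dotProduct_self_eq_zero.1 h)
  have hdet0 : M.det = 0 := Matrix.exists_mulVec_eq_zero_iff.1 ⟨v₀, hv₀ne, hMv₀⟩
  have hadj0 : M.adjugate ≠ 0 := by
    intro h0
    apply hupd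
    rw [← Matrix.cramer_transpose_apply, Matrix.cramer_eq_adjugate_mulVec, hZ.eq, h0]
    simp
  have hadjS : ∀ i j, M.adjugate i j = M.adjugate j i := fun i j => by
    have h1 := Matrix.adjugate_transpose M
    rw [hZ.eq] at h1
    exact (congrFun (congrFun h1 i) j).symm
  obtain ⟨a, b, hab⟩ : ∃ a b, M.adjugate a b ≠ 0 := by
    by_contra! h
    exact hadj0 (by ext i j; exact h i j)
  have hcol : ∀ j, M *ᵥ (fun i => M.adjugate i j) = 0 := fun j => by
    have h1 := Matrix.mul_adjugate M
    rw [hdet0, zero_smul] at h1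
    funext i
    exact congrFun (congrFun h1 i) j
  have hcast : ∀ i j, M.adjugate i j = (Z.adjugate i j : ℝ) := fun i j => by
    have := (Int.castRingHom ℝ).map_adjugate Z
    exact (congrFun (congrFun this i) j).symm
  have hline : ∀ u : Fin p → ℝ, M *ᵥ u = 0 → ∃ t : ℝ, ∀ i, u i = t * M.adjugate i b := by
    intro u hu
    obtain ⟨s, hs⟩ := hspan _ hu
    obtain ⟨r, hr⟩ := hspan _ (hcol b)
    have hr0 : r ≠ 0 := by
      rintro rfl
      exact hab (by simpa using (congrFun hr a).symm)
    refine ⟨s / r, fun i => ?_⟩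
    have h1 := congrFun hs i
    have h2 := congrFun hr i
    simp only [Pi.smul_apply, smul_eq_mul] at h1 h2
    rw [← h1, ← h2]
    field_simp
  choose μ hμ using fun j => hline _ (hcol j)
  refine ⟨fun i => Z.adjugate i b, fun h => hab ?_, fun i => ?_, fun u hu => ?_,
    μ a / M.adjugate a b, ?_, ?_⟩
  · rw [hcast, show Z.adjugate a b = 0 from congrFun h a, Int.cast_zero]
  · simp only [← hcast]
    exact congrFun (hcol b) i
  · simp only [← hcast]
    exact hline u (funext hu)
  · have h1 := hμ b a
    have h2 := hμ a b
    rw [hadjS b a] at h2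
    intro h
    rw [div_eq_zero_iff, or_iff_left hab] at h
    rw [h, zero_mul] at h2
    exact hab h2
  · intro i j
    simp only [← hcast]
    have h1 : μ j * M.adjugate a b = μ a * M.adjugate j b := by
      rw [← hμ j a, ← hμ a j, hadjS]
    rw [hμ j i]
    field_simp
    linear_combination M.adjugate i b * h1

lemma isProperSymGAPSet_image {d' : ℕ} {g' : Fin d' → ℝ} {X' : ℕ} {t : ℝ} (ht : t ≠ 0)
    (hprop : ∀ m m' : Fin d' → ℤ, (∀ i, |m i| ≤ (X' : ℤ)) → (∀ i, |m' i| ≤ (X' : ℤ)) →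
      (∑ i, (m i : ℝ) * g' i) = (∑ i, (m' i : ℝ) * g' i) → m = m') {D : ℕ} (hd : d' ≤ D)
    {s : ℝ} (hs : (2 * (X' : ℝ) + 1) ^ d' ≤ s) :
    IsProperSymGAPSet {x : ℝ | ∃ m : Fin d' → ℤ, (∀ i, |m i| ≤ (X' : ℤ)) ∧
      x = t * ∑ i, (m i : ℝ) * g' i} D s := by
  have hsum : ∀ m : Fin d' → ℤ, ∑ i, (m i : ℝ) * (t * g' i) = t * ∑ i, (m i : ℝ) * g' i :=
    fun m => by
      rw [Finset.mul_sum]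
      exact Finset.sum_congr rfl fun i _ => by ring
  refine ⟨d', fun i => t * g' i, fun _ => X', hd, ?_, fun m m' hm hm' h => ?_, by simpa using hs⟩
  · simp only [hsum]
  · rw [hsum, hsum] at h
    exact hprop m m' hm hm' (mul_left_cancel₀ ht h)

lemma probRad_congr_scaled_sq {p : ℕ} {A : Matrix (Fin p) (Fin p) ℝ} {v : Fin p → ℤ} {l : ℝ}
    (hl : l ≠ 0) (hA : ∀ i j, A i j = l * v i * v j) :
    probRad p (fun x => ∑ i, ∑ j, A i j * x i * x j = 0) =
      probRad p (fun x => ∑ i, (v i : ℝ) * x i = 0) := by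
  have h : (fun x : Fin p → ℝ => ∑ i, ∑ j, A i j * x i * x j = 0) =
      fun x => ∑ i, (v i : ℝ) * x i = 0 := by
    funext x
    have : ∑ i, ∑ j, A i j * x i * x j = l * (∑ i, (v i : ℝ) * x i) ^ 2 := by
      rw [sq, Finset.sum_mul_sum, Finset.mul_sum]
      refine Finset.sum_congr rfl fun i _ => ?_
      rw [Finset.mul_sum]
      exact Finset.sum_congr rfl fun j _ => by rw [hA]; ring
    rw [this]
    simp [hl]
  rw [h]

lemma height_le {n p s B : ℕ} (hn : 2 ≤ n) (hp : p ≤ n) (hs : s ≤ n ^ 2) :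
    s * (s * (p * n ^ B)) ^ s * n ^ B ≤ n ^ ((B + 3) * (s + 1)) := by
  calc s * (s * (p * n ^ B)) ^ s * n ^ B ≤ n ^ 2 * (n ^ 2 * (n * n ^ B)) ^ s * n ^ B := by gcongr
    _ = n ^ ((B + 3) * s + (B + 2)) := by ring
    _ ≤ n ^ ((B + 3) * (s + 1)) := Nat.pow_le_pow_right (by omega) (by nlinarith)

/-- Structural theorem, degenerate case: if `M` is an `(n-1) × (n-1)` symmetric ±1 matrix
of rank `n - 2` whose quadratic form of cofactors `a_{ij}` (entries of the adjugate, which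
for a symmetric matrix coincides with the cofactor matrix) satisfies
`P(Σ a_{ij} xᵢ xⱼ = 0) ≥ n^{-C}`, then there is a nonzero vector `u` whose coordinates,
except at most `n^ε` of them, lie in a proper symmetric GAP of bounded rank and polynomial
size, all of whose coordinates are rationals with numerator and denominator at most
`n^{c·n^ε}`, and which is orthogonal to at least `n - c·n^ε` rows of `M`. -/
theorem structural_theorem_degenerate (ε C : ℝ) (hε0 : 0 < ε) (hε1 : ε < 1) (hC : 0 < C) :
    ∃ r₀ : ℕ, ∃ c : ℝ, 0 < c ∧ ∃ n₀ : ℕ, ∀ n : ℕ, n₀ ≤ n →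
      ∀ M : Matrix (Fin (n - 1)) (Fin (n - 1)) ℝ, M.IsSymm →
        (∀ i j, M i j = 1 ∨ M i j = -1) → M.rank = n - 2 →
        (n : ℝ) ^ (-C) ≤
          probRad (n - 1) (fun x => ∑ i, ∑ j, M.adjugate i j * x i * x j = 0) →
        ∃ u : Fin (n - 1) → ℝ, u ≠ 0 ∧
          (∃ Q : Set ℝ, IsProperSymGAPSet Q r₀ ((n : ℝ) ^ c) ∧
            ((Finset.univ.filter fun i => u i ∉ Q).card : ℝ) ≤ (n : ℝ) ^ ε) ∧
          (∀ i, ∃ p q : ℤ, q ≠ 0 ∧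
            |(p : ℝ)| ≤ (n : ℝ) ^ (c * (n : ℝ) ^ ε) ∧
            |(q : ℝ)| ≤ (n : ℝ) ^ (c * (n : ℝ) ^ ε) ∧ u i = (p : ℝ) / (q : ℝ)) ∧
          ((n : ℝ) - c * (n : ℝ) ^ ε ≤
            ((Finset.univ.filter fun i => ∑ j, M i j * u j = 0).card : ℝ)) := by
  obtain ⟨D, B, hDB⟩ := exists_commonDep_of_concentration hε0 hε1 ⌈C⌉₊
  choose B₁ hB₁ using fun d => exists_proper_cover d B
  set B₂ := ∑ d ∈ Finset.range (D + 1), B₁ d with hB₂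
  have hB₁₂ : ∀ d ≤ D, B₁ d ≤ B₂ := fun d hd =>
    Finset.single_le_sum (f := B₁) (fun _ _ => Nat.zero_le _)
      (Finset.mem_range.2 (Nat.lt_succ_of_le hd))
  set c : ℕ := (B₂ + 2) * D + (B + 3) * (D + 2) with hc
  have hc1 : 1 ≤ c := by rw [hc]; nlinarith
  have hc1' : (1 : ℝ) ≤ c := by exact_mod_cast hc1
  refine ⟨D, c, by linarith, ?_⟩
  obtain ⟨n₀, hn₀⟩ := Filter.eventually_atTop.1
    (hDB.and ((Filter.eventually_ge_atTop 2).and (Filter.eventually_ge_atTop D)))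
  refine ⟨n₀, fun n hn M hMs hM1 hrank hprob => ?_⟩
  obtain ⟨hconc, hn2, hnD⟩ := hn₀ n hn
  have hn2' : (2 : ℝ) ≤ n := by exact_mod_cast hn2
  have hn1' : (1 : ℝ) ≤ n := by linarith
  have hnε : 1 ≤ (n : ℝ) ^ ε := Real.one_le_rpow hn1' hε0.le
  obtain ⟨Z, hZM, hZ1⟩ : ∃ Z : Matrix (Fin (n - 1)) (Fin (n - 1)) ℤ,
      M = Z.map (Int.cast : ℤ → ℝ) ∧ ∀ i j, |Z i j| ≤ 1 := by
    refine ⟨Matrix.of fun i j => if M i j = 1 then 1 else -1, ?_, fun i j => ?_⟩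
    · ext i j
      simp only [Matrix.map_apply, Matrix.of_apply]
      split_ifs with h
      · rw [h, Int.cast_one]
      · rw [(hM1 i j).resolve_left h, Int.cast_neg, Int.cast_one]
    · simp only [Matrix.of_apply]
      split_ifs <;> simp
  obtain ⟨v, hv0, hMv, hker, l, hl, hadj⟩ :=
    exists_adjugate_eq (by omega) Z (hZM ▸ hMs) (by rw [← hZM, hrank]; omega)
  rw [← hZM] at hadj
  rw [probRad_congr_scaled_sq hl hadj] at hprob
  obtain ⟨d, hdD, w, N, K, hN1, hNK, hcard⟩ := hconc (n - 1) v (by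
    refine le_trans ?_ hprob
    rw [one_div, ← Real.rpow_natCast, ← Real.rpow_neg (by positivity)]
    exact Real.rpow_le_rpow_of_exponent_le hn1' (neg_le_neg (Nat.le_ceil C)))
  have hX1 : 1 ≤ n ^ B := Nat.one_le_pow _ _ (by omega)
  obtain ⟨y, hy, hspan⟩ := exists_span_of_commonDep w hN1 hX1 hNK v
  obtain ⟨u, hu0, hMu, hu⟩ := exists_small_kernel_vector Z hZ1 hX1 y hy
    (fun h => hv0 (funext fun i => by simpa using congrFun h i)) hMv hspan
  obtain ⟨t, ht⟩ := hker (fun i => (u i : ℝ)) (fun i => by exact_mod_cast hMu i)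
  have ht0 : t ≠ 0 := by
    rintro rfl
    exact hu0 (funext fun i => by simpa using ht i)
  obtain ⟨d', hd', g', X', hX', hcov, hprop⟩ :=
    hB₁ d n hn2 (n ^ B) le_rfl (fun j => (w j : ℝ) / N)
  refine ⟨fun i => u i, fun h => hu0 (funext fun i => by simpa using congrFun h i),
    ⟨_, isProperSymGAPSet_image ht0 hprop (hd'.trans hdD) ?_, ?_⟩, fun i => ?_, ?_⟩
  · have h1 : 2 * X' + 1 ≤ n ^ (B₂ + 2) := by
      have h2 : X' ≤ n ^ B₂ := hX'.trans (Nat.pow_le_pow_right (by omega) (hB₁₂ d hdD))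
      have h3 : 1 ≤ n ^ B₂ := Nat.one_le_pow _ _ (by omega)
      calc 2 * X' + 1 ≤ n ^ B₂ * 2 ^ 2 := by omega
        _ ≤ n ^ B₂ * n ^ 2 := by gcongr
        _ = _ := by rw [pow_add]
    have h4 : (2 * X' + 1) ^ d' ≤ n ^ c := by
      calc (2 * X' + 1) ^ d' ≤ (n ^ (B₂ + 2)) ^ d' := by gcongr
        _ = n ^ ((B₂ + 2) * d') := by rw [pow_mul]
        _ ≤ n ^ c := by
          apply Nat.pow_le_pow_right (by omega)
          rw [hc]
          exact (Nat.mul_le_mul_left _ (hd'.trans hdD)).trans (Nat.le_add_right _ _)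
    rw [Real.rpow_natCast]
    exact_mod_cast h4
  · refine le_trans ?_ hcard
    norm_cast
    refine Finset.card_le_card fun i => ?_
    simp only [Finset.mem_filter, Finset.mem_univ, true_and]
    refine mt ?_
    rintro ⟨a, ha, hav⟩
    obtain ⟨m', hm', hsum⟩ := hcov a fun j => (ha j).trans (by exact_mod_cast hNK)
    refine ⟨m', hm', ?_⟩
    have hN0 : (N : ℝ) ≠ 0 := by
      have : N ≠ 0 := by omega
      exact_mod_cast this
    have h2 : (N : ℝ) * v i = ∑ j, (a j : ℝ) * w j := by exact_mod_cast hav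
    rw [ht i, ← hsum]
    congr 1
    rw [← mul_right_inj' hN0, h2, Finset.mul_sum]
    exact Finset.sum_congr rfl fun j _ => by field_simp
  · refine ⟨u i, 1, one_ne_zero, ?_, ?_, by simp⟩
    · set s := Fintype.card (Fin d ⊕ {i : Fin (n - 1) // ¬ CommonDep w K N (v i)}) with hs
      have hs' : s = d + (Finset.univ.filter fun i => ¬ CommonDep w K N (v i)).card := by
        rw [hs, Fintype.card_sum, Fintype.card_fin, Fintype.card_subtype]
      have hsn : s ≤ n ^ 2 := by
        have h1 := Finset.card_filter_le (Finset.univ : Finset (Fin (n - 1)))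
          (fun i => ¬ CommonDep w K N (v i))
        rw [Finset.card_univ, Fintype.card_fin] at h1
        have h2 : s ≤ n + n := by omega
        nlinarith
      have hsr : (s : ℝ) + 1 ≤ (D + 2) * (n : ℝ) ^ ε := by
        rw [hs']
        push_cast
        have h1 : (d : ℝ) ≤ D := by exact_mod_cast hdD
        have h2 : (D : ℝ) + 1 ≤ (D + 1) * (n : ℝ) ^ ε := le_mul_of_one_le_right (by positivity) hnε
        linarith
      have h1 : |u i| ≤ ((n ^ ((B + 3) * (s + 1)) : ℕ) : ℤ) :=
        (hu i).trans (by exact_mod_cast height_le hn2 (Nat.sub_le n 1) hsn)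
      have h2 : |(u i : ℝ)| ≤ (n : ℝ) ^ ((B + 3) * (s + 1)) := by exact_mod_cast h1
      refine h2.trans ?_
      rw [← Real.rpow_natCast]
      apply Real.rpow_le_rpow_of_exponent_le hn1'
      rw [hc]
      push_cast
      calc ((B : ℝ) + 3) * (s + 1) ≤ (B + 3) * ((D + 2) * (n : ℝ) ^ ε) := by gcongr
        _ = 0 + (B + 3) * (D + 2) * (n : ℝ) ^ ε := by ring
        _ ≤ (B₂ + 2) * D * (n : ℝ) ^ ε + (B + 3) * (D + 2) * (n : ℝ) ^ ε := by gcongr; positivity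
        _ = _ := by ring
    · rw [Int.cast_one, abs_one]
      exact Real.one_le_rpow hn1' (by positivity)
  · have h1 : (Finset.univ.filter fun i => ∑ j, M i j * (u j : ℝ) = 0) = Finset.univ :=
      Finset.filter_true_of_mem fun i _ => by
        rw [hZM]
        simp only [Matrix.map_apply]
        exact_mod_cast hMu i
    have h2 : (1 : ℝ) ≤ c * (n : ℝ) ^ ε := one_le_mul_of_one_le_of_one_le hc1' hnε
    rw [h1, Finset.card_univ, Fintype.card_fin, Nat.cast_sub (by omega), Nat.cast_one]
    linarith

end
end

section
/- Let 0 < ε < 1 and C > 0 be constants. There exist constants r₀ and c (depending only on C and ε) such that the following holds for all sufficiently large n. Let M be an (n−1)×(n−1) symmetric matrix with entries ±1 of rank n−1 (i.e. nonsingular), let a_{ij} (1 ≤ i,j ≤ n−1) denote its cofactors (a_{ij} = (−1)^{i+j} times the determinant of M with row i and column j deleted), and suppose that P(Σ_{i,j} a_{ij} x_i x_j = 0) ≥ n^{−C}, where x₁,…,x_{n−1} are independent Rademacher random variables. Then there exists a nonzero vector u = (u₁,…,u_{n−1}) ∈ ℝ^{n−1} such that: (i) all but at most n^ε of the coordinates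 u_i belong to a proper symmetric GAP of rank at most r₀ and size at most n^c; (ii) every coordinate u_i is rational of the form p/q with integers |p|, |q| ≤ n^{c·n^ε}, q ≠ 0; and (iii) u is orthogonal to at least n − c·n^ε of the rows of M. -/
open scoped Classical BigOperators

noncomputable section

/-- The (not necessarily proper) symmetric GAP with generators `w` and all dimensions `L`. -/
def boxGAP {r : ℕ} (w : Fin r → ℝ) (L : ℕ) : Set ℝ :=
  {x | ∃ p : Fin r → ℤ, (∀ i, |p i| ≤ (L : ℤ)) ∧ x = ∑ i, (p i : ℝ) * w i}

theorem boxGAP_mono {r : ℕ} {w : Fin r → ℝ} {L L' : ℕ} (h : L ≤ L') :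
    boxGAP w L ⊆ boxGAP w L' := by
  rintro x ⟨p, hp, rfl⟩
  exact ⟨p, fun i => (hp i).trans (by exact_mod_cast h), rfl⟩

theorem zero_mem_boxGAP {r : ℕ} (w : Fin r → ℝ) (L : ℕ) : (0 : ℝ) ∈ boxGAP w L :=
  ⟨0, fun i => by simp, by simp⟩

theorem add_mem_boxGAP {r : ℕ} {w : Fin r → ℝ} {L L' : ℕ} {x y : ℝ} (hx : x ∈ boxGAP w L)
    (hy : y ∈ boxGAP w L') : x + y ∈ boxGAP w (L + L') := by
  obtain ⟨p, hp, rfl⟩ := hx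
  obtain ⟨q, hq, rfl⟩ := hy
  refine ⟨p + q, fun i => ?_, ?_⟩
  · push_cast
    exact (abs_add_le _ _).trans (add_le_add (hp i) (hq i))
  · simp [add_mul, Finset.sum_add_distrib]

theorem natCast_mul_mem_boxGAP {r : ℕ} {w : Fin r → ℝ} {L : ℕ} {x : ℝ} (k : ℕ)
    (hx : x ∈ boxGAP w L) : (k : ℝ) * x ∈ boxGAP w (k * L) := by
  obtain ⟨p, hp, rfl⟩ := hx
  refine ⟨fun i => k * p i, fun i => ?_, ?_⟩
  · rw [abs_mul, Nat.abs_cast]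
    push_cast
    exact mul_le_mul_of_nonneg_left (hp i) (by positivity)
  · simp [Finset.mul_sum, mul_assoc]

theorem neg_mem_boxGAP {r : ℕ} {w : Fin r → ℝ} {L : ℕ} {x : ℝ} (hx : x ∈ boxGAP w L) :
    -x ∈ boxGAP w L := by
  obtain ⟨p, hp, rfl⟩ := hx
  exact ⟨-p, fun i => by simpa using hp i, by simp⟩

/-- `w` has no nontrivial integer relation with coefficients bounded by `L`. -/
def IsDissociated {r : ℕ} (w : Fin r → ℝ) (L : ℕ) : Prop :=
  ∀ m : Fin r → ℤ, (∀ i, |m i| ≤ (L : ℤ)) → ∑ i, (m i : ℝ) * w i = 0 → m = 0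

theorem IsDissociated.eq_of_sum_eq {r : ℕ} {w : Fin r → ℝ} {L L₁ L₂ : ℕ}
    (hw : IsDissociated w L) (hL : L₁ + L₂ ≤ L) {m m' : Fin r → ℤ}
    (hm : ∀ i, |m i| ≤ (L₁ : ℤ)) (hm' : ∀ i, |m' i| ≤ (L₂ : ℤ))
    (h : ∑ i, (m i : ℝ) * w i = ∑ i, (m' i : ℝ) * w i) : m = m' := by
  rw [← sub_eq_zero]
  refine hw _ (fun i => ?_) ?_
  · have := abs_sub (m i) (m' i)
    have h1 := hm i
    have h2 := hm' i
    have h3 : (L₁ : ℤ) + L₂ ≤ L := by exact_mod_cast hL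
    rw [Pi.sub_apply]
    linarith
  · simp [sub_mul, Finset.sum_sub_distrib, h]

/-- A bounded relation between the generators of a GAP makes it possible to drop one of them. -/
theorem exists_boxGAP_subset_of_not_isDissociated {r : ℕ} {w : Fin (r + 1) → ℝ} {H : ℕ}
    (hw : ¬ IsDissociated w H) :
    ∃ w' : Fin r → ℝ, ∀ L : ℕ, boxGAP w L ⊆ boxGAP w' (2 * L * H) := by
  simp only [IsDissociated, not_forall] at hw
  obtain ⟨m, hm, hrel, hne⟩ := hw
  obtain ⟨k, hk⟩ := Function.ne_iff.mp hne
  have hk' : (m k : ℝ) ≠ 0 := by exact_mod_cast hk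
  refine ⟨fun i => w (k.succAbove i) / m k, fun L => ?_⟩
  rintro x ⟨p, hp, rfl⟩
  refine ⟨fun i => p (k.succAbove i) * m k - p k * m (k.succAbove i), fun i => ?_, ?_⟩
  · refine (abs_sub _ _).trans ?_
    rw [abs_mul, abs_mul]
    have h1 := mul_le_mul (hp (k.succAbove i)) (hm k) (abs_nonneg _) (by positivity)
    have h2 := mul_le_mul (hp k) (hm (k.succAbove i)) (abs_nonneg _) (by positivity)
    push_cast
    linarith
  · rw [Fin.sum_univ_succAbove _ k] at hrel ⊢
    have hwk : w k = -(∑ i, (m (k.succAbove i) : ℝ) * w (k.succAbove i)) / m k := by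
      field_simp
      linarith
    rw [hwk, neg_div, mul_neg, Finset.sum_div, Finset.mul_sum, ← Finset.sum_neg_distrib,
      ← Finset.sum_add_distrib]
    refine Finset.sum_congr rfl fun i _ => ?_
    push_cast
    field_simp
    ring

/-- Every symmetric GAP is contained in a proper one of at most the same rank and of
polynomially comparable dimensions. -/
theorem exists_isDissociated_boxGAP_superset (r : ℕ) : ∀ (w : Fin r → ℝ) (L : ℕ),
    ∃ r' ≤ r, ∃ (w' : Fin r' → ℝ) (L' : ℕ), 4 * L' ≤ (4 * L) ^ 2 ^ r ∧
      IsDissociated w' (2 * L') ∧ boxGAP w L ⊆ boxGAP w' L' := by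
  induction r with
  | zero => exact fun w L => ⟨0, le_rfl, w, L, by simp, fun m _ _ => Subsingleton.elim _ _,
      subset_rfl⟩
  | succ r ih =>
    intro w L
    by_cases hw : IsDissociated w (2 * L)
    · exact ⟨r + 1, le_rfl, w, L, Nat.le_self_pow (by positivity) _, hw, subset_rfl⟩
    · obtain ⟨w₁, hw₁⟩ := exists_boxGAP_subset_of_not_isDissociated hw
      obtain ⟨r', hr', w', L', hL', hd, hsub⟩ := ih w₁ (2 * L * (2 * L))
      refine ⟨r', by omega, w', L', hL'.trans (le_of_eq ?_), hd, (hw₁ L).trans hsub⟩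
      rw [show 4 * (2 * L * (2 * L)) = (4 * L) ^ 2 by ring, ← pow_mul, pow_succ 2 r, mul_comm 2]

theorem IsDissociated.isProperSymGAPSet {r : ℕ} {w : Fin r → ℝ} {L : ℕ}
    (hw : IsDissociated w (2 * L)) :
    IsProperSymGAPSet (boxGAP w L) r ((2 * (L : ℝ) + 1) ^ r) := by
  refine ⟨r, w, fun _ => L, le_rfl, rfl, fun m m' hm hm' h => ?_, by simp⟩
  exact hw.eq_of_sum_eq (by omega) hm hm' h

theorem apply_natCast_mul_le {ρ : ℝ → ℝ} (hρ0 : ρ 0 = 0) (hρ : ∀ a b, ρ (a + b) ≤ ρ a + ρ b)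
    (k : ℕ) (a : ℝ) : ρ (k * a) ≤ k * ρ a := by
  induction k with
  | zero => simp [hρ0]
  | succ k ih =>
    push_cast
    rw [add_mul, one_mul, add_mul, one_mul]
    linarith [hρ (k * a) a]

theorem apply_sum_le {ρ : ℝ → ℝ} (hρ0 : ρ 0 = 0) (hρ : ∀ a b, ρ (a + b) ≤ ρ a + ρ b)
    {ι : Type*} (s : Finset ι) (f : ι → ℝ) : ρ (∑ i ∈ s, f i) ≤ ∑ i ∈ s, ρ (f i) := by
  induction s using Finset.induction_on with
  | empty => simp [hρ0]
  | insert i s hi ih =>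
    rw [Finset.sum_insert hi, Finset.sum_insert hi]
    linarith [hρ (f i) (∑ i ∈ s, f i)]

/-- Either `w` can be extended by a given element to a longer dissociated sequence, or a small
multiple of the element lies in the GAP generated by `w`. -/
theorem IsDissociated.cons {r : ℕ} {w : Fin r → ℝ} {h : ℕ} (hw : IsDissociated w h) {a : ℝ}
    (ha : ∀ q : ℕ, 1 ≤ q → q ≤ h → (q : ℝ) * a ∉ boxGAP w h) :
    IsDissociated (Fin.cons a w : Fin (r + 1) → ℝ) h := by
  intro m hm hrel
  rw [Fin.sum_univ_succ] at hrel
  simp only [Fin.cons_zero, Fin.cons_succ] at hrel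
  by_cases h0 : m 0 = 0
  · have := hw (fun i => m i.succ) (fun i => hm _) (by simpa [h0] using hrel)
    funext i
    refine Fin.cases h0 (fun j => ?_) i
    exact congrFun this j
  · exfalso
    have hmem : (∑ i : Fin r, (m i.succ : ℝ) * w i) ∈ boxGAP w h :=
      ⟨fun i => m i.succ, fun i => hm _, rfl⟩
    have hm0 := hm 0
    rw [Int.abs_eq_natAbs] at hm0
    refine ha (m 0).natAbs (by omega) (by omega) ?_
    have hcast : (((m 0).natAbs : ℕ) : ℝ) = |(m 0 : ℝ)| := by
      rw [Nat.cast_natAbs, Int.cast_abs]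
    rw [hcast]
    rcases abs_choice (m 0 : ℝ) with hc | hc
    · rw [hc, show (m 0 : ℝ) * a = -(∑ i : Fin r, (m i.succ : ℝ) * w i) by linarith]
      exact neg_mem_boxGAP hmem
    · rw [hc, show -(m 0 : ℝ) * a = (∑ i : Fin r, (m i.succ : ℝ) * w i) by linarith]
      exact hmem

theorem IsDissociated.pow_le_of_card_le {ρ : ℝ → ℝ} (hρ0 : ρ 0 = 0)
    (hρ : ∀ a b, ρ (a + b) ≤ ρ a + ρ b) {h N r : ℕ} (hh : 1 ≤ h) (hr : r ≤ h)
    (hcard : ∀ X : Finset ℝ, (∀ x ∈ X, ρ x ≤ 1) → X.card ≤ N) {w : Fin r → ℝ}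
    (hw : IsDissociated w h) (hwρ : ∀ i, (h : ℝ) ^ 2 * ρ (w i) ≤ 1) : h ^ r ≤ N := by
  let F : (Fin r → Fin h) → ℝ := fun c => ∑ i, ((c i : ℕ) : ℝ) * w i
  have hinj : Function.Injective F := by
    intro c c' hcc
    have := hw (fun i => ((c i : ℕ) : ℤ) - ((c' i : ℕ) : ℤ)) (fun i => by
        have := (c i).2
        have := (c' i).2
        rw [abs_le]
        omega) (by
        have : F c - F c' = 0 := sub_eq_zero.mpr hcc
        simpa [F, sub_mul, Finset.sum_sub_distrib] using this)
    funext i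
    have := congrFun this i
    simp only [Pi.zero_apply] at this
    ext
    omega
  have hX := hcard (Finset.univ.image F) (by
    simp only [Finset.mem_image, Finset.mem_univ, true_and, forall_exists_index,
      forall_apply_eq_imp_iff]
    intro c
    have hh' : (0 : ℝ) < h := by exact_mod_cast hh
    have hle : ∀ i, ρ (((c i : ℕ) : ℝ) * w i) ≤ 1 / h := fun i => by
      have h1 : (((c i : ℕ) : ℝ)) ≤ h := by exact_mod_cast (c i).2.le
      have h2 : ρ (w i) ≤ 1 / (h : ℝ) ^ 2 := by
        rw [le_div_iff₀ (by positivity)]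
        linarith [hwρ i]
      calc _ ≤ ((c i : ℕ) : ℝ) * ρ (w i) := apply_natCast_mul_le hρ0 hρ _ _
        _ ≤ ((c i : ℕ) : ℝ) * (1 / (h : ℝ) ^ 2) := by gcongr
        _ ≤ h * (1 / (h : ℝ) ^ 2) := by gcongr
        _ = 1 / h := by field_simp
    calc _ ≤ ∑ i, ρ (((c i : ℕ) : ℝ) * w i) := apply_sum_le hρ0 hρ _ _
      _ ≤ ∑ _i : Fin r, 1 / (h : ℝ) := Finset.sum_le_sum fun i _ => hle i
      _ = r / h := by simp [div_eq_mul_inv]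
      _ ≤ 1 := by
        rw [div_le_one hh']
        exact_mod_cast hr)
  rwa [Finset.card_image_of_injective _ hinj, Finset.card_univ, Fintype.card_fun,
    Fintype.card_fin, Fintype.card_fin] at hX

/-- A set of elements of small seminorm in a group with few elements of seminorm at most one
is commensurable with a GAP of bounded rank. -/
theorem exists_boxGAP_natCast_mul_mem {ρ : ℝ → ℝ} (hρ0 : ρ 0 = 0)
    (hρ : ∀ a b, ρ (a + b) ≤ ρ a + ρ b) {h R : ℕ} (hh : 2 ≤ h) (hR : R + 1 ≤ h)
    (hcard : ∀ X : Finset ℝ, (∀ x ∈ X, ρ x ≤ 1) → X.card ≤ h ^ R) {A : Set ℝ}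
    (hA : ∀ a ∈ A, (h : ℝ) ^ 2 * ρ a ≤ 1) :
    ∃ r ≤ R, ∃ w : Fin r → ℝ, ∀ a ∈ A, ∃ q : ℕ, 1 ≤ q ∧ q ≤ h ∧ (q : ℝ) * a ∈ boxGAP w h := by
  by_contra hcon
  push Not at hcon
  have key : ∀ r ≤ R + 1, ∃ w : Fin r → ℝ, (∀ i, w i ∈ A) ∧ IsDissociated w h := by
    intro r
    induction r with
    | zero => exact fun _ => ⟨Fin.elim0, fun i => i.elim0, fun m _ _ => Subsingleton.elim _ _⟩
    | succ r ih =>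
      intro hr
      obtain ⟨w, hwA, hw⟩ := ih (by omega)
      obtain ⟨a, ha, hna⟩ := hcon r (by omega) w
      exact ⟨Fin.cons a w, fun i => Fin.cases ha hwA i, hw.cons hna⟩
  obtain ⟨w, hwA, hw⟩ := key (R + 1) le_rfl
  have := hw.pow_le_of_card_le hρ0 hρ (by omega) hR hcard fun i => hA _ (hwA i)
  exact absurd this (not_le.mpr (Nat.pow_lt_pow_right (by omega) (by omega)))

/-- In the situation of a sufficiently dissociated `w`, the denominators can be made equal. -/
theorem exists_common_denominator_s6 {ρ : ℝ → ℝ} (hρ0 : ρ 0 = 0)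
    (hρ : ∀ a b, ρ (a + b) ≤ ρ a + ρ b) {h R G : ℕ} (hh : 2 ≤ h) (hRh : h ^ R < 2 ^ h)
    (hG : 1 ≤ G) (hcard : ∀ X : Finset ℝ, (∀ x ∈ X, ρ x ≤ 1) → X.card ≤ h ^ R) {A : Set ℝ}
    (hA : ∀ a ∈ A, (h : ℝ) ^ 2 * ρ a ≤ 1) {r : ℕ} {w : Fin r → ℝ}
    (hw : IsDissociated w (h ^ (2 * G + R * G + 4)))
    (hcov : ∀ a ∈ A, ∃ q : ℕ, 1 ≤ q ∧ q ≤ h ^ G ∧ (q : ℝ) * a ∈ boxGAP w (h ^ G)) :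
    ∃ D : ℕ, 1 ≤ D ∧ D ≤ h ^ (R * G) ∧ ∀ a ∈ A, (D : ℝ) * a ∈ boxGAP w (D * h ^ G) := by
  by_contra hcon
  push Not at hcon
  have hhR : (0 : ℝ) < h := by exact_mod_cast (by omega : 0 < h)
  have hcardX : ∀ (t : ℕ) (X : Finset ℝ), t ≤ h → (∀ x ∈ X, h * ρ x ≤ t) → X.card ≤ h ^ R := by
    intro t X ht hX
    refine hcard X fun x hx => ?_
    have h1 := hX x hx
    have h2 : (t : ℝ) ≤ h := by exact_mod_cast ht
    by_contra hlt
    nlinarith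
  have key : ∀ t ≤ h, ∃ (D : ℕ) (X : Finset ℝ), 1 ≤ D ∧ D ≤ X.card ^ G ∧ 2 ^ t ≤ X.card ∧
      ∀ x ∈ X, h * ρ x ≤ t ∧ (D : ℝ) * x ∈ boxGAP w (D * h ^ G * (t * h)) := by
    intro t
    induction t with
    | zero => exact fun _ => ⟨1, {0}, by simp, by simp, by simp, by simp [hρ0, zero_mem_boxGAP]⟩
    | succ t ih =>
      intro ht
      obtain ⟨D, X, hD1, hDX, htX, hX⟩ := ih (by omega)
      have hXR : X.card ≤ h ^ R := hcardX t X (by omega) fun x hx => (hX x hx).1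
      have hDR : D ≤ h ^ (R * G) := by
        rw [pow_mul]
        exact hDX.trans (Nat.pow_le_pow_left hXR _)
      obtain ⟨a, ha, hna⟩ := hcon D hD1 hDR
      obtain ⟨q, hq1, hq, hqa⟩ := hcov a ha
      let P : ℕ → Prop := fun e => 1 ≤ e ∧ ((e * D : ℕ) : ℝ) * a ∈ boxGAP w (e * D * h ^ G)
      have hPq : P q := by
        refine ⟨hq1, ?_⟩
        have := natCast_mul_mem_boxGAP D hqa
        rw [← mul_assoc, ← Nat.cast_mul, mul_comm D q] at this
        refine boxGAP_mono ?_ this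
        gcongr
        exact Nat.le_mul_of_pos_left _ (by omega)
      have hP : ∃ e, P e := ⟨q, hPq⟩
      obtain ⟨e, he, hmin⟩ : ∃ e, P e ∧ ∀ f < e, ¬ P f :=
        ⟨Nat.find hP, Nat.find_spec hP, fun f hf => Nat.find_min hP hf⟩
      have heq : e ≤ h ^ G := by
        refine le_trans ?_ hq
        by_contra hlt
        exact hmin q (by omega) hPq
      have he2 : 2 ≤ e := by
        have h1 := he.1
        have h2 : e ≠ 1 := by
          rintro rfl
          have := he.2
          simp only [one_mul] at this
          exact hna this
        omega
      have hnot : ∀ f, 1 ≤ f → f < e → f < h → ∀ x ∈ X, ∀ x' ∈ X, x + f * a ≠ x' := by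
        intro f hf1 hfe hfh x hx x' hx' hxx
        apply hmin f hfe
        refine ⟨hf1, ?_⟩
        have hmem : ((f * D : ℕ) : ℝ) * a ∈
            boxGAP w (D * h ^ G * (t * h) + D * h ^ G * (t * h)) := by
          have := add_mem_boxGAP (hX x' hx').2 (neg_mem_boxGAP (hX x hx).2)
          rwa [show (D : ℝ) * x' + -(D * x) = ((f * D : ℕ) : ℝ) * a by
            rw [← hxx]; push_cast; ring] at this
        obtain ⟨p, hp, hpa⟩ := hmem
        obtain ⟨s, hs, hsa⟩ := hqa
        have heqv : (fun i => (q : ℤ) * p i) = fun i => ((f * D : ℕ) : ℤ) * s i := by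
          refine hw.eq_of_sum_eq (L₁ := h ^ G * (D * h ^ G * (t * h) + D * h ^ G * (t * h)))
            (L₂ := h * D * h ^ G) ?_ (fun i => ?_) (fun i => ?_) ?_
          · have h1 : h ^ G * (D * h ^ G * (t * h) + D * h ^ G * (t * h)) + h * D * h ^ G
                ≤ h ^ G * (h ^ (R * G) * h ^ G * (h * h) + h ^ (R * G) * h ^ G * (h * h))
                  + h * h ^ (R * G) * h ^ G := by
              have : t ≤ h := by omega
              gcongr
            refine h1.trans ?_
            have h2 : h * h ^ (R * G) * h ^ G ≤ h ^ G * h ^ G * h ^ (R * G) * h ^ 2 := by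
              have h3 : 1 ≤ h ^ G := Nat.one_le_pow _ _ (by omega)
              calc h * h ^ (R * G) * h ^ G = 1 * h ^ G * h ^ (R * G) * h ^ 1 := by ring
                _ ≤ h ^ G * h ^ G * h ^ (R * G) * h ^ 2 := by
                  gcongr <;> omega
            have h4 : h ^ (2 * G + R * G + 4) = h ^ G * h ^ G * h ^ (R * G) * h ^ 2 * h ^ 2 := by
              ring
            have h5 : 4 ≤ h ^ 2 := by nlinarith
            rw [h4]
            calc _ ≤ h ^ G * (h ^ (R * G) * h ^ G * (h * h) + h ^ (R * G) * h ^ G * (h * h))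
                  + h ^ G * h ^ G * h ^ (R * G) * h ^ 2 := by gcongr
              _ = h ^ G * h ^ G * h ^ (R * G) * h ^ 2 * 3 := by ring
              _ ≤ _ := by gcongr; omega
          · rw [abs_mul, Nat.abs_cast]
            push_cast
            have h1 := hp i
            push_cast at h1
            have h2 : (q : ℤ) ≤ (h : ℤ) ^ G := by exact_mod_cast hq
            gcongr
          · rw [abs_mul, Nat.abs_cast]
            push_cast
            have h1 := hs i
            push_cast at h1
            have h2 : (f : ℤ) ≤ h := by exact_mod_cast hfh.le
            gcongr
          · push_cast at hpa ⊢
            simp only [mul_assoc, ← Finset.mul_sum]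
            rw [← hpa, ← hsa]
            ring
        refine ⟨p, fun i => ?_, hpa⟩
        have h1 : (q : ℤ) * p i = ((f * D : ℕ) : ℤ) * s i := congrFun heqv i
        have h2 : (q : ℤ) * |p i| = ((f * D : ℕ) : ℤ) * |s i| := by
          rw [← Nat.abs_cast q, ← Nat.abs_cast (f * D), ← abs_mul, ← abs_mul, h1]
        have h3 : |p i| ≤ q * |p i| :=
          le_mul_of_one_le_left (abs_nonneg _) (by exact_mod_cast hq1)
        calc |p i| ≤ ((f * D : ℕ) : ℤ) * |s i| := h2 ▸ h3
          _ ≤ ((f * D : ℕ) : ℤ) * ((h ^ G : ℕ) : ℤ) := by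
            have := hs i
            gcongr
          _ = _ := by push_cast; ring
      set k := min e h with hk
      have hk2 : 2 ≤ k := le_min he2 hh
      let Φ : ℝ × ℕ → ℝ := fun z => z.1 + z.2 * a
      have hinj : Set.InjOn Φ (X ×ˢ Finset.range k : Finset (ℝ × ℕ)) := by
        have aux : ∀ x ∈ X, ∀ x' ∈ X, ∀ i < k, ∀ j < k, x + i * a = x' + j * a → ¬ i < j := by
          intro x hx x' hx' i hi j hj hxx hij
          refine hnot (j - i) (by omega) (by omega) (by omega) x' hx' x hx ?_
          rw [Nat.cast_sub hij.le]
          linarith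
        rintro ⟨x, i⟩ hxi ⟨x', j⟩ hxj hxx
        simp only [Finset.coe_product, Set.mem_prod, Finset.mem_coe, Finset.mem_range] at hxi hxj
        simp only [Φ] at hxx
        have h1 := aux x hxi.1 x' hxj.1 i hxi.2 j hxj.2 hxx
        have h2 := aux x' hxj.1 x hxi.1 j hxj.2 i hxi.2 hxx.symm
        obtain rfl : i = j := by omega
        simpa using hxx
      have hXcard : ((X ×ˢ Finset.range k).image Φ).card = X.card * k := by
        rw [Finset.card_image_of_injOn hinj, Finset.card_product, Finset.card_range]
      refine ⟨e * D, (X ×ˢ Finset.range k).image Φ, ?_, ?_, ?_, ?_⟩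
      · exact Nat.mul_pos he.1 hD1
      · rw [hXcard, mul_pow, mul_comm e D]
        refine Nat.mul_le_mul hDX ?_
        rcases le_total e h with heh | heh
        · rw [hk, min_eq_left heh]
          exact Nat.le_self_pow (by omega) _
        · rwa [hk, min_eq_right heh]
      · rw [hXcard, pow_succ]
        exact Nat.mul_le_mul htX hk2
      · intro y hy
        simp only [Finset.mem_image, Finset.mem_product, Finset.mem_range, Prod.exists] at hy
        obtain ⟨x, i, ⟨hx, hi⟩, rfl⟩ := hy
        have hih : i ≤ h := by omega
        refine ⟨?_, ?_⟩
        · have h1 := hρ x (i * a)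
          have h2 := apply_natCast_mul_le hρ0 hρ i a
          have h3 := (hX x hx).1
          have h4 := hA a ha
          have h5 : (i : ℝ) ≤ h := by exact_mod_cast hih
          have h6 : h * (i * ρ a) ≤ 1 := by
            rcases le_total 0 (ρ a) with hpos | hneg
            · calc h * (i * ρ a) ≤ h * (h * ρ a) := by gcongr
                _ = h ^ 2 * ρ a := by ring
                _ ≤ 1 := h4
            · have : (i : ℝ) * ρ a ≤ 0 := mul_nonpos_of_nonneg_of_nonpos (by positivity) hneg
              nlinarith
          push_cast
          simp only [Φ]
          nlinarith
        · have h1 := natCast_mul_mem_boxGAP e (hX x hx).2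
          have h2 := natCast_mul_mem_boxGAP i he.2
          have h3 := add_mem_boxGAP h1 h2
          have h4 : ((e * D : ℕ) : ℝ) * Φ (x, i) =
              e * (D * x) + i * (((e * D : ℕ) : ℝ) * a) := by
            simp only [Φ]
            push_cast
            ring
          rw [h4]
          refine boxGAP_mono ?_ h3
          calc e * (D * h ^ G * (t * h)) + i * (e * D * h ^ G)
              ≤ e * (D * h ^ G * (t * h)) + h * (e * D * h ^ G) := by gcongr
            _ = e * D * h ^ G * ((t + 1) * h) := by ring
  obtain ⟨D, X, -, -, htX, hX⟩ := key h le_rfl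
  have := hcardX h X le_rfl fun x hx => (hX x hx).1
  omega

theorem exists_boxGAP_superset_of_natCast_mul_mem (R r : ℕ) : ∀ G : ℕ, 1 ≤ G → ∃ F : ℕ,
    ∀ (ρ : ℝ → ℝ), ρ 0 = 0 → (∀ a b, ρ (a + b) ≤ ρ a + ρ b) → ∀ h : ℕ, 2 ≤ h → h ^ R < 2 ^ h →
    (∀ X : Finset ℝ, (∀ x ∈ X, ρ x ≤ 1) → X.card ≤ h ^ R) → ∀ A : Set ℝ,
    (∀ a ∈ A, (h : ℝ) ^ 2 * ρ a ≤ 1) → ∀ w : Fin r → ℝ,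
    (∀ a ∈ A, ∃ q : ℕ, 1 ≤ q ∧ q ≤ h ^ G ∧ (q : ℝ) * a ∈ boxGAP w (h ^ G)) →
    ∃ r' ≤ r, ∃ w' : Fin r' → ℝ, A ⊆ boxGAP w' (h ^ F) := by
  have main : ∀ (r G : ℕ), 1 ≤ G → ∀ (ρ : ℝ → ℝ), ρ 0 = 0 → (∀ a b, ρ (a + b) ≤ ρ a + ρ b) →
      ∀ h : ℕ, 2 ≤ h → h ^ R < 2 ^ h →
      (∀ X : Finset ℝ, (∀ x ∈ X, ρ x ≤ 1) → X.card ≤ h ^ R) → ∀ A : Set ℝ,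
      (∀ a ∈ A, (h : ℝ) ^ 2 * ρ a ≤ 1) → ∀ w : Fin r → ℝ,
      IsDissociated w (h ^ (2 * G + R * G + 4)) →
      (∀ a ∈ A, ∃ q : ℕ, 1 ≤ q ∧ q ≤ h ^ G ∧ (q : ℝ) * a ∈ boxGAP w (h ^ G)) →
      ∃ r' ≤ r, ∃ w' : Fin r' → ℝ, A ⊆ boxGAP w' (h ^ (R * G + G)) := by
    intro r G hG ρ hρ0 hρ h hh hRh hcard A hA w hw hcov
    obtain ⟨D, hD1, hD, hDA⟩ := exists_common_denominator_s6 hρ0 hρ hh hRh hG hcard hA hw hcov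
    have hD0 : (D : ℝ) ≠ 0 := by
      have : D ≠ 0 := by omega
      exact_mod_cast this
    refine ⟨r, le_rfl, fun i => w i / D, fun a ha => ?_⟩
    obtain ⟨p, hp, hpa⟩ := hDA a ha
    refine ⟨p, fun i => (hp i).trans ?_, ?_⟩
    · rw [pow_add]
      exact_mod_cast Nat.mul_le_mul_right _ hD
    · rw [eq_comm, ← mul_right_inj' hD0, hpa, Finset.mul_sum]
      refine Finset.sum_congr rfl fun i _ => ?_
      field_simp
  induction r with
  | zero =>
    intro G hG
    refine ⟨R * G + G, fun ρ hρ0 hρ h hh hRh hcard A hA w hcov => ?_⟩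
    exact main 0 G hG ρ hρ0 hρ h hh hRh hcard A hA w (fun m _ _ => Subsingleton.elim _ _) hcov
  | succ r ih =>
    intro G hG
    set G' := G + (2 * G + R * G + 4) + 1 with hG'
    obtain ⟨F, hF⟩ := ih G' (by omega)
    refine ⟨F + (R * G + G), fun ρ hρ0 hρ h hh hRh hcard A hA w hcov => ?_⟩
    have hmono : ∀ {i j : ℕ}, i ≤ j → h ^ i ≤ h ^ j :=
      fun hij => Nat.pow_le_pow_right (by omega) hij
    by_cases hw : IsDissociated w (h ^ (2 * G + R * G + 4))
    · obtain ⟨r', hr', w', hw'⟩ := main (r + 1) G hG ρ hρ0 hρ h hh hRh hcard A hA w hw hcov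
      exact ⟨r', hr', w', hw'.trans (boxGAP_mono (hmono (by omega)))⟩
    · obtain ⟨w₁, hw₁⟩ := exists_boxGAP_subset_of_not_isDissociated hw
      have hle : 2 * h ^ G * h ^ (2 * G + R * G + 4) ≤ h ^ G' := by
        calc 2 * h ^ G * h ^ (2 * G + R * G + 4) ≤ h * h ^ G * h ^ (2 * G + R * G + 4) := by gcongr
          _ = h ^ G' := by rw [hG']; ring
      obtain ⟨r', hr', w', hw'⟩ := hF ρ hρ0 hρ h hh hRh hcard A hA w₁ (fun a ha => by
        obtain ⟨q, hq1, hq, hqa⟩ := hcov a ha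
        exact ⟨q, hq1, hq.trans (hmono (by omega)), boxGAP_mono hle (hw₁ _ hqa)⟩)
      exact ⟨r', by omega, w', hw'.trans (boxGAP_mono (hmono (by omega)))⟩

/-- A set of elements of small seminorm in a group with few elements of seminorm at most one
is contained in a GAP of bounded rank and polynomial size. -/
theorem exists_boxGAP_superset (R : ℕ) : ∃ F : ℕ,
    ∀ (ρ : ℝ → ℝ), ρ 0 = 0 → (∀ a b, ρ (a + b) ≤ ρ a + ρ b) → ∀ h : ℕ, 2 ≤ h → h ^ R < 2 ^ h →
    (∀ X : Finset ℝ, (∀ x ∈ X, ρ x ≤ 1) → X.card ≤ h ^ R) → ∀ A : Set ℝ,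
    (∀ a ∈ A, (h : ℝ) ^ 2 * ρ a ≤ 1) →
    ∃ r ≤ R, ∃ w : Fin r → ℝ, A ⊆ boxGAP w (h ^ F) := by
  choose F hF using fun r => exists_boxGAP_superset_of_natCast_mul_mem R r 1 le_rfl
  refine ⟨∑ r ∈ Finset.range (R + 1), F r, fun ρ hρ0 hρ h hh hRh hcard A hA => ?_⟩
  have hR : R + 1 ≤ h := by
    have h1 : 2 ^ R ≤ h ^ R := Nat.pow_le_pow_left hh R
    have h2 : 2 ^ R < 2 ^ h := h1.trans_lt hRh
    exact (Nat.pow_lt_pow_iff_right (by norm_num)).mp h2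
  obtain ⟨r, hr, w, hw⟩ := exists_boxGAP_natCast_mul_mem hρ0 hρ hh hR hcard hA
  obtain ⟨r', hr', w', hw'⟩ := hF r ρ hρ0 hρ h hh hRh hcard A hA w (by simpa using hw)
  refine ⟨r', by omega, w', hw'.trans (boxGAP_mono (Nat.pow_le_pow_right (by omega) ?_))⟩
  exact Finset.single_le_sum (f := F) (fun _ _ => Nat.zero_le _) (Finset.mem_range.mpr (by omega))

/-- The vector in `ℓ²(ℝ)` counting how often each real number is a subset sum of `v` over
subsets of `S`, translated by `a`. -/
def subsetSumVec {ι : Type*} (v : ι → ℝ) (S : Finset ι) (a : ℝ) : lp (fun _ : ℝ => ℝ) 2 :=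
  ∑ T ∈ S.powerset, lp.single 2 (∑ i ∈ T, v i + a) (1 : ℝ)

theorem inner_subsetSumVec {ι : Type*} (v : ι → ℝ) (S : Finset ι) (a b : ℝ) :
    inner ℝ (subsetSumVec v S a) (subsetSumVec v S b) =
      (((S.powerset ×ˢ S.powerset).filter fun T : Finset ι × Finset ι =>
        ∑ i ∈ T.1, v i + a = ∑ i ∈ T.2, v i + b).card : ℝ) := by
  have h : ∀ x y : ℝ, inner ℝ (lp.single 2 x (1 : ℝ) : lp (fun _ : ℝ => ℝ) 2)
      (lp.single 2 y (1 : ℝ)) = if x = y then (1 : ℝ) else 0 := by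
    intro x y
    rw [lp.inner_single_left]
    by_cases hxy : x = y
    · subst hxy; simp
    · simp [hxy]
  rw [subsetSumVec, subsetSumVec, sum_inner, Finset.card_filter, Finset.sum_product]
  simp only [inner_sum, h]
  push_cast
  rfl

theorem inner_subsetSumVec_add {ι : Type*} (v : ι → ℝ) (S : Finset ι) (a b c : ℝ) :
    inner ℝ (subsetSumVec v S (a + c)) (subsetSumVec v S (b + c)) =
      inner ℝ (subsetSumVec v S a) (subsetSumVec v S b) := by
  simp only [inner_subsetSumVec, ← add_assoc, add_left_inj]

theorem norm_subsetSumVec {ι : Type*} (v : ι → ℝ) (S : Finset ι) (a : ℝ) :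
    ‖subsetSumVec v S a‖ = ‖subsetSumVec v S 0‖ := by
  have h := inner_subsetSumVec_add v S 0 0 a
  rw [real_inner_self_eq_norm_sq, real_inner_self_eq_norm_sq, zero_add] at h
  exact (sq_eq_sq₀ (norm_nonneg _) (norm_nonneg _)).mp h

theorem norm_subsetSumVec_sub_add {ι : Type*} (v : ι → ℝ) (S : Finset ι) (a b c : ℝ) :
    ‖subsetSumVec v S (a + c) - subsetSumVec v S (b + c)‖ =
      ‖subsetSumVec v S a - subsetSumVec v S b‖ := by
  rw [← sq_eq_sq₀ (norm_nonneg _) (norm_nonneg _), norm_sub_sq_real, norm_sub_sq_real,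
    inner_subsetSumVec_add, norm_subsetSumVec v S (a + c), norm_subsetSumVec v S (b + c),
    norm_subsetSumVec v S a, norm_subsetSumVec v S b]

theorem subsetSumVec_insert {ι : Type*} (v : ι → ℝ) {S : Finset ι} {j : ι} (hj : j ∉ S) (a : ℝ) :
    subsetSumVec v (insert j S) a = subsetSumVec v S a + subsetSumVec v S (v j + a) := by
  rw [subsetSumVec, Finset.sum_powerset_insert hj]
  congr 1
  refine Finset.sum_congr rfl fun T hT => ?_
  rw [Finset.sum_insert (fun h => hj (Finset.mem_powerset.mp hT h))]
  congr 1
  ring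

theorem norm_sq_subsetSumVec_insert {ι : Type*} (v : ι → ℝ) {S : Finset ι} {j : ι} (hj : j ∉ S) :
    ‖subsetSumVec v (insert j S) 0‖ ^ 2 = 4 * ‖subsetSumVec v S 0‖ ^ 2 -
      ‖subsetSumVec v S 0 - subsetSumVec v S (v j)‖ ^ 2 := by
  rw [subsetSumVec_insert v hj, add_zero, norm_add_sq_real, norm_sub_sq_real,
    norm_subsetSumVec v S (v j)]
  ring

theorem norm_sq_subsetSumVec_le {ι : Type*} (v : ι → ℝ) {S J : Finset ι} (hSJ : S ⊆ J) :
    ‖subsetSumVec v J 0‖ ^ 2 * 4 ^ S.card ≤ ‖subsetSumVec v S 0‖ ^ 2 * 4 ^ J.card := by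
  have key : ∀ U : Finset ι, Disjoint S U →
      ‖subsetSumVec v (U ∪ S) 0‖ ^ 2 ≤ ‖subsetSumVec v S 0‖ ^ 2 * 4 ^ U.card := by
    intro U
    induction U using Finset.induction_on with
    | empty => simp
    | insert j U hj ih =>
      intro hd
      rw [Finset.disjoint_insert_right] at hd
      have hjU : j ∉ U ∪ S := by simp [hj, hd.1]
      rw [Finset.insert_union, norm_sq_subsetSumVec_insert v hjU, Finset.card_insert_of_notMem hj,
        pow_succ 4]
      have := ih hd.2
      nlinarith [sq_nonneg ‖subsetSumVec v (U ∪ S) 0 - subsetSumVec v (U ∪ S) (v j)‖]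
  have h1 := key (J \ S) Finset.disjoint_sdiff
  rw [Finset.sdiff_union_of_subset hSJ] at h1
  calc _ ≤ ‖subsetSumVec v S 0‖ ^ 2 * 4 ^ (J \ S).card * 4 ^ S.card := by gcongr
    _ = _ := by rw [mul_assoc, ← pow_add, Finset.card_sdiff_add_card_eq_card hSJ]

theorem sum_inner_subsetSumVec_le {ι : Type*} (v : ι → ℝ) (S : Finset ι) (X : Finset ℝ) :
    ∑ x ∈ X, inner ℝ (subsetSumVec v S 0) (subsetSumVec v S x) ≤ 4 ^ S.card := by
  simp only [inner_subsetSumVec, add_zero]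
  rw [← Nat.cast_sum, ← Finset.card_biUnion]
  · refine (Nat.cast_le.mpr (Finset.card_le_card (Finset.biUnion_subset.mpr fun x _ =>
      Finset.filter_subset _ _))).trans (le_of_eq ?_)
    rw [Finset.card_product, Finset.card_powerset, ← mul_pow]
    norm_num
  · intro x _ y _ hxy
    refine Finset.disjoint_filter.mpr fun T _ h1 h2 => hxy ?_
    linarith

theorem sq_card_le_norm_sq_subsetSumVec {ι : Type*} (v : ι → ℝ) (J : Finset ι) (b : ℝ) :
    ((J.powerset.filter fun T => ∑ i ∈ T, v i = b).card : ℝ) ^ 2 ≤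
      ‖subsetSumVec v J 0‖ ^ 2 := by
  rw [← real_inner_self_eq_norm_sq, inner_subsetSumVec, sq, ← Nat.cast_mul, ← Finset.card_product]
  refine Nat.cast_le.mpr (Finset.card_le_card fun T hT => ?_)
  simp only [Finset.mem_product, Finset.mem_filter] at hT ⊢
  exact ⟨⟨hT.1.1, hT.2.1⟩, by rw [hT.1.2, hT.2.2]⟩

/-- There is a small set `S` such that translating the subset sum distribution of `S` by any
further step `v j` hardly changes it. -/
theorem exists_almost_invariant_subset {ι : Type*} (v : ι → ℝ) (J : Finset ι) {η : ℝ}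
    (hη1 : η < 1) :
    ∃ S ⊆ J, ‖subsetSumVec v S 0‖ ^ 2 ≤ (4 * (1 - η)) ^ S.card ∧ ∀ j ∈ J, j ∉ S →
      ‖subsetSumVec v S 0 - subsetSumVec v S (v j)‖ ^ 2 ≤ 4 * η * ‖subsetSumVec v S 0‖ ^ 2 := by
  have hc : (0 : ℝ) < 4 * (1 - η) := by linarith
  obtain ⟨S, hSJ, hS⟩ := Finset.exists_min_image J.powerset
    (fun S => ‖subsetSumVec v S 0‖ ^ 2 / (4 * (1 - η)) ^ S.card) ⟨∅, by simp⟩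
  rw [Finset.mem_powerset] at hSJ
  refine ⟨S, hSJ, ?_, fun j hj hjS => ?_⟩
  · have h1 := hS ∅ (by simp)
    have h2 : ‖subsetSumVec v ∅ 0‖ ^ 2 = 1 := by
      rw [← real_inner_self_eq_norm_sq, inner_subsetSumVec]
      simp [Finset.filter_true_of_mem]
    rw [h2] at h1
    simpa [div_le_one (pow_pos hc _)] using h1
  · have h1 := hS (insert j S) (by
      rw [Finset.mem_powerset]
      exact Finset.insert_subset hj hSJ)
    rw [norm_sq_subsetSumVec_insert v hjS, Finset.card_insert_of_notMem hjS,
      div_le_div_iff₀ (pow_pos hc _) (pow_pos hc _), pow_succ (4 * (1 - η))] at h1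
    have h2 : 0 < (4 * (1 - η)) ^ S.card := pow_pos hc _
    have h3 : ‖subsetSumVec v S 0‖ ^ 2 * (4 * (1 - η)) ≤ 4 * ‖subsetSumVec v S 0‖ ^ 2 -
        ‖subsetSumVec v S 0 - subsetSumVec v S (v j)‖ ^ 2 := by
      refine le_of_mul_le_mul_right ?_ h2
      linarith
    linarith

/-- Inverse Littlewood–Offord theorem: if a value is taken by many subset sums of `v`, then all
but few of the `v j` lie in a GAP of bounded rank and polynomial size. -/
theorem inverse_littlewood_offord (R : ℕ) : ∃ F : ℕ, ∀ {ι : Type} (v : ι → ℝ) (J : Finset ι)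
    (b p : ℝ) (h : ℕ), 0 < p → 2 ≤ h → h ^ R < 2 ^ h → 2 / p ^ 2 ≤ (h : ℝ) ^ R →
    p * 2 ^ J.card ≤ ((J.powerset.filter fun T => ∑ i ∈ T, v i = b).card : ℝ) →
    ∃ S ⊆ J, (S.card : ℝ) ≤ 4 * (h : ℝ) ^ 4 * Real.log (1 / p ^ 2) ∧
      ∃ r ≤ R, ∃ w : Fin r → ℝ, ∀ j ∈ J, j ∉ S → v j ∈ boxGAP w (h ^ F) := by
  obtain ⟨F, hF⟩ := exists_boxGAP_superset R
  refine ⟨F, fun {ι} v J b p h hp hh hRh hpR hcount => ?_⟩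
  have hhR : (2 : ℝ) ≤ h := by exact_mod_cast hh
  have hh4 : (1 : ℝ) ≤ (h : ℝ) ^ 4 := one_le_pow₀ (by linarith)
  set η : ℝ := 1 / (4 * (h : ℝ) ^ 4) with hη
  have hη0 : 0 < η := by positivity
  have hη1 : η < 1 := by
    rw [hη, div_lt_one (by positivity)]
    linarith
  obtain ⟨S, hSJ, hScard, hS⟩ := exists_almost_invariant_subset v J hη1
  have hlow : p ^ 2 * 4 ^ S.card ≤ ‖subsetSumVec v S 0‖ ^ 2 := by
    have h1 := norm_sq_subsetSumVec_le v hSJ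
    have h2 := sq_card_le_norm_sq_subsetSumVec v J b
    have h3 : (p * 2 ^ J.card) ^ 2 ≤ ‖subsetSumVec v J 0‖ ^ 2 :=
      (pow_le_pow_left₀ (by positivity) hcount 2).trans h2
    have h4 : (p * 2 ^ J.card) ^ 2 = p ^ 2 * 4 ^ J.card := by
      rw [mul_pow, ← pow_mul, mul_comm J.card 2, pow_mul]
      norm_num
    rw [h4] at h3
    have h5 : (0 : ℝ) < 4 ^ J.card := by positivity
    refine le_of_mul_le_mul_right ?_ h5
    calc p ^ 2 * 4 ^ S.card * 4 ^ J.card = p ^ 2 * 4 ^ J.card * 4 ^ S.card := by ring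
      _ ≤ ‖subsetSumVec v J 0‖ ^ 2 * 4 ^ S.card := by gcongr
      _ ≤ _ := h1
  have h4S : (0 : ℝ) < 4 ^ S.card := by positivity
  have hpos : 0 < ‖subsetSumVec v S 0‖ := by
    have : 0 < ‖subsetSumVec v S 0‖ ^ 2 := lt_of_lt_of_le (by positivity) hlow
    exact (sq_pos_iff.mp this).lt_of_le' (norm_nonneg _)
  refine ⟨S, hSJ, ?_, ?_⟩
  · have h1 : p ^ 2 ≤ Real.exp (-(S.card * η)) := by
      have h2 : p ^ 2 * 4 ^ S.card ≤ (1 - η) ^ S.card * 4 ^ S.card := by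
        rw [← mul_pow, mul_comm (1 - η) 4]
        exact hlow.trans hScard
      refine (le_of_mul_le_mul_right h2 h4S).trans ?_
      rw [← mul_neg, Real.exp_nat_mul]
      exact pow_le_pow_left₀ (by linarith) (Real.one_sub_le_exp_neg η) _
    have h2 := Real.log_le_log (by positivity) h1
    rw [Real.log_exp] at h2
    rw [one_div, Real.log_inv]
    have h3 : S.card * η ≤ -Real.log (p ^ 2) := by linarith
    rw [hη, mul_one_div, div_le_iff₀ (by positivity)] at h3
    linarith
  · set ρ : ℝ → ℝ := fun a => ‖subsetSumVec v S 0 - subsetSumVec v S a‖ / ‖subsetSumVec v S 0‖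
      with hρdef
    obtain ⟨r, hr, w, hw⟩ := hF ρ (by simp [hρdef]) (fun a b => by
      simp only [hρdef]
      rw [← add_div]
      gcongr
      have h1 := norm_sub_le_norm_sub_add_norm_sub (subsetSumVec v S 0) (subsetSumVec v S b)
        (subsetSumVec v S (a + b))
      have h2 := norm_subsetSumVec_sub_add v S 0 a b
      rw [zero_add] at h2
      linarith) h hh hRh (fun X hX => by
      have h1 : ∀ x ∈ X, ‖subsetSumVec v S 0‖ ^ 2 / 2 ≤
          inner ℝ (subsetSumVec v S 0) (subsetSumVec v S x) := by
        intro x hx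
        have h2 := hX x hx
        simp only [hρdef] at h2
        rw [div_le_one hpos] at h2
        have h3 := pow_le_pow_left₀ (norm_nonneg _) h2 2
        rw [norm_sub_sq_real, norm_subsetSumVec v S x] at h3
        linarith
      have h2 := (Finset.sum_le_sum h1).trans (sum_inner_subsetSumVec_le v S X)
      rw [Finset.sum_const, nsmul_eq_mul] at h2
      have h3 : (X.card : ℝ) * (p ^ 2 * 4 ^ S.card / 2) ≤ 4 ^ S.card :=
        le_trans (by gcongr) h2
      have h4 : (X.card : ℝ) ≤ 2 / p ^ 2 := by
        rw [le_div_iff₀ (by positivity)]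
        refine le_of_mul_le_mul_right ?_ h4S
        linarith
      exact_mod_cast h4.trans hpR) {x | ∃ j ∈ J, j ∉ S ∧ v j = x} (by
      rintro _ ⟨j, hj, hjS, rfl⟩
      have h1 := hS j hj hjS
      have h2 : ((h : ℝ) ^ 2 * ‖subsetSumVec v S 0 - subsetSumVec v S (v j)‖) ^ 2 ≤
          ‖subsetSumVec v S 0‖ ^ 2 := by
        rw [mul_pow]
        calc _ ≤ ((h : ℝ) ^ 2) ^ 2 * (4 * η * ‖subsetSumVec v S 0‖ ^ 2) := by gcongr
          _ = _ := by rw [hη]; field_simp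
      have h3 := (sq_le_sq₀ (by positivity) hpos.le).mp h2
      simp only [hρdef]
      rw [← mul_div_assoc, div_le_one hpos]
      exact h3)
    exact ⟨r, hr, w, fun j hj hjS => hw ⟨j, hj, hjS, rfl⟩⟩

theorem intCast_mulVec_apply {α β : Type*} [Fintype β] (N : Matrix α β ℤ) (x : β → ℤ) (i : α) :
    ((N.mulVec x i : ℤ) : ℝ) = (N.map (Int.cast : ℤ → ℝ)).mulVec (fun j => (x j : ℝ)) i := by
  simp [Matrix.mulVec, dotProduct]

theorem exists_bounded_solution_of_injective {κ ι : Type*} [Fintype κ] [Fintype ι]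
    (K : Matrix κ ι ℤ) (b : κ → ℤ) (H : ℕ) (hK : ∀ i j, |K i j| ≤ (H : ℤ))
    (hb : ∀ i, |b i| ≤ (H : ℤ))
    (hinj : ∀ v : ι → ℝ, (K.map (Int.cast : ℤ → ℝ)).mulVec v = 0 → v = 0) (t : ι → ℝ)
    (ht : (K.map (Int.cast : ℤ → ℝ)).mulVec t = fun i => (b i : ℝ)) :
    ∃ (q : ℤ) (p : ι → ℤ), q ≠ 0 ∧
      |q| ≤ (Fintype.card ι).factorial * (Fintype.card κ * H ^ 2 : ℤ) ^ Fintype.card ι ∧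
      (∀ i, |p i| ≤
        (Fintype.card ι).factorial * (Fintype.card κ * H ^ 2 : ℤ) ^ Fintype.card ι) ∧
      K.mulVec p = q • b := by
  set KR : Matrix κ ι ℝ := K.map (Int.cast : ℤ → ℝ) with hKR
  set G : Matrix ι ι ℤ := K.transpose * K with hG
  have hGR : G.map (Int.cast : ℤ → ℝ) = KR.transpose * KR := by
    have := Matrix.map_mul (L := K.transpose) (M := K) (f := Int.castRingHom ℝ)
    simpa [hG, hKR, Matrix.transpose_map] using this
  have hGinj : ∀ v : ι → ℝ, (KR.transpose * KR).mulVec v = 0 → v = 0 := by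
    intro v hv
    refine hinj v ?_
    have h1 : v ∈ LinearMap.ker (KR.transpose * KR).mulVecLin := hv
    rw [Matrix.ker_mulVecLin_transpose_mul_self] at h1
    exact h1
  have hGle : ∀ i j, |G i j| ≤ (Fintype.card κ * H ^ 2 : ℤ) := by
    intro i j
    rw [hG, Matrix.mul_apply]
    refine (Finset.abs_sum_le_sum_abs _ _).trans ?_
    refine (Finset.sum_le_card_nsmul _ _ ((H : ℤ) ^ 2) fun k _ => ?_).trans (by simp)
    rw [abs_mul, sq]
    exact mul_le_mul (hK _ _) (hK _ _) (abs_nonneg _) (by positivity)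
  have hble : ∀ i, |K.transpose.mulVec b i| ≤ (Fintype.card κ * H ^ 2 : ℤ) := by
    intro i
    rw [Matrix.mulVec, dotProduct]
    refine (Finset.abs_sum_le_sum_abs _ _).trans ?_
    refine (Finset.sum_le_card_nsmul _ _ ((H : ℤ) ^ 2) fun k _ => ?_).trans (by simp)
    rw [abs_mul, sq]
    exact mul_le_mul (hK _ _) (hb _) (abs_nonneg _) (by positivity)
  have hdetR : (G.map (Int.cast : ℤ → ℝ)).det = (G.det : ℝ) := by
    have := (Int.castRingHom ℝ).map_det G
    simpa using this.symm
  set p : ι → ℤ := G.cramer (K.transpose.mulVec b) with hp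
  have hGp : G.mulVec p = G.det • K.transpose.mulVec b := Matrix.mulVec_cramer _ _
  have hpt : (fun i => (p i : ℝ)) = (G.det : ℝ) • t := by
    rw [← sub_eq_zero]
    refine hGinj _ ?_
    rw [Matrix.mulVec_sub, Matrix.mulVec_smul, ← Matrix.mulVec_mulVec t, ht, sub_eq_zero, ← hGR]
    funext i
    rw [← intCast_mulVec_apply, hGp]
    simp only [Pi.smul_apply, smul_eq_mul, Int.cast_mul]
    rw [intCast_mulVec_apply]
    simp [hKR, Matrix.transpose_map]
  refine ⟨G.det, p, ?_, ?_, ?_, ?_⟩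
  · intro h0
    rw [h0, Int.cast_zero] at hdetR
    obtain ⟨v, hv0, hv⟩ := Matrix.exists_mulVec_eq_zero_iff.mpr hdetR
    rw [hGR] at hv
    exact hv0 (hGinj v hv)
  · have := Matrix.det_le (abv := AbsoluteValue.abs) (A := G) hGle
    simpa using this
  · intro i
    rw [hp, Matrix.cramer_apply]
    have := Matrix.det_le (abv := AbsoluteValue.abs)
      (A := G.updateCol i (K.transpose.mulVec b)) (x := (Fintype.card κ * H ^ 2 : ℤ))
      (fun a c => by
        rw [Matrix.updateCol_apply]
        split_ifs
        · exact hble a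
        · exact hGle a c)
    simpa using this
  · funext i
    have h1 : ((K.mulVec p i : ℤ) : ℝ) = ((G.det • b) i : ℤ) := by
      rw [intCast_mulVec_apply, hpt, Matrix.mulVec_smul, ← hKR, ht]
      simp
    exact_mod_cast h1

/-- A solvable linear system with bounded integer coefficients has a rational solution with
numerators and a common denominator of controlled size. -/
theorem exists_bounded_solution {κ ι : Type*} [Fintype κ] [Fintype ι]
    (K : Matrix κ ι ℤ) (b : κ → ℤ) (H : ℕ) (hK : ∀ i j, |K i j| ≤ (H : ℤ))
    (hb : ∀ i, |b i| ≤ (H : ℤ)) (hH : 1 ≤ Fintype.card κ * H ^ 2) (t : ι → ℝ)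
    (ht : (K.map (Int.cast : ℤ → ℝ)).mulVec t = fun i => (b i : ℝ)) :
    ∃ (q : ℤ) (p : ι → ℤ), q ≠ 0 ∧
      |q| ≤ (Fintype.card ι).factorial * (Fintype.card κ * H ^ 2 : ℤ) ^ Fintype.card ι ∧
      (∀ i, |p i| ≤
        (Fintype.card ι).factorial * (Fintype.card κ * H ^ 2 : ℤ) ^ Fintype.card ι) ∧
      K.mulVec p = q • b := by
  let supp : (ι → ℝ) → Finset ι := fun t => Finset.univ.filter fun i => t i ≠ 0
  let P : ℕ → Prop := fun k => ∃ t : ι → ℝ,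
    (K.map (Int.cast : ℤ → ℝ)).mulVec t = (fun i => (b i : ℝ)) ∧ (supp t).card = k
  have hP : ∃ k, P k := ⟨_, t, ht, rfl⟩
  obtain ⟨t, ht, htk⟩ := Nat.find_spec hP
  have hmin : ∀ t' : ι → ℝ, (K.map (Int.cast : ℤ → ℝ)).mulVec t' = (fun i => (b i : ℝ)) →
      ¬ (supp t').card < (supp t).card := fun t' ht' hlt =>
    Nat.find_min hP (htk ▸ hlt) ⟨t', ht', rfl⟩
  let S := supp t
  have hS : ∀ i, i ∉ S → t i = 0 := fun i hi => by simpa [S, supp] using hi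
  let K' : Matrix κ S ℤ := K.submatrix id Subtype.val
  have hrestrict : ∀ x : ι → ℝ, (∀ i, i ∉ S → x i = 0) →
      (K'.map (Int.cast : ℤ → ℝ)).mulVec (fun i : S => x i) =
        (K.map (Int.cast : ℤ → ℝ)).mulVec x := by
    intro x hx
    funext k
    simp only [Matrix.mulVec, dotProduct, Matrix.map_apply, K', Matrix.submatrix_apply, id]
    rw [Finset.sum_coe_sort S (fun i => (K k i : ℝ) * x i)]
    exact Finset.sum_subset (Finset.subset_univ _) fun i _ hi => by rw [hx i hi, mul_zero]
  have hinj : ∀ v : S → ℝ, (K'.map (Int.cast : ℤ → ℝ)).mulVec v = 0 → v = 0 := by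
    intro v hv
    by_contra hne
    obtain ⟨i, hi⟩ := Function.ne_iff.mp hne
    let x : ι → ℝ := fun j => if hj : j ∈ S then v ⟨j, hj⟩ else 0
    have hx0 : ∀ j, j ∉ S → x j = 0 := fun j hj => by simp [x, hj]
    have hxv : (fun j : S => x j) = v := by
      funext j
      simp [x]
    have hKx := hrestrict x hx0
    rw [hxv, hv] at hKx
    have hxi : x i ≠ 0 := by simpa [x] using hi
    refine hmin (t - (t i / x i) • x) ?_ (Finset.card_lt_card ⟨fun j hj => ?_, fun hsub => ?_⟩)
    · rw [Matrix.mulVec_sub, Matrix.mulVec_smul, ← hKx, smul_zero, sub_zero, ht]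
    · by_contra hjS
      simp [supp, hS j hjS, hx0 j hjS] at hj
    · have := hsub i.2
      simp [supp, hxi] at this
  obtain ⟨q, p, hq0, hq, hp, hKp⟩ := exists_bounded_solution_of_injective K' b H
    (fun i j => hK _ _) hb hinj (fun i => t i) (by rw [hrestrict t hS, ht])
  have hle : ((Fintype.card S).factorial * (Fintype.card κ * H ^ 2 : ℤ) ^ Fintype.card S) ≤
      (Fintype.card ι).factorial * (Fintype.card κ * H ^ 2 : ℤ) ^ Fintype.card ι := by
    have h1 : Fintype.card S ≤ Fintype.card ι := by
      rw [Fintype.card_coe]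
      exact Finset.card_le_univ S
    have h2 := Nat.mul_le_mul (Nat.factorial_le h1) (Nat.pow_le_pow_right hH h1)
    exact_mod_cast h2
  refine ⟨q, fun j => if hj : j ∈ S then p ⟨j, hj⟩ else 0, hq0, hq.trans hle, fun i => ?_, ?_⟩
  · dsimp only
    split_ifs
    · exact (hp _).trans hle
    · rw [abs_zero]
      positivity
  · rw [← hKp]
    funext k
    simp only [Matrix.mulVec, dotProduct, K', Matrix.submatrix_apply, id]
    rw [← Finset.sum_subset (Finset.subset_univ S) (fun i _ hi => by simp [hi]),
      ← Finset.sum_coe_sort]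
    exact Finset.sum_congr rfl fun i _ => by simp

theorem exists_ne_pair_of_card_le {α β : Type*} (P : Finset α) (T : Finset β) (E : α → β → Prop)
    {p : ℝ} (hp : 0 < p) (hP : 0 < P.card) (hT : 0 < T.card) (hPp : 1 / (P.card : ℝ) < p ^ 2 / 2)
    (hE : p * (P.card * T.card) ≤ (((P ×ˢ T).filter fun z => E z.1 z.2).card : ℝ)) :
    ∃ y ∈ P, ∃ y' ∈ P, y ≠ y' ∧
      p ^ 2 / 2 * T.card ≤ ((T.filter fun t => E y t ∧ E y' t).card : ℝ) := by
  by_contra hcon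
  push Not at hcon
  have hP' : (0 : ℝ) < P.card := by exact_mod_cast hP
  have hT' : (0 : ℝ) < T.card := by exact_mod_cast hT
  let e : α → β → ℝ := fun y t => if E y t then 1 else 0
  have hsum : p * (P.card * T.card) ≤ ∑ t ∈ T, ∑ y ∈ P, e y t := by
    refine hE.trans (le_of_eq ?_)
    rw [Finset.sum_comm, ← Finset.sum_product' P T e, Finset.card_filter]
    push_cast
    rfl
  have hcs : (∑ t ∈ T, ∑ y ∈ P, e y t) ^ 2 ≤ T.card * ∑ t ∈ T, (∑ y ∈ P, e y t) ^ 2 :=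
    sq_sum_le_card_mul_sum_sq
  have hsq : ∑ t ∈ T, (∑ y ∈ P, e y t) ^ 2 =
      ∑ y ∈ P, ∑ y' ∈ P, ((T.filter fun t => E y t ∧ E y' t).card : ℝ) := by
    simp only [sq, Finset.sum_mul_sum]
    rw [Finset.sum_comm]
    refine Finset.sum_congr rfl fun y _ => ?_
    rw [Finset.sum_comm]
    refine Finset.sum_congr rfl fun y' _ => ?_
    rw [Finset.card_filter]
    push_cast
    refine Finset.sum_congr rfl fun t _ => ?_
    by_cases h1 : E y t <;> by_cases h2 : E y' t <;> simp [e, h1, h2]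
  have hle : ∑ y ∈ P, ∑ y' ∈ P, ((T.filter fun t => E y t ∧ E y' t).card : ℝ) ≤
      ∑ y ∈ P, ∑ y' ∈ P, ((if y = y' then (T.card : ℝ) else 0) + p ^ 2 / 2 * T.card) := by
    refine Finset.sum_le_sum fun y hy => Finset.sum_le_sum fun y' hy' => ?_
    split_ifs with hyy
    · have : ((T.filter fun t => E y t ∧ E y' t).card : ℝ) ≤ T.card := by
        exact_mod_cast Finset.card_filter_le _ _
      have : 0 ≤ p ^ 2 / 2 * T.card := by positivity
      linarith
    · linarith [hcon y hy y' hy' hyy]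
  have hval : ∑ y ∈ P, ∑ y' ∈ P, ((if y = y' then (T.card : ℝ) else 0) + p ^ 2 / 2 * T.card) =
      P.card * T.card + P.card * (P.card * (p ^ 2 / 2 * T.card)) := by
    simp only [Finset.sum_add_distrib, Finset.sum_const, nsmul_eq_mul]
    congr 1
    rw [Finset.sum_congr rfl fun y hy => by rw [Finset.sum_ite_eq, if_pos hy]]
    simp
  have h1 : (p * (P.card * T.card)) ^ 2 ≤
      T.card * (P.card * T.card + P.card * (P.card * (p ^ 2 / 2 * T.card))) := by
    refine (pow_le_pow_left₀ (by positivity) hsum 2).trans (hcs.trans ?_)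
    rw [hsq, ← hval]
    gcongr
  rw [div_lt_iff₀ hP'] at hPp
  have h2 : (0 : ℝ) < P.card * T.card ^ 2 := by positivity
  nlinarith

/-- Decoupling: if a quadratic form with symmetric matrix `A` vanishes with probability at
least `p` at a random sign vector, then some nonzero combination of few rows of `A`
has a popular subset sum. -/
theorem exists_row_combination_of_quadratic {ι : Type*} [Fintype ι] [DecidableEq ι]
    (A : Matrix ι ι ℝ) (hA : A.IsSymm) (I : Finset ι) {p : ℝ} (hp : 0 < p)
    (hI : 1 / (2 : ℝ) ^ I.card < p ^ 2 / 2)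
    (hcount : p * 2 ^ Fintype.card ι ≤ ((Finset.univ.filter fun x : ι → Bool =>
      ∑ i, ∑ j, A i j * signv (x i) * signv (x j) = 0).card : ℝ)) :
    ∃ d : ι → ℝ, d ≠ 0 ∧ (∀ i, i ∉ I → d i = 0) ∧ ∃ b : ℝ, p ^ 2 / 2 * 2 ^ Iᶜ.card ≤
      ((Iᶜ.powerset.filter fun T => ∑ j ∈ T, A.mulVec d j = b).card : ℝ) := by
  let χ : Finset ι → ι → ℝ := fun U i => if i ∈ U then 1 else -1
  let Q : (ι → ℝ) → ℝ := fun x => ∑ i, ∑ j, A i j * x i * x j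
  have hcard : I.powerset.card * Iᶜ.powerset.card = 2 ^ Fintype.card ι := by
    rw [Finset.card_powerset, Finset.card_powerset, ← pow_add, Finset.card_add_card_compl]
  have hW : (Finset.univ.filter fun x : ι → Bool =>
      ∑ i, ∑ j, A i j * signv (x i) * signv (x j) = 0).card ≤
      ((I.powerset ×ˢ Iᶜ.powerset).filter fun z => Q (χ (z.1 ∪ z.2)) = 0).card := by
    refine Finset.card_le_card_of_injOn
      (fun x => (I.filter fun i => x i = true, Iᶜ.filter fun i => x i = true)) ?_ ?_
    · intro x hx
      simp only [Finset.coe_filter, Finset.mem_univ, true_and, Set.mem_ofPred_eq] at hx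
      simp only [Finset.coe_filter, Finset.mem_product, Finset.mem_powerset, Set.mem_ofPred_eq,
        Finset.filter_subset, true_and]
      have hχ : χ (I.filter (fun i => x i = true) ∪ Iᶜ.filter fun i => x i = true) =
          fun i => signv (x i) := by
        funext i
        by_cases hi : i ∈ I <;> by_cases hxi : x i = true <;> simp [χ, signv, hi, hxi]
      rw [hχ]
      exact hx
    · intro x _ x' _ hxx
      simp only [Prod.mk.injEq] at hxx
      funext i
      have h1 := Finset.ext_iff.mp hxx.1 i
      have h2 := Finset.ext_iff.mp hxx.2 i
      simp only [Finset.mem_filter, Finset.mem_compl] at h1 h2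
      rw [Bool.eq_iff_iff]
      by_cases hi : i ∈ I <;> tauto
  obtain ⟨Y, hY, Y', hY', hne, hYY⟩ := exists_ne_pair_of_card_le I.powerset Iᶜ.powerset
    (fun Y T => Q (χ (Y ∪ T)) = 0) hp (by simp) (by simp)
    (by rw [Finset.card_powerset]; push_cast; exact hI) (by
      rw [← Nat.cast_mul, hcard]
      push_cast
      exact hcount.trans (by exact_mod_cast hW))
  rw [Finset.mem_powerset] at hY hY'
  refine ⟨fun i => χ Y i - χ Y' i, ?_, fun i hi => ?_, ?_⟩
  · intro h0
    apply hne
    ext i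
    have h1 : χ Y i - χ Y' i = 0 := congrFun h0 i
    simp only [χ] at h1
    split_ifs at h1 <;> first | tauto | norm_num at h1
  · have h1 : i ∉ Y := fun h => hi (hY h)
    have h2 : i ∉ Y' := fun h => hi (hY' h)
    simp [χ, h1, h2]
  · set d : ι → ℝ := fun i => χ Y i - χ Y' i with hd
    refine ⟨(2 * ∑ j ∈ Iᶜ, A.mulVec d j - ∑ j ∈ I, A.mulVec d j * (χ Y j + χ Y' j)) / 4, ?_⟩
    rw [Finset.card_powerset] at hYY
    push_cast at hYY
    refine hYY.trans (Nat.cast_le.mpr (Finset.card_le_card fun T hT => ?_))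
    simp only [Finset.mem_filter, Finset.mem_powerset] at hT ⊢
    obtain ⟨hTI, h1, h2⟩ := hT
    refine ⟨hTI, ?_⟩
    have hTI' : ∀ i ∈ T, i ∉ I := fun i hi => Finset.mem_compl.mp (hTI hi)
    have hdiff : ∀ i, χ (Y ∪ T) i - χ (Y' ∪ T) i = d i := by
      intro i
      by_cases hi : i ∈ T
      · have h3 : i ∉ Y := fun h => hTI' i hi (hY h)
        have h4 : i ∉ Y' := fun h => hTI' i hi (hY' h)
        simp [hd, χ, hi, h3, h4]
      · simp [hd, χ, hi]
    have hQ : Q (χ (Y ∪ T)) - Q (χ (Y' ∪ T)) =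
        ∑ j, A.mulVec d j * (χ (Y ∪ T) j + χ (Y' ∪ T) j) := by
      simp only [Q, Matrix.mulVec, dotProduct, ← hdiff]
      generalize χ (Y ∪ T) = x
      generalize χ (Y' ∪ T) = y
      have hsymm : ∑ i, ∑ j, A i j * (x j * y i) = ∑ i, ∑ j, A i j * (x i * y j) := by
        rw [Finset.sum_comm]
        refine Finset.sum_congr rfl fun i _ => Finset.sum_congr rfl fun j _ => ?_
        rw [hA.apply]
      have hexp : ∑ j, (∑ i, A j i * (x i - y i)) * (x j + y j) =
          (∑ i, ∑ j, A i j * x i * x j) - (∑ i, ∑ j, A i j * y i * y j) +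
          (∑ i, ∑ j, A i j * (x j * y i) - ∑ i, ∑ j, A i j * (x i * y j)) := by
        simp only [← Finset.sum_sub_distrib, ← Finset.sum_add_distrib, Finset.sum_mul]
        refine Finset.sum_congr rfl fun i _ => Finset.sum_congr rfl fun j _ => ?_
        ring
      rw [hexp, hsymm, sub_self, add_zero]
    rw [h1, h2, sub_self, ← Finset.sum_add_sum_compl I] at hQ
    have hI1 : ∑ j ∈ I, A.mulVec d j * (χ (Y ∪ T) j + χ (Y' ∪ T) j) =
        ∑ j ∈ I, A.mulVec d j * (χ Y j + χ Y' j) := by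
      refine Finset.sum_congr rfl fun j hj => ?_
      have h3 : j ∉ T := fun h => hTI' j h hj
      simp [χ, h3]
    have hI2 : ∑ j ∈ Iᶜ, A.mulVec d j * (χ (Y ∪ T) j + χ (Y' ∪ T) j) =
        4 * ∑ j ∈ T, A.mulVec d j - 2 * ∑ j ∈ Iᶜ, A.mulVec d j := by
      have h5 : ∑ j ∈ T, A.mulVec d j = ∑ j ∈ Iᶜ, if j ∈ T then A.mulVec d j else 0 := by
        rw [← Finset.sum_filter, Finset.filter_mem_eq_inter, Finset.inter_eq_right.mpr hTI]
      rw [h5, Finset.mul_sum, Finset.mul_sum, ← Finset.sum_sub_distrib]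
      refine Finset.sum_congr rfl fun j hj => ?_
      rw [Finset.mem_compl] at hj
      have h3 : j ∉ Y := fun h => hj (hY h)
      have h4 : j ∉ Y' := fun h => hj (hY' h)
      by_cases hjT : j ∈ T <;> simp [χ, hjT, h3, h4] <;> ring
    rw [hI1, hI2] at hQ
    linarith

/-- A vector with structured coordinates that is orthogonal to many rows of a sign matrix can be
replaced by a rational one of controlled height. -/
theorem exists_rational_of_boxGAP {ι : Type*} [Fintype ι] (M : Matrix ι ι ℝ)
    (hM : ∀ i j, M i j = 1 ∨ M i j = -1) (I X : Finset ι) {u : ι → ℝ} (hu : u ≠ 0)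
    (hMu : ∀ i, i ∉ I → ∑ j, M i j * u j = 0) {r : ℕ} (w : Fin r → ℝ) {L : ℕ} (hL : 1 ≤ L)
    (huw : ∀ j, j ∉ X → u j ∈ boxGAP w L) :
    ∃ u' : ι → ℝ, u' ≠ 0 ∧ (∀ i, i ∉ I → ∑ j, M i j * u' j = 0) ∧
      (∃ w' : Fin r → ℝ, ∀ j, j ∉ X → u' j ∈ boxGAP w' L) ∧
      ∀ j, ∃ p q : ℤ, q ≠ 0 ∧
        |p| ≤ ((r + X.card + 1) * L * ((r + X.card).factorial *
          ((Fintype.card ι + 1) * (Fintype.card ι * L) ^ 2) ^ (r + X.card)) : ℕ) ∧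
        |q| ≤ ((r + X.card + 1) * L * ((r + X.card).factorial *
          ((Fintype.card ι + 1) * (Fintype.card ι * L) ^ 2) ^ (r + X.card)) : ℕ) ∧
        u' j = p / q := by
  obtain ⟨j₀, hj₀⟩ := Function.ne_iff.mp hu
  rw [Pi.zero_apply] at hj₀
  have hN : 1 ≤ Fintype.card ι := Fintype.card_pos_iff.mpr ⟨j₀⟩
  have hMz : ∀ i j, ∃ z : ℤ, (z : ℝ) = M i j ∧ |z| = 1 := fun i j => by
    rcases hM i j with h | h
    · exact ⟨1, by simp [h]⟩
    · exact ⟨-1, by simp [h]⟩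
  choose Mz hMzM hMz1 using hMz
  choose! c hc hcu using huw
  let P : Matrix ι (Fin r ⊕ X) ℤ := fun j => Sum.elim (fun k => if j ∈ X then 0 else c j k)
    (fun e => if j = e then 1 else 0)
  have hPle : ∀ j k, |P j k| ≤ (L : ℤ) := by
    intro j k
    have hL' : (1 : ℤ) ≤ L := by exact_mod_cast hL
    rcases k with k | e
    · by_cases hj : j ∈ X
      · simp [P, hj]
      · simpa [P, hj] using hc j hj k
    · by_cases hj : j = e
      · simpa [P, hj] using hL'
      · simp [P, hj]
  have hPX : ∀ (y : Fin r ⊕ X → ℝ) j, j ∉ X →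
      ∑ k, (P j k : ℝ) * y k = ∑ k, (c j k : ℝ) * y (Sum.inl k) := by
    intro y j hj
    rw [Fintype.sum_sum_type]
    have h1 : ∑ e : X, (P j (Sum.inr e) : ℝ) * y (Sum.inr e) = 0 := by
      refine Finset.sum_eq_zero fun e _ => ?_
      have : j ≠ e := fun h => hj (h ▸ e.2)
      simp [P, this]
    rw [h1, add_zero]
    refine Finset.sum_congr rfl fun k _ => ?_
    simp [P, hj]
  let t : Fin r ⊕ X → ℝ := Sum.elim w (fun e => u e)
  have hPt : ∀ j, ∑ k, (P j k : ℝ) * t k = u j := by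
    intro j
    by_cases hj : j ∈ X
    · rw [Fintype.sum_sum_type, Finset.sum_eq_zero (fun k _ => by simp [P, hj]), zero_add,
        Finset.sum_eq_single ⟨j, hj⟩ (fun e _ he => ?_) (by simp)]
      · simp [P, t]
      · have : j ≠ e := fun h => he (Subtype.ext h.symm)
        simp [P, this]
    · rw [hPX t j hj, hcu j hj]
      simp [t]
  let K : Matrix (Option {i // i ∉ I}) (Fin r ⊕ X) ℤ := fun o k =>
    o.elim (P j₀ k) (fun i => ∑ j, Mz i j * P j k)
  let b : Option {i // i ∉ I} → ℤ := fun o => o.elim 1 (fun _ => 0)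
  have hKnone : ∀ k, K none k = P j₀ k := fun _ => rfl
  have hKsome : ∀ (y : Fin r ⊕ X → ℝ) (i : {i // i ∉ I}),
      ∑ k, (K (some i) k : ℝ) * y k = ∑ j, M i j * ∑ k, (P j k : ℝ) * y k := by
    intro y i
    simp only [K, Option.elim, Finset.mul_sum]
    rw [Finset.sum_comm]
    refine Finset.sum_congr rfl fun k _ => ?_
    push_cast
    rw [Finset.sum_mul]
    refine Finset.sum_congr rfl fun j _ => ?_
    rw [hMzM, mul_assoc]
  obtain ⟨q, p, hq0, hq, hp, hKp⟩ := exists_bounded_solution K b (Fintype.card ι * L) (by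
      rintro (_ | i) k
      · simp only [K, Option.elim]
        refine (hPle _ _).trans ?_
        exact_mod_cast Nat.le_mul_of_pos_left L hN
      · simp only [K, Option.elim]
        refine (Finset.abs_sum_le_sum_abs _ _).trans ?_
        refine (Finset.sum_le_card_nsmul _ _ (L : ℤ) fun j _ => ?_).trans (by simp)
        rw [abs_mul, hMz1, one_mul]
        exact hPle _ _) (by
      have : (1 : ℤ) ≤ ((Fintype.card ι * L : ℕ) : ℤ) := by
        exact_mod_cast Nat.mul_pos hN hL
      rintro (_ | i)
      · simpa [b] using this
      · simp only [b, Option.elim, abs_zero]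
        positivity) (by
      have : 0 < Fintype.card (Option {i // i ∉ I}) := Fintype.card_pos
      exact Nat.mul_pos this (Nat.pow_pos (Nat.mul_pos hN hL)))
    (fun k => t k / u j₀) (by
      funext o
      rcases o with _ | i
      · simp only [Matrix.mulVec, dotProduct, Matrix.map_apply, hKnone,
          ← mul_div_assoc, ← Finset.sum_div, hPt]
        simp [b, hj₀]
      · simp only [Matrix.mulVec, dotProduct, Matrix.map_apply, hKsome]
        simp only [← mul_div_assoc, ← Finset.sum_div, hPt]
        simp [b, hMu i i.2])
  have hm : Fintype.card (Fin r ⊕ X) = r + X.card := by simp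
  have hκ : Fintype.card (Option {i // i ∉ I}) ≤ Fintype.card ι + 1 := by
    rw [Fintype.card_option]
    exact Nat.succ_le_succ (Fintype.card_subtype_le _)
  rw [hm] at hq hp
  set B : ℕ := (r + X.card).factorial *
    ((Fintype.card ι + 1) * (Fintype.card ι * L) ^ 2) ^ (r + X.card) with hB
  have hXB : ((r + X.card).factorial * (Fintype.card (Option {i // i ∉ I}) *
      ((Fintype.card ι * L : ℕ) : ℤ) ^ 2) ^ (r + X.card) : ℤ) ≤ (B : ℤ) := by
    rw [hB]
    push_cast
    have : ((Fintype.card (Option {i // i ∉ I}) : ℕ) : ℤ) ≤ (Fintype.card ι : ℤ) + 1 := by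
      exact_mod_cast hκ
    gcongr
  replace hq := hq.trans hXB
  replace hp := fun i => (hp i).trans hXB
  have hqR : (q : ℝ) ≠ 0 := by exact_mod_cast hq0
  have hKp' : ∀ o, ∑ k, (K o k : ℝ) * (p k : ℝ) = q * b o := by
    intro o
    have := congrFun hKp o
    simp only [Matrix.mulVec, dotProduct, Pi.smul_apply, smul_eq_mul] at this
    exact_mod_cast this
  refine ⟨fun j => (∑ k, (P j k : ℝ) * p k) / q, ?_, ?_, ?_, ?_⟩
  · intro h0
    have h1 := congrFun h0 j₀
    have h2 := hKp' none
    simp only [K, b, Option.elim, Int.cast_one, mul_one] at h2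
    simp only [h2, Pi.zero_apply] at h1
    exact absurd h1 (by simp [hqR])
  · intro i hi
    have h1 := hKp' (some ⟨i, hi⟩)
    rw [hKsome] at h1
    simp only [b, Option.elim, Int.cast_zero, mul_zero] at h1
    simp only [← mul_div_assoc, ← Finset.sum_div, h1, zero_div]
  · refine ⟨fun k => p (Sum.inl k) / q, fun j hj => ⟨c j, hc j hj, ?_⟩⟩
    change (∑ k, (P j k : ℝ) * (p k : ℝ)) / q = ∑ k, (c j k : ℝ) * ((p (Sum.inl k) : ℝ) / q)
    rw [hPX (fun k => (p k : ℝ)) j hj, Finset.sum_div]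
    simp only [mul_div_assoc]
  · intro j
    refine ⟨∑ k, P j k * p k, q, hq0, ?_, hq.trans ?_, by push_cast; rfl⟩
    · refine (Finset.abs_sum_le_sum_abs _ _).trans ?_
      refine (Finset.sum_le_card_nsmul _ _ ((L : ℤ) * B) fun k _ => ?_).trans ?_
      · rw [abs_mul]
        exact mul_le_mul (hPle _ _) (hp _) (abs_nonneg _) (by positivity)
      · rw [Finset.card_univ, hm, nsmul_eq_mul, ← mul_assoc]
        have : (r + X.card) * L * B ≤ (r + X.card + 1) * L * B :=
          Nat.mul_le_mul_right _ (Nat.mul_le_mul_right _ (Nat.le_succ _))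
        exact_mod_cast this
    · exact_mod_cast Nat.le_mul_of_pos_left B (Nat.mul_pos (by omega) hL)

theorem IsProperSymGAPSet.mono {Q : Set ℝ} {r r' : ℕ} {s s' : ℝ} (hQ : IsProperSymGAPSet Q r s)
    (hr : r ≤ r') (hs : s ≤ s') : IsProperSymGAPSet Q r' s' := by
  obtain ⟨t, g, N, ht, hQ, hinj, hsize⟩ := hQ
  exact ⟨t, g, N, ht.trans hr, hQ, hinj, hsize.trans hs⟩

/-- A box GAP is contained in a proper symmetric GAP of at most the same rank and
polynomially larger size. -/
theorem exists_isProperSymGAPSet_superset {r R : ℕ} (hr : r ≤ R) (w : Fin r → ℝ) {L : ℕ}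
    (hL : 1 ≤ L) :
    ∃ Q, boxGAP w L ⊆ Q ∧ IsProperSymGAPSet Q R (((4 * L) ^ (2 ^ R * R) : ℕ) : ℝ) := by
  obtain ⟨r', hr', w', L', hL', hw', hsub⟩ := exists_isDissociated_boxGAP_superset r w L
  refine ⟨_, hsub, hw'.isProperSymGAPSet.mono (hr'.trans hr) ?_⟩
  have h1 : 1 ≤ (4 * L) ^ 2 ^ r := Nat.one_le_pow _ _ (by omega)
  have h2 : (2 * L' + 1) ^ r' ≤ (4 * L) ^ (2 ^ R * R) := by
    calc (2 * L' + 1) ^ r' ≤ ((4 * L) ^ 2 ^ r) ^ r' := Nat.pow_le_pow_left (by omega) _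
      _ ≤ ((4 * L) ^ 2 ^ R) ^ R := by
        refine (Nat.pow_le_pow_right (by omega) (hr'.trans hr)).trans
          (Nat.pow_le_pow_left (Nat.pow_le_pow_right (by omega)
            (Nat.pow_le_pow_right (by omega) hr)) _)
      _ = (4 * L) ^ (2 ^ R * R) := (pow_mul _ _ _).symm
  exact_mod_cast h2

theorem Matrix.det_ne_zero_of_rank_eq_card {ι K : Type*} [Fintype ι] [DecidableEq ι] [Field K]
    {M : Matrix ι ι K} (hM : M.rank = Fintype.card ι) : M.det ≠ 0 := by
  intro h0
  obtain ⟨v, hv, hMv⟩ := Matrix.exists_mulVec_eq_zero_iff.mpr h0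
  have hsurj : Function.Surjective M.mulVecLin := by
    rw [← LinearMap.range_eq_top]
    apply Submodule.eq_top_of_finrank_eq
    rw [Module.finrank_fintype_fun_eq_card]
    exact hM
  have hinj := LinearMap.injective_iff_surjective.mpr hsurj
  exact hv (hinj (by simpa using hMv))

/-- Quantitative form of the structural theorem, with all parameters explicit. -/
theorem exists_structured_vector (R : ℕ) : ∃ F : ℕ, ∀ (N k h : ℕ) (p : ℝ)
    (M : Matrix (Fin N) (Fin N) ℝ), M.IsSymm → (∀ i j, M i j = 1 ∨ M i j = -1) → M.det ≠ 0 →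
    0 < p → p ≤ probRad N (fun x => ∑ i, ∑ j, M.adjugate i j * x i * x j = 0) →
    k ≤ N → 1 / (2 : ℝ) ^ k < p ^ 2 / 2 → 2 ≤ h → h ^ R < 2 ^ h →
    2 / (p ^ 2 / 2) ^ 2 ≤ (h : ℝ) ^ R →
    ∃ u : Fin N → ℝ, u ≠ 0 ∧ ∃ X : Finset (Fin N),
      (X.card : ℝ) ≤ k + 4 * (h : ℝ) ^ 4 * Real.log (1 / (p ^ 2 / 2) ^ 2) ∧
      (∃ Q, IsProperSymGAPSet Q R (((4 * h ^ F) ^ (2 ^ R * R) : ℕ) : ℝ) ∧ ∀ j, j ∉ X → u j ∈ Q) ∧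
      (∀ j, ∃ a b : ℤ, b ≠ 0 ∧
        |a| ≤ ((R + X.card + 1) * h ^ F * ((R + X.card).factorial *
          ((N + 1) * (N * h ^ F) ^ 2) ^ (R + X.card)) : ℕ) ∧
        |b| ≤ ((R + X.card + 1) * h ^ F * ((R + X.card).factorial *
          ((N + 1) * (N * h ^ F) ^ 2) ^ (R + X.card)) : ℕ) ∧
        u j = a / b) ∧
      N ≤ (Finset.univ.filter fun i => ∑ j, M i j * u j = 0).card + k := by
  obtain ⟨F, hF⟩ := inverse_littlewood_offord R
  refine ⟨F, fun N k h p M hsymm hM hdet hp hprob hkN hk h2 hR2 hRp => ?_⟩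
  obtain ⟨I, -, hI⟩ := Finset.exists_subset_card_eq (s := (Finset.univ : Finset (Fin N)))
    (by simpa using hkN)
  rw [probRad, le_div_iff₀ (by positivity)] at hprob
  obtain ⟨d, hd, hdI, b, hb⟩ := exists_row_combination_of_quadratic M.adjugate hsymm.adjugate I hp
    (by rwa [hI]) (by rw [Fintype.card_fin]; exact hprob)
  obtain ⟨S, -, hS, r, hr, w, hw⟩ := hF (M.adjugate.mulVec d) Iᶜ b (p ^ 2 / 2) h (by positivity)
    h2 hR2 hRp hb
  have hL : 1 ≤ h ^ F := Nat.one_le_pow _ _ (by omega)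
  have hMd : M.mulVec (M.adjugate.mulVec d) = M.det • d := by
    rw [Matrix.mulVec_mulVec, Matrix.mul_adjugate, Matrix.smul_mulVec, Matrix.one_mulVec]
  obtain ⟨u, hu, hMu, ⟨w', hw'⟩, hrat⟩ := exists_rational_of_boxGAP M hM I (I ∪ S)
    (u := M.adjugate.mulVec d)
    (fun h0 => by
      rw [h0, Matrix.mulVec_zero, eq_comm, smul_eq_zero] at hMd
      exact hMd.elim hdet hd)
    (fun i hi => by
      have := congrFun hMd i
      rw [Pi.smul_apply, hdI i hi, smul_zero] at this
      exact this) w hL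
    (fun j hj => by
      rw [Finset.mem_union, not_or] at hj
      exact hw j (Finset.mem_compl.mpr hj.1) hj.2)
  obtain ⟨Q, hsub, hQ⟩ := exists_isProperSymGAPSet_superset hr w' hL
  refine ⟨u, hu, I ∪ S, ?_, ⟨Q, hQ, fun j hj => hsub (hw' j hj)⟩, fun j => ?_, ?_⟩
  · have : ((I ∪ S).card : ℝ) ≤ I.card + S.card := by exact_mod_cast Finset.card_union_le I S
    rw [hI] at this
    linarith
  · obtain ⟨a, b, hb0, ha, hb, hu⟩ := hrat j
    have hmono : (r + (I ∪ S).card + 1) * h ^ F * ((r + (I ∪ S).card).factorial *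
          ((Fintype.card (Fin N) + 1) * (Fintype.card (Fin N) * h ^ F) ^ 2) ^ (r + (I ∪ S).card))
        ≤ (R + (I ∪ S).card + 1) * h ^ F * ((R + (I ∪ S).card).factorial *
          ((N + 1) * (N * h ^ F) ^ 2) ^ (R + (I ∪ S).card)) := by
      rw [Fintype.card_fin]
      have hN : 1 ≤ (N + 1) * (N * h ^ F) ^ 2 :=
        Nat.mul_pos (by omega) (Nat.pow_pos (Nat.mul_pos (Fin.pos j) hL))
      have hm : r + (I ∪ S).card ≤ R + (I ∪ S).card := by omega
      have := Nat.factorial_le hm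
      gcongr
    have hmono' := Int.ofNat_le.mpr hmono
    exact ⟨a, b, hb0, ha.trans hmono', hb.trans hmono', hu⟩
  · have h1 : Iᶜ.card ≤ (Finset.univ.filter fun i => ∑ j, M i j * u j = 0).card :=
      Finset.card_le_card fun i hi => by simpa using hMu i (Finset.mem_compl.mp hi)
    have h3 := Finset.card_add_card_compl I
    rw [Fintype.card_fin] at h3
    omega

theorem height_bound_le_pow {n N h F R s : ℕ} (hn : N + 1 = n) (hh : h ≤ n) (hR : R + 2 ≤ n)
    (hs : s ≤ N) :
    (R + s + 1) * h ^ F * ((R + s).factorial * ((N + 1) * (N * h ^ F) ^ 2) ^ (R + s)) ≤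
      n ^ (F + 2 + (2 * F + 5) * (R + s)) := by
  have hm : R + s + 1 ≤ n ^ 2 := by nlinarith
  have hhF : h ^ F ≤ n ^ F := Nat.pow_le_pow_left hh F
  have hfac : (R + s).factorial ≤ (n ^ 2) ^ (R + s) :=
    (Nat.factorial_le_pow _).trans (Nat.pow_le_pow_left (by omega) _)
  have hNn : N ≤ n := by omega
  calc _ ≤ n ^ 2 * n ^ F * ((n ^ 2) ^ (R + s) * (n * (n * n ^ F) ^ 2) ^ (R + s)) := by
        rw [hn]
        gcongr
    _ = n ^ (F + 2 + (2 * F + 5) * (R + s)) := by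
        rw [← mul_pow]
        have : n ^ 2 * (n * (n * n ^ F) ^ 2) = n ^ (2 * F + 5) := by ring
        rw [this]
        ring

theorem eventually_parameters {ε C : ℝ} (hε0 : 0 < ε) (hε1 : ε < 1) (hC : 0 < C) {R : ℕ}
    (hR : 4 * C + 1 ≤ ε / 16 * R) : ∀ᶠ n : ℕ in Filter.atTop, ∃ k h : ℕ,
      0 < ((n : ℝ) ^ (-C)) ∧ R + 2 ≤ n ∧ k + 1 ≤ n ∧ (k : ℝ) + 1 ≤ (n : ℝ) ^ ε ∧
      1 / (2 : ℝ) ^ k < ((n : ℝ) ^ (-C)) ^ 2 / 2 ∧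
      2 ≤ h ∧ h ≤ n ∧ h ^ R < 2 ^ h ∧ 2 / (((n : ℝ) ^ (-C)) ^ 2 / 2) ^ 2 ≤ (h : ℝ) ^ R ∧
      k + 4 * (h : ℝ) ^ 4 * Real.log (1 / (((n : ℝ) ^ (-C)) ^ 2 / 2) ^ 2) ≤ (n : ℝ) ^ ε := by
  have hcast : Filter.Tendsto (fun n : ℕ => (n : ℝ)) Filter.atTop Filter.atTop :=
    tendsto_natCast_atTop_atTop
  have hy : ∀ᶠ n : ℕ in Filter.atTop, 2 * (2 + 4 * Real.log 4) ≤ (n : ℝ) ^ (ε / 2) :=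
    ((tendsto_rpow_atTop (by positivity)).comp hcast).eventually_ge_atTop _
  have hz : ∀ᶠ n : ℕ in Filter.atTop, 2 ≤ (n : ℝ) ^ (ε / 16) :=
    ((tendsto_rpow_atTop (by positivity)).comp hcast).eventually_ge_atTop _
  have hlog : ∀ᶠ n : ℕ in Filter.atTop,
      ‖Real.log (n : ℝ)‖ ≤ 1 / (32 * C) * ‖(n : ℝ) ^ (ε / 2)‖ :=
    hcast.eventually ((isLittleO_log_rpow_atTop (show 0 < ε / 2 by positivity)).bound
      (by positivity))
  have hpow : ∀ᶠ m : ℕ in Filter.atTop, m ^ R < 2 ^ m := by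
    have h1 := (tendsto_pow_const_div_const_pow_of_one_lt R
      (one_lt_two (α := ℝ))).eventually_lt_const zero_lt_one
    filter_upwards [h1] with m hm
    rw [div_lt_one (by positivity)] at hm
    exact_mod_cast hm
  have hh : Filter.Tendsto (fun n : ℕ => ⌊(n : ℝ) ^ (ε / 8)⌋₊) Filter.atTop Filter.atTop :=
    tendsto_nat_floor_atTop.comp ((tendsto_rpow_atTop (by positivity)).comp hcast)
  filter_upwards [hy, hz, hlog, hh.eventually hpow, hh.eventually_ge_atTop 2,
    Filter.eventually_ge_atTop (R + 2), Filter.eventually_ge_atTop 8]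
    with n hy hz hlog hpow hh2 hnR hn8
  have hx8 : (8 : ℝ) ≤ n := by exact_mod_cast hn8
  have hx0 : (0 : ℝ) < n := by linarith
  have hx1 : (1 : ℝ) ≤ n := by linarith
  set x : ℝ := (n : ℝ) with hx
  set y : ℝ := x ^ (ε / 2) with hydef
  set h : ℕ := ⌊x ^ (ε / 8)⌋₊ with hhdef
  have hy0 : 0 < y := by positivity
  have hyy : y * y = x ^ ε := by rw [hydef, ← Real.rpow_add hx0]; congr 1; ring
  have hl2 := Real.log_two_gt_d9
  have hl2' := Real.log_two_lt_d9
  have hl4 : Real.log 4 = 2 * Real.log 2 := by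
    rw [show (4 : ℝ) = 2 ^ 2 by norm_num, Real.log_pow]; norm_num
  have hy4 : 4 ≤ y := by rw [hl4] at hy; linarith
  have hl0 : 0 ≤ Real.log x := Real.log_nonneg hx1
  have hlog' : 32 * C * Real.log x ≤ y := by
    rw [Real.norm_of_nonneg hl0, Real.norm_of_nonneg hy0.le] at hlog
    rw [one_div, inv_mul_eq_div, le_div_iff₀ (by positivity)] at hlog
    linarith
  have hk1 : y ≤ (⌈y⌉₊ : ℝ) := Nat.le_ceil y
  have hk2 : (⌈y⌉₊ : ℝ) < y + 1 := Nat.ceil_lt_add_one hy0.le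
  have hkε : (⌈y⌉₊ : ℝ) + 1 ≤ x ^ ε := by rw [← hyy]; nlinarith
  have hxε : x ^ ε ≤ x := by
    simpa using Real.rpow_le_rpow_of_exponent_le hx1 hε1.le
  have hp2 : (x ^ (-C)) ^ 2 / 2 = (2 * x ^ (2 * C))⁻¹ := by
    rw [← Real.rpow_natCast, ← Real.rpow_mul hx0.le, mul_inv, ← Real.rpow_neg hx0.le]
    push_cast
    rw [show -C * 2 = -(2 * C) by ring]
    ring
  have hp4 : 1 / ((x ^ (-C)) ^ 2 / 2) ^ 2 = 4 * x ^ (4 * C) := by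
    rw [hp2, inv_pow, one_div, inv_inv, mul_pow, ← Real.rpow_natCast (x ^ _),
      ← Real.rpow_mul hx0.le]
    push_cast
    rw [show 2 * C * 2 = 4 * C by ring]
    norm_num
  have hhle : (h : ℝ) ≤ x ^ (ε / 8) := Nat.floor_le (by positivity)
  have hhge : x ^ (ε / 16) ≤ h := by
    have h1 : x ^ (ε / 8) < h + 1 := Nat.lt_floor_add_one _
    have h2 : x ^ (ε / 16) * x ^ (ε / 16) = x ^ (ε / 8) := by
      rw [← Real.rpow_add hx0]; congr 1; ring
    nlinarith
  refine ⟨⌈y⌉₊, h, by positivity, hnR, ?_, hkε, ?_, hh2, ?_, hpow, ?_, ?_⟩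
  · have : (⌈y⌉₊ : ℝ) + 1 ≤ (n : ℝ) := hkε.trans hxε
    exact_mod_cast this
  · rw [hp2, ← one_div]
    refine one_div_lt_one_div_of_lt (by positivity) ?_
    rw [← Real.log_lt_log_iff (by positivity) (by positivity), Real.log_pow,
      Real.log_mul (by norm_num) (by positivity), Real.log_rpow hx0]
    nlinarith
  · have : (h : ℝ) ≤ (n : ℝ) := hhle.trans (by
      simpa using Real.rpow_le_rpow_of_exponent_le hx1 (show ε / 8 ≤ 1 by linarith))
    exact Nat.cast_le.mp this
  · calc 2 / ((x ^ (-C)) ^ 2 / 2) ^ 2 = 8 * x ^ (4 * C) := by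
          rw [← mul_one_div, hp4]; ring
      _ ≤ x * x ^ (4 * C) := by gcongr
      _ = x ^ (4 * C + 1) := by rw [Real.rpow_add_one hx0.ne', mul_comm]
      _ ≤ x ^ (ε / 16 * R) := Real.rpow_le_rpow_of_exponent_le hx1 hR
      _ = (x ^ (ε / 16)) ^ R := by rw [Real.rpow_mul hx0.le, Real.rpow_natCast]
      _ ≤ (h : ℝ) ^ R := by gcongr
  · rw [hp4, Real.log_mul (by norm_num) (by positivity), Real.log_rpow hx0]
    have hh4 : (h : ℝ) ^ 4 ≤ y := by
      calc (h : ℝ) ^ 4 ≤ (x ^ (ε / 8)) ^ 4 := by gcongr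
        _ = y := by
          rw [← Real.rpow_natCast, ← Real.rpow_mul hx0.le, hydef]
          congr 1
          push_cast
          ring
    have hlog4 : 0 ≤ Real.log 4 := Real.log_nonneg (by norm_num)
    calc (⌈y⌉₊ : ℝ) + 4 * (h : ℝ) ^ 4 * (Real.log 4 + 4 * C * Real.log x)
        ≤ (y + 1) + 4 * y * (Real.log 4 + 4 * C * Real.log x) := by gcongr
      _ ≤ y * (y / 2) + y * (y / 2) := by nlinarith
      _ = x ^ ε := by rw [← hyy]; ring

/-- Structural theorem, non-degenerate case: if `M` is an `(n-1) × (n-1)` symmetric ±1 matrix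
of rank `n - 1` (nonsingular) whose quadratic form of cofactors `a_{ij}` (entries of the adjugate, which
for a symmetric matrix coincides with the cofactor matrix) satisfies
`P(Σ a_{ij} xᵢ xⱼ = 0) ≥ n^{-C}`, then there is a nonzero vector `u` whose coordinates,
except at most `n^ε` of them, lie in a proper symmetric GAP of bounded rank and polynomial
size, all of whose coordinates are rationals with numerator and denominator at most
`n^{c·n^ε}`, and which is orthogonal to at least `n - c·n^ε` rows of `M`. -/
theorem structural_theorem_nondegenerate (ε C : ℝ) (hε0 : 0 < ε) (hε1 : ε < 1) (hC : 0 < C) :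
    ∃ r₀ : ℕ, ∃ c : ℝ, 0 < c ∧ ∃ n₀ : ℕ, ∀ n : ℕ, n₀ ≤ n →
      ∀ M : Matrix (Fin (n - 1)) (Fin (n - 1)) ℝ, M.IsSymm →
        (∀ i j, M i j = 1 ∨ M i j = -1) → M.rank = n - 1 →
        (n : ℝ) ^ (-C) ≤
          probRad (n - 1) (fun x => ∑ i, ∑ j, M.adjugate i j * x i * x j = 0) →
        ∃ u : Fin (n - 1) → ℝ, u ≠ 0 ∧
          (∃ Q : Set ℝ, IsProperSymGAPSet Q r₀ ((n : ℝ) ^ c) ∧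
            ((Finset.univ.filter fun i => u i ∉ Q).card : ℝ) ≤ (n : ℝ) ^ ε) ∧
          (∀ i, ∃ p q : ℤ, q ≠ 0 ∧
            |(p : ℝ)| ≤ (n : ℝ) ^ (c * (n : ℝ) ^ ε) ∧
            |(q : ℝ)| ≤ (n : ℝ) ^ (c * (n : ℝ) ^ ε) ∧ u i = (p : ℝ) / (q : ℝ)) ∧
          ((n : ℝ) - c * (n : ℝ) ^ ε ≤
            ((Finset.univ.filter fun i => ∑ j, M i j * u j = 0).card : ℝ)) := by
  obtain ⟨R, hR⟩ := exists_nat_ge ((4 * C + 1) / (ε / 16))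
  rw [div_le_iff₀' (by positivity)] at hR
  obtain ⟨F, hF⟩ := exists_structured_vector R
  obtain ⟨n₀, hn₀⟩ := Filter.eventually_atTop.mp (eventually_parameters hε0 hε1 hC hR)
  let e : ℕ := F + 2 + (2 * F + 5) * (R + 1) + (F + 2) * (2 ^ R * R)
  refine ⟨R, e, by positivity, n₀, fun n hn M hsymm hM hrank hprob => ?_⟩
  obtain ⟨k, h, hp, hnR, hkn, hkε, hk, hh2, hhn, hhR, hhp, hX⟩ := hn₀ n hn
  obtain ⟨u, hu, X, hXcard, ⟨Q, hQ, huQ⟩, hrat, hrows⟩ := hF (n - 1) k h _ M hsymm hM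
    (Matrix.det_ne_zero_of_rank_eq_card (by rw [hrank, Fintype.card_fin])) hp hprob (by omega)
    hk hh2 hhR hhp
  have hx1 : (1 : ℝ) ≤ n := by exact_mod_cast (by omega : 1 ≤ n)
  have hε1' : 1 ≤ (n : ℝ) ^ ε := Real.one_le_rpow hx1 hε0.le
  have hXε := hXcard.trans hX
  have he1 : (1 : ℝ) ≤ e := by exact_mod_cast (by omega : 1 ≤ e)
  have hheight : (((R + X.card + 1) * h ^ F * ((R + X.card).factorial *
      ((n - 1 + 1) * ((n - 1) * h ^ F) ^ 2) ^ (R + X.card)) : ℕ) : ℝ) ≤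
      (n : ℝ) ^ ((e : ℝ) * (n : ℝ) ^ ε) := by
    have h1 := height_bound_le_pow (F := F) (by omega : n - 1 + 1 = n) hhn hnR
      (by simpa using Finset.card_le_univ X : X.card ≤ n - 1)
    refine (Nat.cast_le.mpr h1).trans ?_
    rw [Nat.cast_pow, ← Real.rpow_natCast]
    refine Real.rpow_le_rpow_of_exponent_le hx1 ?_
    simp only [e]
    push_cast
    have hR0 : (0 : ℝ) ≤ R := R.cast_nonneg
    have h2 : (R : ℝ) + X.card ≤ (R + 1) * (n : ℝ) ^ ε := by nlinarith
    have hF0 : (0 : ℝ) ≤ F := F.cast_nonneg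
    calc (F : ℝ) + 2 + (2 * F + 5) * (R + X.card)
        ≤ (F + 2) * (n : ℝ) ^ ε + (2 * F + 5) * ((R + 1) * (n : ℝ) ^ ε) := by
          gcongr
          nlinarith
      _ = (F + 2 + (2 * F + 5) * (R + 1)) * (n : ℝ) ^ ε := by ring
      _ ≤ _ := mul_le_mul_of_nonneg_right (le_add_of_nonneg_right (by positivity))
          (by positivity)
  refine ⟨u, hu, ⟨Q, hQ.mono le_rfl ?_, ?_⟩, fun j => ?_, ?_⟩
  · have hn4 : 4 ≤ n ^ 2 := by nlinarith [(by omega : 2 ≤ n)]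
    rw [Real.rpow_natCast, ← Nat.cast_pow]
    refine Nat.cast_le.mpr ?_
    calc (4 * h ^ F) ^ (2 ^ R * R) ≤ (n ^ 2 * n ^ F) ^ (2 ^ R * R) := by gcongr
      _ = n ^ ((F + 2) * (2 ^ R * R)) := by rw [← pow_add, ← pow_mul, add_comm 2]
      _ ≤ n ^ e := Nat.pow_le_pow_right (by omega) (by omega)
  · refine le_trans (Nat.cast_le.mpr (Finset.card_le_card fun j hj => ?_)) hXε
    by_contra hjX
    exact (Finset.mem_filter.mp hj).2 (huQ j hjX)
  · obtain ⟨a, b, hb, hab, hbb, huj⟩ := hrat j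
    exact ⟨a, b, hb, le_trans (by exact_mod_cast hab) hheight,
      le_trans (by exact_mod_cast hbb) hheight, huj⟩
  · have h1 : (n : ℝ) ≤
        (Finset.univ.filter fun i => ∑ j, M i j * u j = 0).card + (k + 1) := by
      exact_mod_cast (by omega :
        n ≤ (Finset.univ.filter fun i => ∑ j, M i j * u j = 0).card + (k + 1))
    nlinarith

end
end
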